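/- Let g be the finite-dimensional simple Lie algebra of type E₇ over ℂ. Every nilpotent element e of g with dim g_e = 41 satisfies dim [g_e,g_e] = 40, e ∉ [g_e,g_e], and g_e = [g_e,g_e] + ℂ·e. (The unique nilpotent orbit of E₇ with centralizer dimension 41 is (A₃+A₁)′, which is rigid but not strongly reachable, with (dim g_e, dim[g_e,g_e]) = (41,40).) -/

import Mathlib

/-- The centralizer `g_e` of `e`, i.e. the kernel of `ad e`. -/
noncomputable def centralizer (e : LieAlgebra.e₇ ℂ) : Submodule ℂ (LieAlgebra.e₇ ℂ) :=
  LinearMap.ker (LieAlgebra.ad ℂ (LieAlgebra.e₇ ℂ) e)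

/-- The derived subalgebra `[g_e, g_e]` of the centralizer, as the linear span of all
brackets of pairs of elements of `g_e`. -/
noncomputable def derived (e : LieAlgebra.e₇ ℂ) : Submodule ℂ (LieAlgebra.e₇ ℂ) :=
  Submodule.span ℂ
    {z : LieAlgebra.e₇ ℂ | ∃ x ∈ centralizer e, ∃ y ∈ centralizer e, ⁅x, y⁆ = z}

/-! ### The root system -/

namespace E7

open Module

/-- The Cartan matrix of type E₇. -/
abbrev A : Matrix (Fin 7) (Fin 7) ℤ := CartanMatrix.E₇

/-- The root lattice. -/
abbrev Q := Fin 7 → ℤ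

/-- The simple roots. -/
def sr (i : Fin 7) : Q := Pi.single i 1

/-- The positive roots, in coordinates with respect to the simple roots. -/
def posL : List Q := [
  ![1, 0, 0, 0, 0, 0, 0], ![0, 1, 0, 0, 0, 0, 0], ![0, 0, 1, 0, 0, 0, 0], ![0, 0, 0, 1, 0, 0, 0],
  ![0, 0, 0, 0, 1, 0, 0], ![0, 0, 0, 0, 0, 1, 0], ![0, 0, 0, 0, 0, 0, 1], ![1, 0, 1, 0, 0, 0, 0],
  ![0, 1, 0, 1, 0, 0, 0], ![0, 0, 1, 1, 0, 0, 0], ![0, 0, 0, 1, 1, 0, 0], ![0, 0, 0, 0, 1, 1, 0],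
  ![0, 0, 0, 0, 0, 1, 1], ![1, 0, 1, 1, 0, 0, 0], ![0, 1, 1, 1, 0, 0, 0], ![0, 1, 0, 1, 1, 0, 0],
  ![0, 0, 1, 1, 1, 0, 0], ![0, 0, 0, 1, 1, 1, 0], ![0, 0, 0, 0, 1, 1, 1], ![1, 1, 1, 1, 0, 0, 0],
  ![1, 0, 1, 1, 1, 0, 0], ![0, 1, 1, 1, 1, 0, 0], ![0, 1, 0, 1, 1, 1, 0], ![0, 0, 1, 1, 1, 1, 0],
  ![0, 0, 0, 1, 1, 1, 1], ![1, 1, 1, 1, 1, 0, 0], ![1, 0, 1, 1, 1, 1, 0], ![0, 1, 1, 2, 1, 0, 0],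
  ![0, 1, 1, 1, 1, 1, 0], ![0, 1, 0, 1, 1, 1, 1], ![0, 0, 1, 1, 1, 1, 1], ![1, 1, 1, 2, 1, 0, 0],
  ![1, 1, 1, 1, 1, 1, 0], ![1, 0, 1, 1, 1, 1, 1], ![0, 1, 1, 2, 1, 1, 0], ![0, 1, 1, 1, 1, 1, 1],
  ![1, 1, 2, 2, 1, 0, 0], ![1, 1, 1, 2, 1, 1, 0], ![1, 1, 1, 1, 1, 1, 1], ![0, 1, 1, 2, 2, 1, 0],
  ![0, 1, 1, 2, 1, 1, 1], ![1, 1, 2, 2, 1, 1, 0], ![1, 1, 1, 2, 2, 1, 0], ![1, 1, 1, 2, 1, 1, 1],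
  ![0, 1, 1, 2, 2, 1, 1], ![1, 1, 2, 2, 2, 1, 0], ![1, 1, 2, 2, 1, 1, 1], ![1, 1, 1, 2, 2, 1, 1],
  ![0, 1, 1, 2, 2, 2, 1], ![1, 1, 2, 3, 2, 1, 0], ![1, 1, 2, 2, 2, 1, 1], ![1, 1, 1, 2, 2, 2, 1],
  ![1, 2, 2, 3, 2, 1, 0], ![1, 1, 2, 3, 2, 1, 1], ![1, 1, 2, 2, 2, 2, 1], ![1, 2, 2, 3, 2, 1, 1],
  ![1, 1, 2, 3, 2, 2, 1], ![1, 2, 2, 3, 2, 2, 1], ![1, 1, 2, 3, 3, 2, 1], ![1, 2, 2, 3, 3, 2, 1],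
  ![1, 2, 2, 4, 3, 2, 1], ![1, 2, 3, 4, 3, 2, 1], ![2, 2, 3, 4, 3, 2, 1]]

/-- The pairing of a root lattice element with a simple coroot. -/
def pair (β : Q) (i : Fin 7) : ℤ := ∑ j, β j * A j i

set_option maxRecDepth 100000 in
theorem pos_pair_add : ∀ β ∈ posL, ∀ j, pair β j = -1 → β + sr j ∈ posL := by decide +kernel

theorem pos_pair_not_add : ∀ β ∈ posL, ∀ j, 0 ≤ pair β j → β + sr j ∉ posL := by decide +kernel

theorem pos_pair_sub : ∀ β ∈ posL, ∀ j, pair β j = 1 → β - sr j ∈ posL := by decide +kernel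

theorem pos_pair_cases : ∀ β ∈ posL, ∀ j,
    pair β j = -1 ∨ pair β j = 0 ∨ pair β j = 1 ∨ (pair β j = 2 ∧ β = sr j) := by decide +kernel

theorem pos_exists : ∀ β ∈ posL, (∃ i, β = sr i) ∨ ∃ i, pair β i = 1 := by decide +kernel

end E7

/-! ### Monomials in the Chevalley generators -/

namespace E7

open Module

section Pair

theorem pair_add (β γ : Q) (i : Fin 7) : pair (β + γ) i = pair β i + pair γ i := by
  simp [pair, add_mul, Finset.sum_add_distrib]

theorem pair_neg (β : Q) (i : Fin 7) : pair (-β) i = -pair β i := by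
  simp [pair]

theorem pair_sub (β γ : Q) (i : Fin 7) : pair (β - γ) i = pair β i - pair γ i := by
  rw [sub_eq_add_neg, pair_add, pair_neg, sub_eq_add_neg]

theorem pair_sr (i j : Fin 7) : pair (sr i) j = A i j := by
  simp [pair, sr, Pi.single_apply]

theorem A_symm (i j : Fin 7) : A i j = A j i := by
  fin_cases i <;> fin_cases j <;> rfl

theorem A_self : ∀ i, A i i = 2 := by decide

theorem A_cases (i j : Fin 7) : i = j ∨ A i j = 0 ∨ A i j = -1 := by
  fin_cases i <;> fin_cases j <;> decide

theorem sr_mem : ∀ i, sr i ∈ posL := by decide +kernel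

/-- The height of a root lattice element. -/
def ht (β : Q) : ℤ := ∑ i, β i

theorem ht_add (β γ : Q) : ht (β + γ) = ht β + ht γ := by
  simp [ht, Finset.sum_add_distrib]

theorem ht_sub (β γ : Q) : ht (β - γ) = ht β - ht γ := by
  simp [ht]

theorem ht_sr (i : Fin 7) : ht (sr i) = 1 := by simp [ht, sr]

end Pair

/-- Chevalley generators of type E₇ satisfying the Serre relations. -/
structure SerreSys {L : Type*} [LieRing L] [LieAlgebra ℂ L] (E F H : Fin 7 → L) : Prop where
  hh : ∀ i j, ⁅H i, H j⁆ = 0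
  ef : ∀ i, ⁅E i, F i⁆ = H i
  ef_ne : ∀ i j, i ≠ j → ⁅E i, F j⁆ = 0
  he : ∀ i j, ⁅H i, E j⁆ = (A i j : ℂ) • E j
  hf : ∀ i j, ⁅H i, F j⁆ = -((A i j : ℂ) • F j)
  orthE : ∀ i j, A i j = 0 → ⁅E i, E j⁆ = 0
  adjE : ∀ i j, A i j = -1 → ⁅E i, ⁅E i, E j⁆⁆ = 0
  orthF : ∀ i j, A i j = 0 → ⁅F i, F j⁆ = 0
  adjF : ∀ i j, A i j = -1 → ⁅F i, ⁅F i, F j⁆⁆ = 0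

variable {L : Type*} [LieRing L] [LieAlgebra ℂ L] {E F H : Fin 7 → L}

theorem SerreSys.symm (S : SerreSys E F H) : SerreSys F E (fun i => -H i) where
  hh i j := by simp [S.hh]
  ef i := by rw [← lie_skew, S.ef]
  ef_ne i j h := by rw [← lie_skew, S.ef_ne j i h.symm, neg_zero]
  he i j := by rw [neg_lie, S.hf, neg_neg]
  hf i j := by rw [neg_lie, S.he]
  orthE := S.orthF
  adjE := S.adjF
  orthF := S.orthE
  adjF := S.adjE

/-- Iterated brackets of the generators `E i` with total weight `β`. -/
inductive Mon (E : Fin 7 → L) : Q → L → Prop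
  | base (i : Fin 7) : Mon E (sr i) (E i)
  | step (i : Fin 7) (β : Q) (x : L) : Mon E β x → Mon E (β + sr i) ⁅E i, x⁆

/-- The span of the iterated brackets of weight `β`. -/
def V (E : Fin 7 → L) (β : Q) : Submodule ℂ L := Submodule.span ℂ {x | Mon E β x}

theorem V_base (i : Fin 7) : E i ∈ V E (sr i) := Submodule.subset_span (Mon.base i)

theorem V_step {β γ : Q} {x : L} (i : Fin 7) (h : x ∈ V E β) (hγ : γ = β + sr i) :
    ⁅E i, x⁆ ∈ V E γ := by
  subst hγ
  have : V E β ≤ (V E (β + sr i)).comap (LieAlgebra.ad ℂ L (E i)) := by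
    refine Submodule.span_le.2 fun y hy => ?_
    exact Submodule.subset_span (Mon.step i β y hy)
  exact this h

omit [LieAlgebra ℂ L] in
theorem Mon.ht_pos {β : Q} {x : L} (h : Mon E β x) : 1 ≤ ht β := by
  induction h with
  | base i => rw [ht_sr]
  | step i β x _ ih => rw [ht_add, ht_sr]; omega

omit [LieAlgebra ℂ L] in
theorem Mon.of_sr {β : Q} {x : L} (h : Mon E β x) (i : Fin 7) (hβ : β = sr i) : x = E i := by
  cases h with
  | base j =>
    congr 1
    by_contra hne
    have := congrFun hβ j
    simp [sr, hne] at this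
  | step j β x h =>
    have := h.ht_pos
    have h2 := congrArg ht hβ
    rw [ht_add, ht_sr, ht_sr] at h2
    omega

theorem V_sr {i : Fin 7} {x : L} (h : x ∈ V E (sr i)) : ∃ c : ℂ, x = c • E i := by
  have : V E (sr i) ≤ Submodule.span ℂ {E i} := by
    refine Submodule.span_mono fun y hy => ?_
    exact Mon.of_sr hy i rfl
  obtain ⟨c, hc⟩ := Submodule.mem_span_singleton.1 (this h)
  exact ⟨c, hc.symm⟩

theorem SerreSys.comm_op (S : SerreSys E F H) {i j : Fin 7} (h : A i j = 0) (w : L) :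
    ⁅E i, ⁅E j, w⁆⁆ = ⁅E j, ⁅E i, w⁆⁆ := by
  rw [leibniz_lie, S.orthE i j h, zero_lie, zero_add]

theorem SerreSys.serre_op (S : SerreSys E F H) {i j : Fin 7} (h : A j i = -1) (w : L) :
    ⁅E j, ⁅E j, ⁅E i, w⁆⁆⁆ + ⁅E i, ⁅E j, ⁅E j, w⁆⁆⁆ = (2 : ℂ) • ⁅E j, ⁅E i, ⁅E j, w⁆⁆⁆ := by
  have h1 : ⁅⁅E j, ⁅E j, E i⁆⁆, w⁆ = 0 := by rw [S.adjE j i h, zero_lie]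
  simp only [lie_lie, lie_sub] at h1
  rw [two_smul]
  rw [sub_eq_zero, sub_eq_iff_eq_add] at h1
  rw [h1]
  abel

/-- Multiplicity one and vanishing of the weight spaces, the inductive claim. -/
def Good (E : Fin 7 → L) (β : Q) : Prop :=
  (β ∉ posL → V E β = ⊥) ∧
    ∀ i, pair β i = 1 → V E β ≤ (V E (β - sr i)).map (LieAlgebra.ad ℂ L (E i))

theorem SerreSys.good_step (S : SerreSys E F H) (n : ℤ) (IH : ∀ γ, ht γ < n → Good E γ)
    (β' : Q) (hβ' : ht β' < n) (j : Fin 7) (y : L) (hy : y ∈ V E β') :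
    (β' + sr j ∉ posL → ⁅E j, y⁆ = 0) ∧
    ∀ i, pair (β' + sr j) i = 1 → ∃ w ∈ V E (β' + sr j - sr i), ⁅E j, y⁆ = ⁅E i, w⁆ := by
  have vn : ∀ {γ : Q} {z : L}, ht γ < n → γ ∉ posL → z ∈ V E γ → z = 0 := by
    intro γ z h1 h2 h3
    rw [(IH γ h1).1 h2] at h3
    simpa using h3
  have vd : ∀ {γ : Q} {z : L} (i : Fin 7), ht γ < n → pair γ i = 1 → z ∈ V E γ →
      ∃ w ∈ V E (γ - sr i), z = ⁅E i, w⁆ := by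
    intro γ z i h1 h2 h3
    obtain ⟨w, hw, h⟩ := (IH γ h1).2 i h2 h3
    exact ⟨w, hw, h.symm⟩
  have htj : ∀ γ j, ht (γ + sr j) = ht γ + 1 := fun γ j => by rw [ht_add, ht_sr]
  have htj' : ∀ γ j, ht (γ - sr j) = ht γ - 1 := fun γ j => by rw [ht_sub, ht_sr]
  have pj : ∀ γ j i, pair (γ + sr j) i = pair γ i + A j i := fun γ j i => by
    rw [pair_add, pair_sr]
  have pj' : ∀ γ j i, pair (γ - sr j) i = pair γ i - A j i := fun γ j i => by
    rw [pair_sub, pair_sr]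
  have zero : ⁅E j, y⁆ = 0 → (β' + sr j ∉ posL → ⁅E j, y⁆ = 0) ∧
    ∀ i, pair (β' + sr j) i = 1 → ∃ w ∈ V E (β' + sr j - sr i), ⁅E j, y⁆ = ⁅E i, w⁆ :=
    fun h => ⟨fun _ => h, fun i _ => ⟨0, zero_mem _, by rw [h, lie_zero]⟩⟩
  by_cases hp : β' ∈ posL
  swap
  · exact zero (by rw [vn hβ' hp hy, lie_zero])
  rcases pos_pair_cases β' hp j with hj | hj | hj | ⟨-, hj⟩
  · refine ⟨fun h => absurd (pos_pair_add β' hp j hj) h, fun i hi => ?_⟩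
    rw [pj] at hi
    rcases A_cases i j with rfl | hij | hij
    · exact ⟨y, by simpa using hy, rfl⟩
    · rw [A_symm j i, hij, add_zero] at hi
      obtain ⟨w, hw, rfl⟩ := vd i hβ' hi hy
      refine ⟨⁅E j, w⁆, V_step j hw (by abel), S.comm_op (by rw [A_symm, hij]) w⟩
    · rw [A_symm j i, hij] at hi
      rcases pos_pair_cases β' hp i with h | h | h | ⟨-, h⟩
      · omega
      · omega
      · omega
      · subst h
        obtain ⟨c, rfl⟩ := V_sr hy
        refine ⟨-c • E j, Submodule.smul_mem _ _ ?_, ?_⟩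
        · rw [add_sub_cancel_left]; exact V_base j
        · rw [lie_smul, lie_smul, ← lie_skew, smul_neg, neg_smul]
  · apply zero
    rcases pos_exists β' hp with ⟨i, rfl⟩ | ⟨i, hi⟩
    · obtain ⟨c, rfl⟩ := V_sr hy
      rw [pair_sr, A_symm] at hj
      rw [lie_smul, S.orthE _ _ hj, smul_zero]
    · obtain ⟨z, hz, rfl⟩ := vd i hβ' hi hy
      have hγ := pos_pair_sub β' hp i hi
      rcases A_cases i j with rfl | hij | hij
      · omega
      · rw [S.comm_op (by rw [A_symm, hij])]
        rw [vn (γ := β' - sr i + sr j) (z := ⁅E j, z⁆) (by rw [htj, htj']; omega) _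
          (V_step j hz rfl), lie_zero]
        exact pos_pair_not_add _ hγ j (by rw [pj', hij, hj]; omega)
      · obtain ⟨w, hw, rfl⟩ := vd (γ := β' - sr i) j (by rw [htj']; omega)
          (by rw [pj', hij, hj]; omega) hz
        have h2 := S.serre_op (i := i) (j := j) (by rw [A_symm, hij]) w
        have e1 : ⁅E j, ⁅E j, w⁆⁆ = 0 := by
          refine vn (γ := β' - sr i + sr j) (by rw [htj, htj']; omega) ?_ (V_step j hz rfl)
          exact pos_pair_not_add _ hγ j (by rw [pj', hij, hj]; omega)
        have e2 : ⁅E i, w⁆ = 0 := by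
          refine vn (γ := β' - sr i - sr j + sr i) (by rw [htj, htj', htj']; omega) ?_
            (V_step i hw rfl)
          intro hmem
          have h3 : pair (β' - sr i - sr j + sr i) j = -2 := by
            rw [pj, pj', pj', hj, A_self]; ring
          rcases pos_pair_cases _ hmem j with h | h | h | ⟨h, -⟩ <;> omega
        rw [e1, e2] at h2
        simpa using h2.symm
  · apply zero
    obtain ⟨z, hz, rfl⟩ := vd j hβ' hj hy
    have hκ := pos_pair_sub β' hp j hj
    have hκj : pair (β' - sr j) j = -1 := by rw [pj', hj, A_self]; rfl
    set κ := β' - sr j with hκdef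
    have hκt : ht κ = ht β' - 1 := htj' _ _
    rcases pos_exists κ hκ with ⟨i, h⟩ | ⟨i, hi⟩
    · rw [h] at hz hκj
      obtain ⟨c, rfl⟩ := V_sr hz
      rw [pair_sr, A_symm] at hκj
      rw [lie_smul, lie_smul, S.adjE _ _ hκj, smul_zero]
    · obtain ⟨w, hw, rfl⟩ := vd (γ := κ) i (by omega) hi hz
      have hl := pos_pair_sub κ hκ i hi
      rcases A_cases i j with rfl | hij | hij
      · omega
      · rw [S.comm_op (i := j) (j := i) (by rw [A_symm, hij]),
          S.comm_op (i := j) (j := i) (by rw [A_symm, hij])]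
        have e1 : ⁅E j, ⁅E j, w⁆⁆ = 0 := by
          have hlt : ht (κ - sr i + sr j) < n := by rw [htj, htj']; omega
          by_cases hmem : κ - sr i + sr j ∈ posL
          · refine vn (γ := κ - sr i + sr j + sr j) (by rw [htj, htj, htj']; omega) ?_
              (V_step j (V_step j hw rfl) rfl)
            exact pos_pair_not_add _ hmem j (by rw [pj, pj', hij, hκj, A_self]; omega)
          · rw [vn hlt hmem (V_step j hw rfl), lie_zero]
        rw [e1, lie_zero]
      · have e1 : ⁅E j, w⁆ = 0 := by
          refine vn (γ := κ - sr i + sr j) (by rw [htj, htj']; omega) ?_ (V_step j hw rfl)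
          exact pos_pair_not_add _ hl j (by rw [pj', hij, hκj]; omega)
        have h2 := S.serre_op (i := i) (j := j) (by rw [A_symm, hij]) w
        rw [e1] at h2
        simpa using h2
  · apply zero
    subst hj
    obtain ⟨c, rfl⟩ := V_sr hy
    simp

theorem SerreSys.good (S : SerreSys E F H) (β : Q) : Good E β := by
  have key : ∀ n : ℕ, ∀ β, ht β < n + 1 → Good E β := by
    intro n
    induction n with
    | zero =>
      intro β hβ
      have : V E β = ⊥ := by
        rw [V, Submodule.span_eq_bot]
        intro x hx
        have := hx.ht_pos
        omega
      exact ⟨fun _ => this, fun i _ => by rw [this]; exact bot_le⟩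
    | succ n ih =>
      intro β hβ
      have aux : ∀ x, Mon E β x → (β ∉ posL → x = 0) ∧
          ∀ i, pair β i = 1 → ∃ w ∈ V E (β - sr i), x = ⁅E i, w⁆ := by
        intro x hx
        cases hx with
        | base i =>
          refine ⟨fun h => absurd (sr_mem i) h, fun j hj => ?_⟩
          rw [pair_sr] at hj
          rcases A_cases i j with rfl | h | h
          · rw [A_self] at hj; omega
          · omega
          · omega
        | step i β x h =>
          rw [ht_add, ht_sr] at hβ
          exact S.good_step (n + 1) ih β (by push_cast at hβ; omega) i x
            (Submodule.subset_span h)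
      refine ⟨fun h => ?_, fun i hi => ?_⟩
      · rw [V, Submodule.span_eq_bot]
        exact fun x hx => (aux x hx).1 h
      · refine Submodule.span_le.2 fun x hx => ?_
        obtain ⟨w, hw, h⟩ := (aux x hx).2 i hi
        exact ⟨w, hw, h.symm⟩
  exact key (ht β).toNat β (by omega)

end E7

/-! ### The root space decomposition -/

namespace E7

open Module

variable {L : Type*} [LieRing L] [LieAlgebra ℂ L] {E F H : Fin 7 → L}

/-- The span of the Cartan generators. -/
def hs (H : Fin 7 → L) : Submodule ℂ L := Submodule.span ℂ (Set.range H)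

theorem hs_neg (H : Fin 7 → L) : hs (fun i => -H i) = hs H := by
  have key : ∀ H : Fin 7 → L, hs (fun i => -H i) ≤ hs H := by
    intro H
    refine Submodule.span_le.2 ?_
    rintro _ ⟨i, rfl⟩
    exact Submodule.neg_mem _ (Submodule.subset_span ⟨i, rfl⟩)
  refine le_antisymm (key H) ?_
  simpa using key (fun i => -H i)

theorem H_mem (i : Fin 7) : H i ∈ hs H := Submodule.subset_span ⟨i, rfl⟩

/-- The part of weight `β` in the Borel subalgebra. -/
def N (E H : Fin 7 → L) (β : Q) : Submodule ℂ L := V E β ⊔ ⨆ _ : β = 0, hs H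

theorem V_le_N (β : Q) : V E β ≤ N E H β := le_sup_left

theorem hs_le_N : hs H ≤ N E H 0 := by
  unfold N
  simp

theorem N_le {β : Q} {K : Submodule ℂ L} (h1 : V E β ≤ K) (h2 : β = 0 → hs H ≤ K) :
    N E H β ≤ K := sup_le h1 (iSup_le h2)

theorem SerreSys.V_wt (S : SerreSys E F H) {β : Q} {x : L} (hx : x ∈ V E β) (i : Fin 7) :
    ⁅H i, x⁆ = (pair β i : ℂ) • x := by
  induction hx using Submodule.span_induction with
  | mem x hx =>
    induction hx with
    | base j => rw [S.he, pair_sr, A_symm]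
    | step j β x _ ih =>
      rw [leibniz_lie, S.he, ih, pair_add, pair_sr, A_symm]
      simp only [smul_lie, lie_smul]
      push_cast
      module
  | zero => simp
  | add x y _ _ h1 h2 => simp [h1, h2]
  | smul c x _ h => rw [lie_smul, h, smul_comm]

theorem SerreSys.N_wt (S : SerreSys E F H) {β : Q} {x : L} (hx : x ∈ N E H β) (i : Fin 7) :
    ⁅H i, x⁆ = (pair β i : ℂ) • x := by
  have : N E H β ≤ LinearMap.ker (LieAlgebra.ad ℂ L (H i) - (pair β i : ℂ) • LinearMap.id) := by
    refine N_le ?_ ?_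
    · intro x hx
      simp [S.V_wt hx]
    · rintro rfl
      refine Submodule.span_le.2 ?_
      rintro _ ⟨j, rfl⟩
      simp [S.hh, pair]
  simpa [sub_eq_zero] using this hx

theorem SerreSys.N_step (S : SerreSys E F H) {β : Q} {x : L} (hx : x ∈ N E H β) (i : Fin 7) :
    ⁅E i, x⁆ ∈ N E H (β + sr i) := by
  have : N E H β ≤ (N E H (β + sr i)).comap (LieAlgebra.ad ℂ L (E i)) := by
    refine N_le ?_ ?_
    · intro x hx
      exact V_le_N _ (V_step i hx rfl)
    · rintro rfl
      refine Submodule.span_le.2 ?_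
      rintro _ ⟨j, rfl⟩
      simp only [Submodule.comap_coe, Set.mem_preimage, LieAlgebra.ad_apply, SetLike.mem_coe,
        zero_add]
      rw [← lie_skew, S.he]
      exact neg_mem (Submodule.smul_mem _ _ (V_le_N _ (V_base i)))
  exact this hx

theorem SerreSys.V_back (S : SerreSys E F H) {β : Q} {x : L} (hx : x ∈ V F β) (j : Fin 7) :
    ⁅E j, x⁆ ∈ N F H (β - sr j) := by
  have : ∀ β, V F β ≤ (N F H (β - sr j)).comap (LieAlgebra.ad ℂ L (E j)) := by
    intro β
    refine Submodule.span_le.2 ?_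
    clear hx x
    intro x hx
    simp only [Submodule.comap_coe, Set.mem_preimage, LieAlgebra.ad_apply, SetLike.mem_coe]
    induction hx with
    | base i =>
      by_cases h : j = i
      · subst h
        rw [S.ef, sub_self]
        exact hs_le_N (H_mem j)
      · rw [S.ef_ne j i h]
        exact zero_mem _
    | step i β x hx ih =>
      rw [leibniz_lie]
      refine add_mem ?_ ?_
      · by_cases h : j = i
        · subst h
          rw [S.ef, add_sub_cancel_right]
          have h2 := S.symm.V_wt (Submodule.subset_span hx : x ∈ V F β) j
          rw [neg_lie, neg_eq_iff_eq_neg] at h2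
          rw [h2]
          exact neg_mem (Submodule.smul_mem _ _ (V_le_N _ (Submodule.subset_span hx)))
        · rw [S.ef_ne j i h, zero_lie]
          exact zero_mem _
      · have h2 : β - sr j + sr i = β + sr i - sr j := by abel
        have h3 := S.symm.N_step (x := ⁅E j, x⁆) (β := β - sr j)
          (by rw [N, hs_neg]; exact ih) i
        rw [N, hs_neg, h2] at h3
        exact h3
  exact this β hx

/-- The weight space of weight `β`. -/
def W (E F H : Fin 7 → L) (β : Q) : Submodule ℂ L := N E H β ⊔ N F H (-β)

theorem N_neg : N F (fun i => -H i) = N F H := by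
  funext β
  rw [N, hs_neg, N]

theorem W_swap (β : Q) : W F E (fun i => -H i) β = W E F H (-β) := by
  rw [W, W, N_neg, N_neg, neg_neg, sup_comm]

theorem SerreSys.W_E (S : SerreSys E F H) {β : Q} {x : L} (hx : x ∈ W E F H β) (i : Fin 7) :
    ⁅E i, x⁆ ∈ W E F H (β + sr i) := by
  have : W E F H β ≤ (W E F H (β + sr i)).comap (LieAlgebra.ad ℂ L (E i)) := by
    refine sup_le ?_ (N_le ?_ ?_)
    · intro x hx
      exact le_sup_left (a := N E H (β + sr i)) (S.N_step hx i)
    · intro x hx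
      have h := S.V_back hx i
      have h2 : -β - sr i = -(β + sr i) := by abel
      rw [h2] at h
      exact le_sup_right (a := N E H (β + sr i)) h
    · intro h
      rw [neg_eq_zero] at h
      subst h
      intro x hx
      exact le_sup_left (a := N E H (0 + sr i)) (S.N_step (hs_le_N hx) i)
  exact this hx

theorem SerreSys.W_F (S : SerreSys E F H) {β : Q} {x : L} (hx : x ∈ W E F H β) (i : Fin 7) :
    ⁅F i, x⁆ ∈ W E F H (β - sr i) := by
  have h := S.symm.W_E (β := -β) (x := x) (by rwa [W_swap, neg_neg]) i
  rw [W_swap] at h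
  convert h using 2
  abel

theorem SerreSys.W_H (S : SerreSys E F H) {β : Q} {x : L} (hx : x ∈ W E F H β) (i : Fin 7) :
    ⁅H i, x⁆ = (pair β i : ℂ) • x := by
  have : W E F H β ≤ LinearMap.ker (LieAlgebra.ad ℂ L (H i) - (pair β i : ℂ) • LinearMap.id) := by
    refine sup_le ?_ ?_
    · intro x hx
      simp [S.N_wt hx]
    · intro x hx
      rw [← N_neg] at hx
      have h := S.symm.N_wt hx i
      rw [neg_lie, neg_eq_iff_eq_neg, pair_neg] at h
      simp [h]
  simpa [sub_eq_zero] using this hx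

theorem SerreSys.W_mul (S : SerreSys E F H) {α β : Q} {x y : L} (hx : x ∈ W E F H α)
    (hy : y ∈ W E F H β) : ⁅x, y⁆ ∈ W E F H (α + β) := by
  have hV : ∀ {E F H : Fin 7 → L}, SerreSys E F H → ∀ α x, x ∈ V E α → ∀ β y, y ∈ W E F H β →
      ⁅x, y⁆ ∈ W E F H (α + β) := by
    intro E F H S α x hx
    induction hx using Submodule.span_induction with
    | mem x hx =>
      induction hx with
      | base i =>
        intro β y hy
        rw [add_comm]
        exact S.W_E hy i
      | step i α x hx ih =>
        intro β y hy
        rw [lie_lie]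
        refine sub_mem ?_ ?_
        · convert S.W_E (ih β y hy) i using 1
          congr 1; abel
        · convert ih _ _ (S.W_E hy i) using 1
          congr 1; abel
    | zero => intro β y _; rw [zero_lie]; exact zero_mem _
    | add x y _ _ h1 h2 => intro β z hz; rw [add_lie]; exact add_mem (h1 β z hz) (h2 β z hz)
    | smul c x _ h => intro β z hz; rw [smul_lie]; exact Submodule.smul_mem _ _ (h β z hz)
  have e : ∀ x, (-LieAlgebra.ad ℂ L y : L →ₗ[ℂ] L) x = ⁅x, y⁆ := fun x => lie_skew x y
  have hH : hs H ≤ (W E F H β).comap (-LieAlgebra.ad ℂ L y : L →ₗ[ℂ] L) := by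
    refine Submodule.span_le.2 ?_
    rintro _ ⟨i, rfl⟩
    simp only [Submodule.comap_coe, Set.mem_preimage, e, SetLike.mem_coe]
    rw [S.W_H hy]
    exact Submodule.smul_mem _ _ hy
  have : W E F H α ≤ (W E F H (α + β)).comap (-LieAlgebra.ad ℂ L y : L →ₗ[ℂ] L) := by
    refine sup_le (N_le ?_ ?_) (N_le ?_ ?_)
    · intro x hx
      rw [Submodule.mem_comap, e]
      exact hV S α x hx β y hy
    · rintro rfl
      rwa [zero_add]
    · intro x hx
      rw [Submodule.mem_comap, e]
      have h := hV S.symm (-α) x hx (-β) y (by rwa [W_swap, neg_neg])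
      rwa [W_swap, neg_add, neg_neg, neg_neg] at h
    · intro h
      rw [neg_eq_zero] at h
      subst h
      rwa [zero_add]
  have h := this hx
  rwa [Submodule.mem_comap, e] at h

theorem SerreSys.W_eq_bot (S : SerreSys E F H) {β : Q} (h0 : β ≠ 0) (h1 : β ∉ posL)
    (h2 : -β ∉ posL) : W E F H β = ⊥ := by
  have h0' : -β ≠ 0 := by simpa using h0
  simp [W, N, (S.good β).1 h1, (S.symm.good (-β)).1 h2, h0]

theorem posL_pos : ∀ β ∈ posL, ∃ i, 0 < β i := by decide +kernel

theorem posL_nonneg : ∀ β ∈ posL, ∀ i, 0 ≤ β i := by decide +kernel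

theorem posL_neg {β : Q} (h : β ∈ posL) : -β ∉ posL := by
  intro h2
  obtain ⟨i, hi⟩ := posL_pos β h
  have := posL_nonneg _ h2 i
  simp at this
  omega

theorem posL_ne_zero {β : Q} (h : β ∈ posL) : β ≠ 0 := by
  rintro rfl
  obtain ⟨i, hi⟩ := posL_pos 0 h
  simp at hi

theorem SerreSys.W_pos (S : SerreSys E F H) {β : Q} (h : β ∈ posL) : W E F H β = V E β := by
  have h0 := posL_ne_zero h
  simp [W, N, (S.symm.good (-β)).1 (posL_neg h), h0]

theorem SerreSys.W_neg (S : SerreSys E F H) {β : Q} (h : β ∈ posL) : W E F H (-β) = V F β := by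
  rw [← W_swap, S.symm.W_pos h]

theorem SerreSys.V_zero (S : SerreSys E F H) : V E 0 = ⊥ := by
  refine (S.good 0).1 fun h => posL_ne_zero h rfl

theorem SerreSys.W_zero (S : SerreSys E F H) : W E F H 0 = hs H := by
  simp [W, N, S.V_zero, S.symm.V_zero]

/-- The elements `E i`, `F i` and `H i` generate `L`. -/
def Gen (E F H : Fin 7 → L) : Prop := ∀ K : LieSubalgebra ℂ L,
  (∀ i, E i ∈ K) → (∀ i, F i ∈ K) → (∀ i, H i ∈ K) → K = ⊤

theorem SerreSys.iSup_W (S : SerreSys E F H) (G : Gen E F H) : ⨆ β, W E F H β = ⊤ := by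
  set M := ⨆ β, W E F H β with hM
  have hE : ∀ i, E i ∈ M := fun i => by
    refine Submodule.mem_iSup_of_mem (sr i) ?_
    rw [S.W_pos (sr_mem i)]
    exact V_base i
  have hF : ∀ i, F i ∈ M := fun i => by
    refine Submodule.mem_iSup_of_mem (-sr i) ?_
    rw [S.W_neg (sr_mem i)]
    exact V_base i
  have hH : ∀ i, H i ∈ M := fun i => by
    refine Submodule.mem_iSup_of_mem 0 ?_
    rw [S.W_zero]
    exact H_mem i
  have hlie : ∀ x y, x ∈ M → y ∈ M → ⁅x, y⁆ ∈ M := by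
    intro x y hx hy
    induction hx using Submodule.iSup_induction' with
    | mem α x hx =>
      induction hy using Submodule.iSup_induction' with
      | mem β y hy => exact Submodule.mem_iSup_of_mem _ (S.W_mul hx hy)
      | zero => rw [lie_zero]; exact zero_mem _
      | add y z _ _ h1 h2 => rw [lie_add]; exact add_mem h1 h2
    | zero => rw [zero_lie]; exact zero_mem _
    | add x z _ _ h1 h2 => rw [add_lie]; exact add_mem h1 h2
  have h := G { M with lie_mem' := fun {x y} hx hy => hlie x y hx hy } hE hF hH
  rw [eq_top_iff]
  intro x _
  have hx : x ∈ (⊤ : LieSubalgebra ℂ L) := trivial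
  rw [← h] at hx
  exact hx

theorem SerreSys.E_ne_zero [Nontrivial L] (S : SerreSys E F H) (G : Gen E F H) (i : Fin 7) :
    E i ≠ 0 := by
  intro hi
  have hH : ∀ i, E i = 0 → H i = 0 := fun i h => by rw [← S.ef, h, zero_lie]
  have hadj : ∀ i j, A i j = -1 → E i = 0 → E j = 0 := by
    intro i j h h0
    have h2 := S.he i j
    rw [hH i h0, zero_lie, h] at h2
    simpa using h2.symm
  have a1 := hadj 0 2 rfl
  have a2 := hadj 2 0 rfl
  have a3 := hadj 2 3 rfl
  have a4 := hadj 3 2 rfl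
  have a5 := hadj 1 3 rfl
  have a6 := hadj 3 1 rfl
  have a7 := hadj 3 4 rfl
  have a8 := hadj 4 3 rfl
  have a9 := hadj 4 5 rfl
  have b1 := hadj 5 4 rfl
  have b2 := hadj 5 6 rfl
  have b3 := hadj 6 5 rfl
  have all : ∀ j, E j = 0 := by
    have h3 : E 3 = 0 := by
      fin_cases i
      exacts [a3 (a1 hi), a5 hi, a3 hi, hi, a8 hi, a8 (b1 hi), a8 (b1 (b3 hi))]
    intro j
    fin_cases j
    exacts [a2 (a4 h3), a6 h3, a4 h3, h3, a7 h3, a9 (a7 h3), b2 (a9 (a7 h3))]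
  have allF : ∀ j, F j = 0 := by
    intro j
    have h2 := S.hf j j
    rw [hH j (all j), zero_lie, A_self] at h2
    simpa using h2.symm
  have h := G ⊥ (by simpa using all) (by simpa using allF) (by simpa using fun i => hH i (all i))
  obtain ⟨x, hx⟩ := exists_ne (0 : L)
  have hx2 : x ∈ (⊤ : LieSubalgebra ℂ L) := trivial
  rw [← h] at hx2
  exact hx (by simpa using hx2)

end E7

/-! ### Frames -/

namespace E7

open Module

/-- Twice the inverse of the Cartan matrix. -/
def B : Matrix (Fin 7) (Fin 7) ℤ :=
  !![4, 4, 6, 8, 6, 4, 2; 4, 7, 8, 12, 9, 6, 3; 6, 8, 12, 16, 12, 8, 4; 8, 12, 16, 24, 18, 12, 6;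
    6, 9, 12, 18, 15, 10, 5; 4, 6, 8, 12, 10, 8, 4; 2, 3, 4, 6, 5, 4, 3]

theorem A_mul_B (i j : Fin 7) : ∑ k, A i k * B k j = if i = j then 2 else 0 := by
  fin_cases i <;> fin_cases j <;> decide

theorem B_mul_A (i j : Fin 7) : ∑ k, B i k * A k j = if i = j then 2 else 0 := by
  fin_cases i <;> fin_cases j <;> decide

/-- The value of a root lattice element at the coweight with coordinates `a`. -/
def ev (a : Fin 7 → ℂ) (β : Q) : ℂ := ∑ i, (β i : ℂ) * a i

/-- The predicate of being a root. -/
def IsRt (β : Q) : Prop := β ∈ posL ∨ -β ∈ posL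

instance : DecidablePred IsRt := fun _ => inferInstanceAs (Decidable (_ ∨ _))

theorem IsRt.neg {β : Q} (h : IsRt β) : IsRt (-β) := by
  unfold IsRt at *
  rw [neg_neg]
  exact h.symm

/-- A Chevalley type frame of a Lie algebra of type E₇. -/
structure Frame {L : Type*} [LieRing L] [LieAlgebra ℂ L] (x : Q → L)
    (h : (Fin 7 → ℂ) →ₗ[ℂ] L) : Prop where
  x_ne : ∀ β, x β ≠ 0 ↔ IsRt β
  h_x : ∀ a β, ⁅h a, x β⁆ = ev a β • x β
  h_h : ∀ a b, ⁅h a, h b⁆ = 0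
  x_neg : ∀ β, IsRt β → ∃ c : ℂ, c ≠ 0 ∧ ⁅x β, x (-β)⁆ = c • h (fun i => (pair β i : ℂ))
  x_add : ∀ α β, α + β ≠ 0 → ∃ c : ℂ, ⁅x α, x β⁆ = c • x (α + β)
  span : Submodule.span ℂ (Set.range x) ⊔ LinearMap.range h = ⊤

variable {L : Type*} [LieRing L] [LieAlgebra ℂ L] {E F H : Fin 7 → L}

/-- The element of the Cartan subalgebra on which the simple roots have prescribed values. -/
noncomputable def hOf (H : Fin 7 → L) : (Fin 7 → ℂ) →ₗ[ℂ] L :=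
  ∑ i, ∑ j, ((B i j : ℂ) / 2) • (LinearMap.proj j : (Fin 7 → ℂ) →ₗ[ℂ] ℂ).smulRight (H i)

theorem hOf_apply (a : Fin 7 → ℂ) :
    hOf H a = ∑ i, (∑ j, (B i j : ℂ) / 2 * a j) • H i := by
  simp [hOf, LinearMap.sum_apply, Finset.sum_smul, mul_smul]

theorem hOf_A (i : Fin 7) : hOf H (fun j => (A i j : ℂ)) = H i := by
  rw [hOf_apply]
  have : ∀ k, (∑ j, (B k j : ℂ) / 2 * (A i j : ℂ)) = if k = i then 1 else 0 := by
    intro k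
    have h2 : ((∑ j, B k j * A j i : ℤ) : ℂ) = ((if k = i then 2 else 0 : ℤ) : ℂ) := by
      rw [B_mul_A]
    push_cast at h2
    have h3 : (∑ j, (B k j : ℂ) / 2 * (A i j : ℂ)) = (∑ j, (B k j : ℂ) * (A j i : ℂ)) / 2 := by
      rw [Finset.sum_div]
      refine Finset.sum_congr rfl fun j _ => ?_
      rw [A_symm i j]
      ring
    rw [h3, h2]
    split_ifs <;> simp
  simp [this]

theorem hOf_pair (β : Q) : hOf H (fun j => (pair β j : ℂ)) = ∑ k, (β k : ℂ) • H k := by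
  have : (fun j => (pair β j : ℂ)) = ∑ k, (β k : ℂ) • (fun j => (A k j : ℂ)) := by
    funext j
    simp [pair]
  rw [this, map_sum]
  simp [hOf_A]

theorem SerreSys.hOf_W (S : SerreSys E F H) {β : Q} {x : L} (hx : x ∈ W E F H β)
    (a : Fin 7 → ℂ) : ⁅hOf H a, x⁆ = ev a β • x := by
  rw [hOf_apply, sum_lie]
  simp only [smul_lie, S.W_H hx, smul_smul]
  rw [← Finset.sum_smul]
  congr 1
  have h1 : ∀ j k : Fin 7, ∑ i, (A k i : ℂ) * (B i j : ℂ) = if k = j then 2 else 0 := by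
    intro j k
    have := congrArg (Int.cast : ℤ → ℂ) (A_mul_B k j)
    push_cast at this
    exact this
  calc ∑ i, (∑ j, (B i j : ℂ) / 2 * a j) * (pair β i : ℂ)
      = ∑ i, ∑ j, ∑ k, (β k : ℂ) * a j / 2 * ((A k i : ℂ) * (B i j : ℂ)) := by
        refine Finset.sum_congr rfl fun i _ => ?_
        rw [Finset.sum_mul]
        refine Finset.sum_congr rfl fun j _ => ?_
        simp only [pair, Int.cast_sum, Int.cast_mul, Finset.mul_sum]
        exact Finset.sum_congr rfl fun k _ => by ring
    _ = ∑ j, ∑ k, ∑ i, (β k : ℂ) * a j / 2 * ((A k i : ℂ) * (B i j : ℂ)) := by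
        rw [Finset.sum_comm]
        exact Finset.sum_congr rfl fun j _ => Finset.sum_comm
    _ = ∑ j, ∑ k, (β k : ℂ) * a j / 2 * (if k = j then 2 else 0) := by
        simp only [← Finset.mul_sum, h1]
    _ = ev a β := by simp [ev]

theorem SerreSys.exists_pair [Nontrivial L] (S : SerreSys E F H) (G : Gen E F H) :
    ∀ n : ℕ, ∀ β ∈ posL, ht β < n → ∃ e f : L, e ≠ 0 ∧ f ≠ 0 ∧ V E β = Submodule.span ℂ {e} ∧
      V F β = Submodule.span ℂ {f} ∧ ∃ c : ℂ, c ≠ 0 ∧ ⁅e, f⁆ = c • ∑ k, (β k : ℂ) • H k := by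
  have G' : Gen F E (fun i => -H i) := fun K h1 h2 h3 =>
    G K h2 h1 (fun i => by simpa using h3 i)
  have hne : ∀ i, E i ≠ 0 := S.E_ne_zero G
  have hne' : ∀ i, F i ≠ 0 := S.symm.E_ne_zero G'
  have hsr : ∀ (E : Fin 7 → L) i, V E (sr i) = Submodule.span ℂ {E i} := fun E i =>
    le_antisymm (fun x hx => by
      obtain ⟨c, rfl⟩ := V_sr hx
      exact Submodule.smul_mem _ _ (Submodule.mem_span_singleton_self _))
      ((Submodule.span_singleton_le_iff_mem _ _).2 (V_base i))
  intro n
  induction n with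
  | zero =>
    intro β hβ h
    have : 0 ≤ ht β := Finset.sum_nonneg fun i _ => posL_nonneg β hβ i
    simp at h
    omega
  | succ n ih =>
    intro β hβ hn
    rcases pos_exists β hβ with ⟨i, rfl⟩ | ⟨i, hi⟩
    · refine ⟨E i, F i, hne i, hne' i, hsr E i, hsr F i, 1, one_ne_zero, ?_⟩
      rw [S.ef]
      simp [sr, Pi.single_apply]
    · have hγ := pos_pair_sub β hβ i hi
      obtain ⟨γ, rfl⟩ : ∃ γ, β = γ + sr i := ⟨β - sr i, by abel⟩
      rw [add_sub_cancel_right] at hγ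
      have hi' := hi
      rw [pair_add, pair_sr, A_self] at hi'
      have hγi : pair γ i = -1 := by omega
      rw [ht_add, ht_sr] at hn
      obtain ⟨e, f, he, hf, hE, hF, c, hc, hef⟩ := ih γ hγ (by push_cast at hn; omega)
      have heV : e ∈ V E γ := hE ▸ Submodule.mem_span_singleton_self e
      have hfV : f ∈ V F γ := hF ▸ Submodule.mem_span_singleton_self f
      have heW : e ∈ W E F H γ := by rw [S.W_pos hγ]; exact heV
      have hfW : f ∈ W E F H (-γ) := by rw [S.W_neg hγ]; exact hfV
      have hp : pair (γ - sr i) i = -3 := by rw [pair_sub, pair_sr, A_self, hγi]; rfl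
      have n1 : γ - sr i ∉ posL := fun h => by
        rcases pos_pair_cases _ h i with h | h | h | ⟨h, -⟩ <;> omega
      have n2 : -(γ - sr i) ∉ posL := fun h => by
        rcases pos_pair_cases _ h i with h | h | h | ⟨h, -⟩ <;> rw [pair_neg] at h <;> omega
      have n0 : γ - sr i ≠ 0 := fun h => by rw [h] at hp; simp [pair] at hp
      have Fe : ⁅F i, e⁆ = 0 := by
        have h := S.W_F heW i
        rw [S.W_eq_bot n0 n1 n2] at h
        simpa using h
      have Ef : ⁅E i, f⁆ = 0 := by
        have h := S.W_E hfW i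
        have h2 : -γ + sr i = -(γ - sr i) := by abel
        rw [h2, S.W_eq_bot (neg_ne_zero.2 n0) n2 (by simpa using n1)] at h
        simpa using h
      have He : ⁅H i, e⁆ = -e := by rw [S.W_H heW, hγi]; simp
      have Hf : ⁅H i, f⁆ = f := by rw [S.W_H hfW, pair_neg, hγi]; simp
      have k1 : ⁅F i, ⁅E i, e⁆⁆ = e := by
        rw [leibniz_lie, Fe, lie_zero, add_zero, ← lie_skew (F i) (E i), S.ef, neg_lie, He, neg_neg]
      have k2 : ⁅E i, ⁅F i, f⁆⁆ = f := by
        rw [leibniz_lie, Ef, lie_zero, add_zero, S.ef, Hf]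
      have gen : ∀ {E F H : Fin 7 → L}, SerreSys E F H → ∀ e, V E γ = Submodule.span ℂ {e} →
          V E (γ + sr i) = Submodule.span ℂ {⁅E i, e⁆} := by
        intro E F H S e h
        have h2 := (S.good (γ + sr i)).2 i hi
        rw [add_sub_cancel_right, h, Submodule.map_span, Set.image_singleton] at h2
        refine le_antisymm h2 ((Submodule.span_singleton_le_iff_mem _ _).2 ?_)
        exact V_step i (h ▸ Submodule.mem_span_singleton_self e) rfl
      refine ⟨⁅E i, e⁆, ⁅F i, f⁆, fun h => he (by rw [← k1, h, lie_zero]),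
        fun h => hf (by rw [← k2, h, lie_zero]), gen S e hE, gen S.symm f hF, -c, by simpa, ?_⟩
      have m1 : ⁅⁅E i, e⁆, F i⁆ = -e := by rw [← lie_skew, k1]
      have m2 : ⁅⁅E i, e⁆, f⁆ = c • E i := by
        rw [lie_lie, Ef, lie_zero, sub_zero, hef, ← hOf_pair, ← lie_skew, smul_lie,
          S.hOf_W (β := sr i) (by rw [S.W_pos (sr_mem i)]; exact V_base i)]
        have : ev (fun j => (pair γ j : ℂ)) (sr i) = -1 := by
          simp [ev, sr, Pi.single_apply, hγi]
        rw [this]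
        simp
      rw [leibniz_lie, m1, m2, neg_lie, hef, lie_smul, ← lie_skew, S.ef]
      simp only [Pi.add_apply, Int.cast_add, add_smul, Finset.sum_add_distrib]
      simp [sr, Pi.single_apply]

theorem SerreSys.exists_frame [Nontrivial L] (S : SerreSys E F H) (G : Gen E F H) :
    ∃ x : Q → L, Frame x (hOf H) := by
  have key : ∀ β, β ∈ posL → ∃ e f : L, e ≠ 0 ∧ f ≠ 0 ∧ V E β = Submodule.span ℂ {e} ∧
      V F β = Submodule.span ℂ {f} ∧ ∃ c : ℂ, c ≠ 0 ∧ ⁅e, f⁆ = c • ∑ k, (β k : ℂ) • H k :=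
    fun β hβ => S.exists_pair G ((ht β).toNat + 1) β hβ (by push_cast; omega)
  choose! e f he hf hE hF c hc hef using key
  set x : Q → L := fun β => if β ∈ posL then e β else if -β ∈ posL then f (-β) else 0 with hx
  have xpos : ∀ β, β ∈ posL → x β = e β := fun β hβ => by simp [hx, hβ]
  have xneg : ∀ β, β ∈ posL → x (-β) = f β := fun β hβ => by simp [hx, hβ, posL_neg hβ]
  have xW : ∀ β, β ≠ 0 → W E F H β = Submodule.span ℂ {x β} := by
    intro β h0
    by_cases h1 : β ∈ posL
    · rw [S.W_pos h1, xpos β h1, hE β h1]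
    · by_cases h2 : -β ∈ posL
      · have h3 := S.W_neg h2
        have h4 := xneg _ h2
        rw [neg_neg] at h3 h4
        rw [h3, h4, hF _ h2]
      · rw [S.W_eq_bot h0 h1 h2]
        simp [hx, h1, h2]
  have x0 : x 0 = 0 := by
    have h0 : (0 : Q) ∉ posL := fun h => posL_ne_zero h rfl
    simp [hx, h0]
  have xmem : ∀ β, x β ∈ W E F H β := by
    intro β
    by_cases h0 : β = 0
    · rw [h0, x0]; exact zero_mem _
    · rw [xW β h0]; exact Submodule.mem_span_singleton_self _
  refine ⟨x, ?_, ?_, ?_, ?_, ?_, ?_⟩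
  · intro β
    constructor
    · intro h
      by_contra hβ
      simp only [IsRt, not_or] at hβ
      exact h (by simp [hx, hβ])
    · rintro (h | h)
      · rw [xpos β h]; exact he β h
      · have := xneg _ h
        rw [neg_neg] at this
        rw [this]; exact hf _ h
  · intro a β
    exact S.hOf_W (xmem β) a
  · intro a b
    rw [hOf_apply b, lie_sum]
    refine Finset.sum_eq_zero fun i _ => ?_
    rw [lie_smul, S.hOf_W (β := 0) (by rw [S.W_zero]; exact H_mem i)]
    simp [ev]
  · rintro β (h | h)
    · rw [xpos β h, xneg β h, hOf_pair]
      exact ⟨c β, hc β h, hef β h⟩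
    · have h2 := xneg _ h
      rw [neg_neg] at h2
      rw [h2, xpos _ h, ← lie_skew, hef _ h, ← hOf_pair]
      refine ⟨c (-β), hc _ h, ?_⟩
      rw [← smul_neg, ← map_neg]
      congr 2
      funext i
      simp [pair_neg]
  · intro α β h
    have h2 := S.W_mul (xmem α) (xmem β)
    rw [xW _ h] at h2
    obtain ⟨c, hc⟩ := Submodule.mem_span_singleton.1 h2
    exact ⟨c, hc.symm⟩
  · rw [eq_top_iff, ← S.iSup_W G]
    refine iSup_le fun β => ?_
    by_cases h0 : β = 0
    · rw [h0, S.W_zero]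
      refine le_trans ?_ le_sup_right
      refine Submodule.span_le.2 ?_
      rintro _ ⟨i, rfl⟩
      exact ⟨_, hOf_A i⟩
    · rw [xW β h0]
      refine le_trans ?_ le_sup_left
      exact Submodule.span_mono (by rintro _ rfl; exact ⟨β, rfl⟩)

end E7

/-! ### The Lie algebra of type E₇ -/

namespace E7

open Module

open CartanMatrix in
/-- The quotient map from the free Lie algebra. -/
noncomputable def proj7 : FreeLieAlgebra ℂ (Generators (Fin 7)) →ₗ⁅ℂ⁆ LieAlgebra.e₇ ℂ where
  toFun x := (LieSubmodule.Quotient.mk x :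
    FreeLieAlgebra ℂ (Generators (Fin 7)) ⧸ Relations.toIdeal ℂ CartanMatrix.E₇)
  map_add' _ _ := rfl
  map_smul' _ _ := rfl
  map_lie' := rfl

theorem proj7_surj : Function.Surjective proj7 := by
  intro y
  obtain ⟨x, hx⟩ := Submodule.Quotient.mk_surjective
    (CartanMatrix.Relations.toIdeal ℂ CartanMatrix.E₇).toSubmodule y
  exact ⟨x, hx⟩

open CartanMatrix in
theorem proj7_rel {x : FreeLieAlgebra ℂ (Generators (Fin 7))}
    (hx : x ∈ Relations.toSet ℂ CartanMatrix.E₇) : proj7 x = 0 := by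
  have : x ∈ Relations.toIdeal ℂ CartanMatrix.E₇ := LieSubmodule.subset_lieSpan hx
  exact (Submodule.Quotient.mk_eq_zero (Relations.toIdeal ℂ CartanMatrix.E₇).toSubmodule).2 this

open CartanMatrix in
/-- A generator of the Lie algebra of type E₇. -/
noncomputable def gen7 (g : Generators (Fin 7)) : LieAlgebra.e₇ ℂ := proj7 (FreeLieAlgebra.of ℂ g)

open CartanMatrix in
theorem gen7_gen : Gen (fun i => gen7 (.E i)) (fun i => gen7 (.F i)) (fun i => gen7 (.H i)) := by
  intro K hE hF hH
  have hK : ∀ g, gen7 g ∈ K := by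
    rintro (i | i | i)
    exacts [hH i, hE i, hF i]
  let φ : FreeLieAlgebra ℂ (Generators (Fin 7)) →ₗ⁅ℂ⁆ K :=
    FreeLieAlgebra.lift ℂ (fun g => ⟨gen7 g, hK g⟩)
  have h : K.incl.comp φ = proj7 := by
    ext g
    simp [φ, gen7]
  rw [eq_top_iff]
  intro y _
  obtain ⟨x, rfl⟩ := proj7_surj y
  rw [← h]
  exact (φ x).2

open CartanMatrix CartanMatrix.Relations in
theorem serreSys7 :
    SerreSys (fun i => gen7 (.E i)) (fun i => gen7 (.F i)) (fun i => gen7 (.H i)) := by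
  have HH' : ∀ i j, proj7 (HH ℂ (i, j)) = 0 := fun i j => proj7_rel (by simp [toSet])
  have EF' : ∀ i j, proj7 (EF ℂ (i, j)) = 0 := fun i j => proj7_rel (by simp [toSet])
  have HE' : ∀ i j, proj7 (HE ℂ CartanMatrix.E₇ (i, j)) = 0 := fun i j =>
    proj7_rel (by simp [toSet])
  have HF' : ∀ i j, proj7 (HF ℂ CartanMatrix.E₇ (i, j)) = 0 := fun i j =>
    proj7_rel (by simp [toSet])
  have adE' : ∀ i j, proj7 (adE ℂ CartanMatrix.E₇ (i, j)) = 0 := fun i j =>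
    proj7_rel (by simp [toSet])
  have adF' : ∀ i j, proj7 (adF ℂ CartanMatrix.E₇ (i, j)) = 0 := fun i j =>
    proj7_rel (by simp [toSet])
  refine ⟨?_, ?_, ?_, ?_, ?_, ?_, ?_, ?_, ?_⟩
  · intro i j
    simpa [HH, gen7] using HH' i j
  · intro i
    simpa [EF, gen7, sub_eq_zero] using EF' i i
  · intro i j h
    simpa [EF, gen7, h] using EF' i j
  · intro i j
    have h := HE' i j
    simp only [HE, Function.uncurry, Function.comp, map_sub, LieHom.map_lie, sub_eq_zero] at h
    rw [Int.cast_smul_eq_zsmul]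
    simp only [gen7]
    rw [← map_zsmul]
    exact h
  · intro i j
    have h := HF' i j
    simp only [HF, Function.uncurry, Function.comp, map_add, LieHom.map_lie,
      add_eq_zero_iff_eq_neg] at h
    rw [Int.cast_smul_eq_zsmul]
    simp only [gen7]
    rw [← map_zsmul]
    exact h
  · intro i j h
    have h2 := adE' i j
    have h3 : (-CartanMatrix.E₇ i j).toNat = 0 := by
      change (-A i j).toNat = 0
      rw [h]; rfl
    simpa [adE, h3, gen7] using h2
  · intro i j h
    have h2 := adE' i j
    have h3 : (-CartanMatrix.E₇ i j).toNat = 1 := by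
      change (-A i j).toNat = 1
      rw [h]; rfl
    simpa [adE, h3, gen7] using h2
  · intro i j h
    have h2 := adF' i j
    have h3 : (-CartanMatrix.E₇ i j).toNat = 0 := by
      change (-A i j).toNat = 0
      rw [h]; rfl
    simpa [adF, h3, gen7] using h2
  · intro i j h
    have h2 := adF' i j
    have h3 : (-CartanMatrix.E₇ i j).toNat = 1 := by
      change (-A i j).toNat = 1
      rw [h]; rfl
    simpa [adF, h3, gen7] using h2

theorem exists_frame7 [Nontrivial (LieAlgebra.e₇ ℂ)] :
    ∃ (x : Q → LieAlgebra.e₇ ℂ) (h : (Fin 7 → ℂ) →ₗ[ℂ] LieAlgebra.e₇ ℂ), Frame x h :=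
  let ⟨x, hx⟩ := serreSys7.exists_frame gen7_gen
  ⟨x, _, hx⟩

end E7

/-! ### Coordinates with respect to a frame -/

namespace E7

open Module

theorem posL_nodup : posL.Nodup := by decide +kernel

theorem posL_le : ∀ β ∈ posL, ∀ i, β i ≤ 4 := by decide +kernel

/-- The list of all roots. -/
def rtL : List Q := posL ++ posL.map Neg.neg

theorem isRt_iff {β : Q} : IsRt β ↔ β ∈ posL ∨ -β ∈ posL := Iff.rfl

theorem mem_rtL {β : Q} : β ∈ rtL ↔ IsRt β := by
  simp only [rtL, List.mem_append, List.mem_map, IsRt]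
  refine or_congr_right ⟨?_, fun h => ⟨_, h, neg_neg β⟩⟩
  rintro ⟨γ, h, rfl⟩
  rwa [neg_neg]

theorem rtL_nodup : rtL.Nodup := by
  refine List.Nodup.append posL_nodup (posL_nodup.map neg_injective) ?_
  intro β h1 h2
  obtain ⟨γ, h, rfl⟩ := List.mem_map.1 h2
  exact posL_neg h h1

attribute [irreducible] rtL

theorem mem_rtF {β : Q} : β ∈ rtL.toFinset ↔ IsRt β := by
  rw [List.mem_toFinset, mem_rtL]

/-- The type of roots. -/
abbrev Rt := {β : Q // IsRt β}

instance : Fintype Rt := Fintype.subtype rtL.toFinset (fun _ => mem_rtF)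

theorem sum_Rt {M : Type*} [AddCommMonoid M] (f : Q → M) :
    ∑ β : Rt, f β.1 = (posL.map fun β => f β + f (-β)).sum := by
  have h1 : ∑ β : Rt, f β.1 = ∑ β ∈ rtL.toFinset, f β :=
    (Finset.sum_subtype rtL.toFinset (fun _ => mem_rtF) f).symm
  rw [h1, List.sum_toFinset f rtL_nodup, rtL, List.map_append, List.sum_append, List.map_map,
    List.sum_map_add]
  rfl

theorem card_Rt : Fintype.card Rt = 126 := by
  have h := sum_Rt (fun _ => 1)
  rw [Finset.sum_const, Finset.card_univ, smul_eq_mul, mul_one] at h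
  rw [h, List.map_const', List.sum_replicate]
  decide +kernel

theorem IsRt.ne_zero {β : Q} (h : IsRt β) : β ≠ 0 := by
  rw [isRt_iff] at h
  rcases h with h | h
  · exact posL_ne_zero h
  · exact neg_ne_zero.1 (posL_ne_zero h)

theorem IsRt.bounds {β : Q} (h : IsRt β) (i : Fin 7) : -4 ≤ β i ∧ β i ≤ 4 := by
  rw [isRt_iff] at h
  rcases h with h | h
  · have := posL_le β h i
    have := posL_nonneg β h i
    omega
  · have := posL_le _ h i
    have := posL_nonneg _ h i
    simp only [Pi.neg_apply] at *
    omega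

/-- A generic coweight. -/
def gnr : Fin 7 → ℂ := ![1, 100, 10000, 1000000, 100000000, 10000000000, 1000000000000]

theorem ev_gnr (β : Q) : ev gnr β = ((β 0 + 100 * β 1 + 10000 * β 2 + 1000000 * β 3 +
    100000000 * β 4 + 10000000000 * β 5 + 1000000000000 * β 6 : ℤ) : ℂ) := by
  simp [ev, gnr, Fin.sum_univ_succ]
  ring

theorem ev_gnr_inj {β γ : Q} (hβ : ∀ i, -4 ≤ β i ∧ β i ≤ 4) (hγ : ∀ i, -4 ≤ γ i ∧ γ i ≤ 4)
    (h : ev gnr β = ev gnr γ) : β = γ := by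
  rw [ev_gnr, ev_gnr, Int.cast_inj] at h
  have a0 := hβ 0
  have a1 := hβ 1
  have a2 := hβ 2
  have a3 := hβ 3
  have a4 := hβ 4
  have a5 := hβ 5
  have a6 := hβ 6
  have b0 := hγ 0
  have b1 := hγ 1
  have b2 := hγ 2
  have b3 := hγ 3
  have b4 := hγ 4
  have b5 := hγ 5
  have b6 := hγ 6
  funext i
  have h6 : β 6 = γ 6 := by omega
  have h5 : β 5 = γ 5 := by omega
  have h4 : β 4 = γ 4 := by omega
  have h3 : β 3 = γ 3 := by omega
  have h2 : β 2 = γ 2 := by omega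
  have h1 : β 1 = γ 1 := by omega
  have h0 : β 0 = γ 0 := by omega
  fin_cases i
  exacts [h0, h1, h2, h3, h4, h5, h6]

@[simp] theorem ev_zero (a : Fin 7 → ℂ) : ev a 0 = 0 := by simp [ev]

theorem ev_neg (a : Fin 7 → ℂ) (β : Q) : ev a (-β) = -ev a β := by simp [ev]

theorem ev_sr (a : Fin 7 → ℂ) (i : Fin 7) : ev a (sr i) = a i := by
  simp [ev, sr, Pi.single_apply]

theorem ev_single (β : Q) (i : Fin 7) : ev (Pi.single i 1) β = β i := by
  simp [ev, Pi.single_apply]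

theorem ev_gnr_ne {β : Q} (h : IsRt β) : ev gnr β ≠ 0 := by
  intro h2
  refine h.ne_zero (ev_gnr_inj h.bounds (fun i => ?_) (h2.trans (ev_zero _).symm))
  simp

theorem isRt_sr (i : Fin 7) : IsRt (sr i) := isRt_iff.2 (Or.inl (sr_mem i))

namespace Frame

variable {L : Type*} [LieRing L] [LieAlgebra ℂ L] {x : Q → L} {h : (Fin 7 → ℂ) →ₗ[ℂ] L}

theorem h_inj (S : Frame x h) : Function.Injective h := by
  rw [injective_iff_map_eq_zero]
  intro a ha
  funext i
  have h1 := S.h_x a (sr i)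
  rw [ha, zero_lie, ev_sr] at h1
  rcases smul_eq_zero.1 h1.symm with h2 | h2
  · exact h2
  · exact absurd h2 ((S.x_ne _).2 (isRt_sr i))

theorem x_indep (S : Frame x h) : LinearIndependent ℂ (fun β : Rt => x β.1) := by
  refine Module.End.eigenvectors_linearIndependent' (LieAlgebra.ad ℂ L (h gnr))
    (fun β : Rt => ev gnr β.1) ?_ _ ?_
  · intro β γ hβγ
    exact Subtype.ext (ev_gnr_inj β.2.bounds γ.2.bounds hβγ)
  · intro β
    exact Module.End.hasEigenvector_iff.2 ⟨Module.End.mem_eigenspace_iff.2 (S.h_x _ _),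
      (S.x_ne _).2 β.2⟩

theorem disj (S : Frame x h) :
    Disjoint (LinearMap.range h) (Submodule.span ℂ (Set.range fun β : Rt => x β.1)) := by
  rw [Submodule.disjoint_def]
  rintro _ ⟨a, rfl⟩ hy
  obtain ⟨c, hc⟩ := (Submodule.mem_span_range_iff_exists_fun ℂ).1 hy
  have h1 : ∑ β : Rt, (c β * ev gnr β.1) • x β.1 = 0 := by
    have h2 := S.h_h gnr a
    rw [← hc, lie_sum] at h2
    rw [← h2]
    refine Finset.sum_congr rfl fun β _ => ?_
    rw [lie_smul, S.h_x, smul_smul]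
  have h3 := Fintype.linearIndependent_iff.1 S.x_indep _ h1
  rw [← hc]
  refine Finset.sum_eq_zero fun β _ => ?_
  rw [(mul_eq_zero.1 (h3 β)).resolve_right (ev_gnr_ne β.2), zero_smul]

theorem h_indep (S : Frame x h) :
    LinearIndependent ℂ (fun i : Fin 7 => h (Pi.single i 1)) := by
  have h1 := (Pi.basisFun ℂ (Fin 7)).linearIndependent.map' h (LinearMap.ker_eq_bot.2 S.h_inj)
  have h2 : (fun i : Fin 7 => h (Pi.single i 1)) = ⇑h ∘ ⇑(Pi.basisFun ℂ (Fin 7)) := by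
    funext i
    simp
  rw [h2]
  exact h1

theorem range_h : LinearMap.range h =
    Submodule.span ℂ (Set.range fun i : Fin 7 => h (Pi.single i 1)) := by
  rw [← Submodule.map_top, ← (Pi.basisFun ℂ (Fin 7)).span_eq, Submodule.map_span, ← Set.range_comp]
  congr 2
  funext i
  simp

theorem span_x (S : Frame x h) : Submodule.span ℂ (Set.range x) =
    Submodule.span ℂ (Set.range fun β : Rt => x β.1) := by
  refine le_antisymm (Submodule.span_le.2 ?_) (Submodule.span_mono ?_)
  · rintro _ ⟨β, rfl⟩
    by_cases hβ : IsRt β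
    · exact Submodule.subset_span ⟨⟨β, hβ⟩, rfl⟩
    · have : x β = 0 := by
        by_contra h2
        exact hβ ((S.x_ne β).1 h2)
      simp [this]
  · rintro _ ⟨β, rfl⟩
    exact ⟨_, rfl⟩

/-- The Chevalley type basis. -/
noncomputable def basis (S : Frame x h) : Basis (Fin 7 ⊕ Rt) ℂ L :=
  Basis.mk (v := Sum.elim (fun i : Fin 7 => h (Pi.single i 1)) (fun β : Rt => x β.1))
    (S.h_indep.sum_type S.x_indep (by rw [← range_h]; exact S.disj)) (by
      rw [Set.Sum.elim_range, Submodule.span_union, ← range_h, ← S.span_x, sup_comm, S.span])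

theorem basis_inl (S : Frame x h) (i : Fin 7) : S.basis (Sum.inl i) = h (Pi.single i 1) := by
  simp [basis]

theorem basis_inr (S : Frame x h) (β : Rt) : S.basis (Sum.inr β) = x β.1 := by
  simp [basis]

theorem finite (S : Frame x h) : FiniteDimensional ℂ L := Module.Finite.of_basis S.basis

theorem finrank_eq (S : Frame x h) : finrank ℂ L = 133 := by
  rw [finrank_eq_card_basis S.basis, Fintype.card_sum, card_Rt]
  rfl

/-- The Cartan component of an element. -/
noncomputable def ca (S : Frame x h) : L →ₗ[ℂ] (Fin 7 → ℂ) :=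
  LinearMap.pi fun i => S.basis.coord (Sum.inl i)

/-- The coefficient of an element at a root. -/
noncomputable def co (S : Frame x h) (β : Q) : L →ₗ[ℂ] ℂ :=
  if hβ : IsRt β then S.basis.coord (Sum.inr ⟨β, hβ⟩) else 0

theorem h_eq_sum (S : Frame x h) (a : Fin 7 → ℂ) :
    h a = ∑ i, a i • S.basis (Sum.inl i) := by
  conv_lhs => rw [pi_eq_sum_univ' a, map_sum]
  refine Finset.sum_congr rfl fun i _ => ?_
  rw [map_smul, basis_inl]

@[simp] theorem ca_h (S : Frame x h) (a : Fin 7 → ℂ) : S.ca (h a) = a := by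
  funext i
  rw [S.h_eq_sum a]
  simp [ca, Finsupp.single_apply]

@[simp] theorem co_h (S : Frame x h) (a : Fin 7 → ℂ) (β : Q) : S.co β (h a) = 0 := by
  rw [S.h_eq_sum a, co]
  split_ifs <;> simp

theorem x_eq_zero (S : Frame x h) {β : Q} (hβ : ¬IsRt β) : x β = 0 := by
  by_contra h2
  exact hβ ((S.x_ne β).1 h2)

@[simp] theorem ca_x (S : Frame x h) (β : Q) : S.ca (x β) = 0 := by
  by_cases hβ : IsRt β
  · funext i
    rw [← S.basis_inr ⟨β, hβ⟩]
    simp [ca]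
  · rw [S.x_eq_zero hβ, map_zero]

theorem co_x (S : Frame x h) {β : Q} (hβ : IsRt β) (γ : Q) :
    S.co γ (x β) = if β = γ then 1 else 0 := by
  rw [← S.basis_inr ⟨β, hβ⟩, co]
  split_ifs with h1 h2 h2
  · subst h2; simp
  · simp [h2]
  · subst h2; exact absurd hβ h1
  · rfl

theorem expand (S : Frame x h) (y : L) : y = h (S.ca y) + ∑ β : Rt, S.co β.1 y • x β.1 := by
  conv_lhs => rw [← S.basis.sum_repr y, Fintype.sum_sum_type]
  rw [S.h_eq_sum]
  refine congrArg _ (Finset.sum_congr rfl fun β _ => ?_)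
  rw [basis_inr]
  simp [co, β.2]

theorem ext (S : Frame x h) {y z : L} (h1 : S.ca y = S.ca z)
    (h2 : ∀ β, IsRt β → S.co β y = S.co β z) : y = z := by
  rw [S.expand y, S.expand z, h1]
  exact congrArg _ (Finset.sum_congr rfl fun β _ => by rw [h2 _ β.2])

theorem induction (S : Frame x h) {K : Submodule ℂ L} (h1 : ∀ a, h a ∈ K)
    (h2 : ∀ β, IsRt β → x β ∈ K) (y : L) : y ∈ K := by
  rw [S.expand y]
  exact add_mem (h1 _) (Submodule.sum_mem _ fun β _ => Submodule.smul_mem _ _ (h2 _ β.2))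

theorem ca_h_lie (S : Frame x h) (a : Fin 7 → ℂ) (y : L) : S.ca ⁅h a, y⁆ = 0 := by
  refine S.induction (K := LinearMap.ker (S.ca ∘ₗ (LieAlgebra.ad ℂ L (h a) : L →ₗ[ℂ] L))) ?_ ?_ y
  · intro b; simp [S.h_h]
  · intro β _; simp [S.h_x]

theorem co_h_lie (S : Frame x h) (a : Fin 7 → ℂ) (β : Q) (y : L) :
    S.co β ⁅h a, y⁆ = ev a β * S.co β y := by
  have := S.induction (K := LinearMap.ker (S.co β ∘ₗ (LieAlgebra.ad ℂ L (h a) : L →ₗ[ℂ] L) -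
    ev a β • S.co β)) ?_ ?_ y
  · simpa [sub_eq_zero] using this
  · intro b; simp [S.h_h]
  · intro γ hγ
    simp only [LinearMap.mem_ker, LinearMap.sub_apply, LinearMap.comp_apply, LieAlgebra.ad_apply,
      S.h_x, map_smul, LinearMap.smul_apply, S.co_x hγ]
    split_ifs with h1
    · subst h1; simp
    · simp

end Frame

end E7

/-! ### The Killing form -/

namespace E7

open Module

namespace Frame

variable {L : Type*} [LieRing L] [LieAlgebra ℂ L] {x : Q → L} {h : (Fin 7 → ℂ) →ₗ[ℂ] L}

theorem kf_h (S : Frame x h) (a b : Fin 7 → ℂ) :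
    killingForm ℂ L (h a) (h b) = ∑ β : Rt, ev a β.1 * ev b β.1 := by
  rw [killingForm_apply_apply, LinearMap.trace_eq_matrix_trace ℂ S.basis, Matrix.trace,
    Fintype.sum_sum_type]
  have h1 : ∀ i, (LinearMap.toMatrix S.basis S.basis (LieAlgebra.ad ℂ L (h a) *
      LieAlgebra.ad ℂ L (h b))).diag (Sum.inl i) = 0 := by
    intro i
    rw [Matrix.diag_apply, LinearMap.toMatrix_apply, basis_inl]
    simp [S.h_h]
  have h2 : ∀ β : Rt, (LinearMap.toMatrix S.basis S.basis (LieAlgebra.ad ℂ L (h a) *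
      LieAlgebra.ad ℂ L (h b))).diag (Sum.inr β) = ev a β.1 * ev b β.1 := by
    intro β
    rw [Matrix.diag_apply, LinearMap.toMatrix_apply]
    have : (LieAlgebra.ad ℂ L (h a) * LieAlgebra.ad ℂ L (h b)) (S.basis (Sum.inr β)) =
        (ev a β.1 * ev b β.1) • S.basis (Sum.inr β) := by
      rw [basis_inr]
      simp [S.h_x, smul_smul, mul_comm]
    rw [this, map_smul]
    simp
  have h3 : (LieAlgebra.ad ℂ L (h a) : L →ₗ[ℂ] L) ∘ₗ (LieAlgebra.ad ℂ L (h b)) =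
      LieAlgebra.ad ℂ L (h a) * LieAlgebra.ad ℂ L (h b) := rfl
  rw [h3, Finset.sum_congr rfl (fun i _ => h1 i), Finset.sum_const_zero, zero_add]
  exact Finset.sum_congr rfl (fun β _ => h2 β)

theorem kf_inv (y z w : L) : killingForm ℂ L ⁅y, z⁆ w = killingForm ℂ L y ⁅z, w⁆ :=
  LieModule.traceForm_apply_lie_apply ℂ L L y z w

theorem kf_comm (y z : L) : killingForm ℂ L y z = killingForm ℂ L z y :=
  LieModule.traceForm_comm ℂ L L y z

theorem kf_x_x (S : Frame x h) {β γ : Q} (hn : β + γ ≠ 0) :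
    killingForm ℂ L (x β) (x γ) = 0 := by
  obtain ⟨i, hi⟩ : ∃ i, (β + γ) i ≠ 0 := by
    by_contra h2
    push Not at h2
    exact hn (funext h2)
  have h1 := kf_inv (x β) (h (Pi.single i 1)) (x γ)
  rw [← lie_skew, S.h_x, S.h_x, map_neg, map_smul, map_smul, LinearMap.neg_apply,
    LinearMap.smul_apply, smul_eq_mul, smul_eq_mul, ev_single, ev_single] at h1
  have h2 : (((β + γ) i : ℤ) : ℂ) * killingForm ℂ L (x β) (x γ) = 0 := by
    rw [Pi.add_apply, Int.cast_add]
    linear_combination -h1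
  exact (mul_eq_zero.1 h2).resolve_left (by exact_mod_cast hi)

theorem kf_h_x (S : Frame x h) (a : Fin 7 → ℂ) {β : Q} (hn : β ≠ 0) :
    killingForm ℂ L (h a) (x β) = 0 := by
  obtain ⟨i, hi⟩ : ∃ i, β i ≠ 0 := by
    by_contra h2
    push Not at h2
    exact hn (funext h2)
  have h1 := kf_inv (h a) (h (Pi.single i 1)) (x β)
  rw [S.h_h, S.h_x, map_smul, map_zero, LinearMap.zero_apply, smul_eq_mul, ev_single] at h1
  exact (mul_eq_zero.1 h1.symm).resolve_left (by exact_mod_cast hi)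

theorem ev_conj (a : Fin 7 → ℂ) (β : Q) :
    ev (fun i => starRingEnd ℂ (a i)) β = starRingEnd ℂ (ev a β) := by
  simp [ev]

theorem sum_ev_conj_ne {a : Fin 7 → ℂ} (ha : a ≠ 0) :
    ∑ β : Rt, ev a β.1 * ev (fun i => starRingEnd ℂ (a i)) β.1 ≠ 0 := by
  intro h0
  simp only [ev_conj, Complex.mul_conj] at h0
  rw [← Complex.ofReal_sum, Complex.ofReal_eq_zero,
    Finset.sum_eq_zero_iff_of_nonneg (fun _ _ => Complex.normSq_nonneg _)] at h0
  refine ha (funext fun i => ?_)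
  have h1 := h0 ⟨sr i, isRt_sr i⟩ (Finset.mem_univ _)
  rwa [Complex.normSq_eq_zero, ev_sr] at h1

theorem kf_x_neg (S : Frame x h) {β : Q} (hβ : IsRt β) :
    killingForm ℂ L (x β) (x (-β)) ≠ 0 := by
  intro h0
  obtain ⟨c, hc, h1⟩ := S.x_neg β hβ
  set a : Fin 7 → ℂ := fun i => (pair β i : ℂ) with ha
  have hconj : (fun i => starRingEnd ℂ (a i)) = a := by
    funext i
    simp [ha]
  have ha0 : a ≠ 0 := by
    rw [isRt_iff] at hβ
    have key : ∀ γ ∈ posL, ∃ i, pair γ i ≠ 0 := by decide +kernel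
    intro h2
    rcases hβ with h | h
    · obtain ⟨i, hi⟩ := key _ h
      have := congrFun h2 i
      simp [ha] at this
      exact hi this
    · obtain ⟨i, hi⟩ := key _ h
      have := congrFun h2 i
      simp [ha] at this
      rw [pair_neg, this] at hi
      simp at hi
  have h3 := kf_inv (x β) (x (-β)) (h a)
  rw [h1, ← lie_skew, S.h_x, map_smul, LinearMap.smul_apply, map_neg, map_smul, h0, S.kf_h] at h3
  have h4 := sum_ev_conj_ne ha0
  rw [hconj] at h4
  simp [hc] at h3
  exact h4 h3

theorem kf_nondeg (S : Frame x h) {y : L} (hy : ∀ z, killingForm ℂ L y z = 0) : y = 0 := by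
  have h0 : ∀ β, IsRt β → S.co β y = 0 := by
    intro β hβ
    have h1 := hy (x (-β))
    rw [S.expand y, map_add, LinearMap.add_apply, S.kf_h_x _ hβ.neg.ne_zero, zero_add, map_sum,
      LinearMap.sum_apply, Finset.sum_eq_single (⟨β, hβ⟩ : Rt)] at h1
    · rw [map_smul, LinearMap.smul_apply, smul_eq_mul] at h1
      exact (mul_eq_zero.1 h1).resolve_right (S.kf_x_neg hβ)
    · intro γ _ hne
      rw [map_smul, LinearMap.smul_apply, S.kf_x_x, smul_zero]
      intro h2
      exact hne (Subtype.ext (by rw [← sub_eq_add_neg, sub_eq_zero] at h2; exact h2))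
    · intro h2
      exact absurd (Finset.mem_univ _) h2
  have h1 : y = h (S.ca y) := by
    conv_lhs => rw [S.expand y]
    rw [add_eq_left]
    exact Finset.sum_eq_zero fun β _ => by rw [h0 _ β.2, zero_smul]
  have h2 : S.ca y = 0 := by
    by_contra ha
    have h3 := hy (h (fun i => starRingEnd ℂ (S.ca y i)))
    rw [h1, S.kf_h, S.ca_h] at h3
    exact sum_ev_conj_ne ha h3
  rw [h1, h2, map_zero]

end Frame

end E7

/-! ### Traces -/

namespace E7

open Module

section Trace

variable {V : Type*} [AddCommGroup V] [Module ℂ V] [FiniteDimensional ℂ V]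

theorem isNilpotent_of_trace (w : End ℂ V)
    (hw : ∀ q : Polynomial ℂ, LinearMap.trace ℂ V (w * Polynomial.aeval w q) = 0) :
    IsNilpotent w := by
  have h0 : w.charpoly ≠ 0 := (LinearMap.charpoly_monic w).ne_zero
  obtain ⟨r, hr, hX⟩ := Polynomial.exists_eq_pow_rootMultiplicity_mul_and_not_dvd w.charpoly h0 0
  set m := w.charpoly.rootMultiplicity 0
  rw [Polynomial.C_0, sub_zero] at hr hX
  have hcop : IsCoprime (Polynomial.X ^ (m + 1)) r :=
    IsCoprime.pow_left ((Polynomial.irreducible_X.coprime_iff_not_dvd).2 hX)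
  obtain ⟨a, b, hab⟩ := hcop
  have hc : w ^ m * Polynomial.aeval w r = 0 := by
    have := LinearMap.aeval_self_charpoly w
    rw [hr] at this
    simpa using this
  set P : End ℂ V := Polynomial.aeval w (a * Polynomial.X ^ (m + 1)) with hP
  have hPQ : P + Polynomial.aeval w (b * r) = 1 := by
    rw [hP, ← map_add, hab, map_one]
  have hPQ0 : P * Polynomial.aeval w (b * r) = 0 := by
    rw [hP, ← map_mul]
    have : a * Polynomial.X ^ (m + 1) * (b * r) =
        (a * b * Polynomial.X) * (Polynomial.X ^ m * r) := by ring
    rw [this, map_mul]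
    have h2 : Polynomial.aeval w (Polynomial.X ^ m * r) = 0 := by simpa using hc
    rw [h2, mul_zero]
  have hidem : IsIdempotentElem P := by
    have h2 : P * (P + Polynomial.aeval w (b * r)) = P := by rw [hPQ, mul_one]
    rwa [mul_add, hPQ0, add_zero] at h2
  have htr : LinearMap.trace ℂ V P = 0 := by
    have h2 : P = w * Polynomial.aeval w (a * Polynomial.X ^ m) := by
      have : a * Polynomial.X ^ (m + 1) = Polynomial.X * (a * Polynomial.X ^ m) := by ring
      rw [hP, this, map_mul, Polynomial.aeval_X]
    rw [h2]
    exact hw _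
  have hproj := (LinearMap.isProj_range_iff_isIdempotentElem P).2 hidem
  rw [hproj.trace] at htr
  have hr0 : finrank ℂ (LinearMap.range P) = 0 := by exact_mod_cast htr
  have hP0 : P = 0 := by
    rw [Submodule.finrank_eq_zero] at hr0
    exact LinearMap.range_eq_bot.1 hr0
  refine ⟨m, ?_⟩
  rw [hP0, zero_add, mul_comm b r, map_mul] at hPQ
  calc w ^ m = w ^ m * (Polynomial.aeval w r * Polynomial.aeval w b) := by rw [hPQ, mul_one]
    _ = 0 := by rw [← mul_assoc, hc, zero_mul]

theorem trace_mul_eq_zero {u v : End ℂ V} (hu : IsNilpotent u)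
    (huv : u * (u * v - v * u) = (u * v - v * u) * u) : LinearMap.trace ℂ V (u * v) = 0 := by
  set w := u * v - v * u with hw
  have hcomm : Commute u w := huv
  have hwn : IsNilpotent w := by
    refine isNilpotent_of_trace w fun q => ?_
    have h2 : Commute u (Polynomial.aeval w q) := by
      induction q using Polynomial.induction_on' with
      | add p q hp hq => rw [map_add]; exact hp.add_right hq
      | monomial n a =>
        rw [Polynomial.aeval_monomial]
        exact (Algebra.commute_algebraMap_right a u).mul_right (hcomm.pow_right n)
    have h3 : w * Polynomial.aeval w q =
        u * (v * Polynomial.aeval w q) - (v * Polynomial.aeval w q) * u := by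
      rw [mul_assoc v, ← h2.eq, hw, sub_mul]
      simp only [mul_assoc]
    rw [h3, map_sub, LinearMap.trace_mul_comm, sub_self]
  obtain ⟨k, hk⟩ := hwn
  obtain ⟨n, hn⟩ := hu
  have hpow : ∀ p : ℕ, u ^ (p + 1) * v = v * u ^ (p + 1) + ((p + 1 : ℕ) : ℂ) • (w * u ^ p) := by
    intro p
    induction p with
    | zero => simp [hw]
    | succ p ih =>
      rw [pow_succ' u (p + 1), mul_assoc, ih, mul_add, ← mul_assoc u v]
      have : u * v = v * u + w := by rw [hw]; abel
      rw [this, add_mul, mul_assoc, ← pow_succ', mul_smul_comm, ← mul_assoc u w, hcomm.eq,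
        mul_assoc w u, ← pow_succ' u p]
      push_cast
      module
  have step : ∀ (p : ℕ) (x : V), (u ^ (p + 1)) x = 0 → ∀ j : ℕ,
      (u ^ (p + 1)) (((u * v) ^ j) x) = 0 ∧
      (u ^ p) (((u * v) ^ j) x) = ((p + 1 : ℕ) : ℂ) ^ j • (w ^ j) ((u ^ p) x) := by
    intro p x hx j
    induction j with
    | zero => simp [hx]
    | succ j ih =>
      obtain ⟨h1, h2⟩ := ih
      set y := ((u * v) ^ j) x
      have h3 : (u ^ (p + 1)) (v y) = ((p + 1 : ℕ) : ℂ) • w ((u ^ p) y) := by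
        have := congrArg (fun f : End ℂ V => f y) (hpow p)
        simpa [h1] using this
      have h4 : ((u * v) ^ (j + 1)) x = u (v y) := by rw [pow_succ']; rfl
      have h5 : (u ^ p) (u (v y)) = (u ^ (p + 1)) (v y) := by rw [pow_succ]; rfl
      refine ⟨?_, ?_⟩
      · rw [h4]
        have h6 : (u ^ (p + 1)) (u (v y)) = u ((u ^ (p + 1)) (v y)) := by
          change (u ^ (p + 1) * u) (v y) = (u * u ^ (p + 1)) (v y)
          rw [← pow_succ, ← pow_succ']
        have h7 : u (w ((u ^ p) y)) = w ((u ^ (p + 1)) y) := by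
          rw [pow_succ' u p]
          exact congrArg (fun f : End ℂ V => f ((u ^ p) y)) hcomm.eq
        rw [h6, h3, map_smul, h7, h1, map_zero, smul_zero]
      · rw [h4, h5, h3, h2, map_smul, smul_smul, pow_succ' w, pow_succ']
        rfl
  have main : ∀ (p : ℕ) (x : V), (u ^ p) x = 0 → ((u * v) ^ (k * p)) x = 0 := by
    intro p
    induction p with
    | zero => intro x hx; simpa using hx
    | succ p ih =>
      intro x hx
      have h1 := ih (((u * v) ^ k) x) (by rw [(step p x hx k).2, hk]; simp)
      rw [mul_add, mul_one, pow_add]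
      exact h1
  have hnil : IsNilpotent (u * v) := ⟨k * n, LinearMap.ext fun x => main n x (by rw [hn]; rfl)⟩
  exact (LinearMap.isNilpotent_trace_of_isNilpotent hnil).eq_zero

end Trace

end E7

/-! ### Representations of sl₂ -/

namespace E7

open Module

section Sl2

variable {V : Type*} [AddCommGroup V] [Module ℂ V] {X H Y : End ℂ V}

/-- The sum of the spaces of highest weight vectors of weight at least `p`. -/
def hwt (X H : End ℂ V) (p : ℕ) : Submodule ℂ V :=
  ⨆ m : ℕ, ⨆ _ : p ≤ m, LinearMap.ker X ⊓ End.eigenspace H (m : ℂ)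

theorem mem_hwt {p m : ℕ} (hm : p ≤ m) {v : V} (h1 : X v = 0) (h2 : H v = (m : ℂ) • v) :
    v ∈ hwt X H p :=
  Submodule.mem_iSup_of_mem m <| Submodule.mem_iSup_of_mem hm
    ⟨h1, End.mem_eigenspace_iff.2 h2⟩

theorem hwt_le {p : ℕ} {K : Submodule ℂ V}
    (h : ∀ (m : ℕ) (v : V), p ≤ m → X v = 0 → H v = (m : ℂ) • v → v ∈ K) : hwt X H p ≤ K :=
  iSup_le fun m => iSup_le fun hm _ hv => h m _ hm hv.1 (End.mem_eigenspace_iff.1 hv.2)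

theorem hwt_anti {p q : ℕ} (hpq : p ≤ q) : hwt X H q ≤ hwt X H p :=
  hwt_le fun _ _ hm h1 h2 => mem_hwt (hpq.trans hm) h1 h2

theorem hwt_solve {p : ℕ} {c : ℂ} (hc : ∀ m : ℕ, p ≤ m → (m : ℂ) ≠ c) {u : V}
    (hu : u ∈ hwt X H p) : ∃ u' ∈ hwt X H p, H u' - c • u' = u := by
  have : hwt X H p ≤ (hwt X H p).map (H - c • (1 : End ℂ V)) := by
    refine hwt_le fun m v hm h1 h2 => ?_
    have hne : (m : ℂ) - c ≠ 0 := sub_ne_zero.2 (hc m hm)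
    refine ⟨((m : ℂ) - c)⁻¹ • v, Submodule.smul_mem _ _ (mem_hwt hm h1 h2), ?_⟩
    have : (H - c • (1 : End ℂ V)) v = ((m : ℂ) - c) • v := by
      simp [h2, sub_smul]
    rw [map_smul, this, smul_smul, inv_mul_cancel₀ hne, one_smul]
  obtain ⟨u', h1, h2⟩ := this hu
  exact ⟨u', h1, by simpa using h2⟩

theorem X_pow_Y (hHX : ∀ v, H (X v) = X (H v) + (2 : ℂ) • X v)
    (hXY : ∀ v, X (Y v) = Y (X v) + H v) (k : ℕ) (v : V) :
    (X ^ (k + 1)) (Y v) = Y ((X ^ (k + 1)) v) + ((k + 1 : ℕ) : ℂ) • (H ((X ^ k) v) -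
      (k : ℂ) • (X ^ k) v) := by
  induction k with
  | zero => simp [hXY]
  | succ k ih =>
    have : ∀ n u, (X ^ (n + 1)) u = X ((X ^ n) u) := fun n u => by rw [pow_succ']; rfl
    rw [this, ih, map_add, hXY, map_smul, map_sub, map_smul, ← this]
    have h2 : X (H ((X ^ k) v)) = H ((X ^ (k + 1)) v) - (2 : ℂ) • (X ^ (k + 1)) v := by
      rw [this, hHX]; module
    rw [h2, ← this]
    push_cast
    module

theorem ker_inf_range_le (hHX : ∀ v, H (X v) = X (H v) + (2 : ℂ) • X v)
    (hXY : ∀ v, X (Y v) = Y (X v) + H v) (hX : IsNilpotent X) (p : ℕ) (w : V)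
    (hw : (X ^ (p + 1)) w = 0) : (X ^ p) w ∈ hwt X H p := by
  obtain ⟨n, hn⟩ := hX
  have key : ∀ d p : ℕ, n ≤ p + d → ∀ w : V, (X ^ (p + 1)) w = 0 → (X ^ p) w ∈ hwt X H p := by
    intro d
    induction d with
    | zero =>
      intro p hp w _
      rw [pow_eq_zero_of_le (show n ≤ p from hp) hn]
      exact zero_mem _
    | succ d ih =>
      intro p hp w hw
      have hXs : ∀ n u, (X ^ (n + 1)) u = X ((X ^ n) u) := fun n u => by rw [pow_succ']; rfl
      have h1 := X_pow_Y hHX hXY p w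
      rw [hw, map_zero, zero_add] at h1
      have hX0 : X ((X ^ p) w) = 0 := by rw [← hXs, hw]
      have hp0 : ((p + 1 : ℕ) : ℂ) ≠ 0 := Nat.cast_ne_zero.2 (Nat.succ_ne_zero p)
      have h2 : (X ^ (p + 1)) ((((p + 1 : ℕ) : ℂ))⁻¹ • Y w) =
          H ((X ^ p) w) - (p : ℂ) • (X ^ p) w := by
        rw [map_smul, h1, smul_smul, inv_mul_cancel₀ hp0, one_smul]
      have h3 : H ((X ^ p) w) - (p : ℂ) • (X ^ p) w ∈ hwt X H (p + 1) := by
        rw [← h2]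
        refine ih (p + 1) (by omega) _ ?_
        rw [hXs, h2, map_sub, map_smul, hX0, smul_zero, sub_zero]
        have := hHX ((X ^ p) w)
        rw [hX0, map_zero, smul_zero, add_zero] at this
        exact this.symm
      obtain ⟨u', hu', hu⟩ := hwt_solve (c := (p : ℂ)) (fun m hm => by
        exact_mod_cast (show m ≠ p by omega)) h3
      have hXu : X u' = 0 :=
        (hwt_le (K := LinearMap.ker X) fun _ _ _ h _ => h) hu'
      have h4 : (X ^ p) w - u' ∈ hwt X H p := by
        refine mem_hwt le_rfl (by rw [map_sub, hX0, hXu, sub_zero]) ?_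
        rw [map_sub, smul_sub, sub_eq_sub_iff_sub_eq_sub, ← hu]
      have := add_mem h4 (hwt_anti (Nat.le_succ p) hu')
      rwa [sub_add_cancel] at this
  exact key n p (by omega) w hw

theorem ker_le_hwt (hHX : ∀ v, H (X v) = X (H v) + (2 : ℂ) • X v)
    (hXY : ∀ v, X (Y v) = Y (X v) + H v) (hX : IsNilpotent X) {v : V} (hv : X v = 0) :
    v ∈ hwt X H 0 := by
  simpa using ker_inf_range_le hHX hXY hX 0 v (by simpa using hv)

theorem H_Y_pow (hHY : ∀ v, H (Y v) = Y (H v) - (2 : ℂ) • Y v) {u : V} {m : ℂ}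
    (hu : H u = m • u) (k : ℕ) : H ((Y ^ k) u) = (m - 2 * k) • (Y ^ k) u := by
  induction k with
  | zero => simp [hu]
  | succ k ih =>
    have : (Y ^ (k + 1)) u = Y ((Y ^ k) u) := by rw [pow_succ']; rfl
    rw [this, hHY, ih, map_smul]
    push_cast
    module

theorem X_Y_pow (hXY : ∀ v, X (Y v) = Y (X v) + H v)
    (hHY : ∀ v, H (Y v) = Y (H v) - (2 : ℂ) • Y v) {u : V} {m : ℂ}
    (hu : H u = m • u) (hX : X u = 0) (k : ℕ) :
    X ((Y ^ (k + 1)) u) = ((k + 1) * (m - k) : ℂ) • (Y ^ k) u := by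
  have hs : ∀ n, (Y ^ (n + 1)) u = Y ((Y ^ n) u) := fun n => by rw [pow_succ']; rfl
  induction k with
  | zero => simp [hXY, hX, hu]
  | succ k ih =>
    rw [hs, hXY, ih, map_smul, H_Y_pow hHY hu, ← hs]
    push_cast
    module

theorem sl2_span (hHX : ∀ v, H (X v) = X (H v) + (2 : ℂ) • X v)
    (hXY : ∀ v, X (Y v) = Y (X v) + H v) (hHY : ∀ v, H (Y v) = Y (H v) - (2 : ℂ) • Y v)
    (hX : IsNilpotent X) (S : Submodule ℂ V)
    (hS : ∀ (m k : ℕ) (u : V), X u = 0 → H u = (m : ℂ) • u → (Y ^ k) u ∈ S) : S = ⊤ := by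
  have h1 : ∀ (p m : ℕ) (u : V), p ≤ m → X u = 0 → H u = (m : ℂ) • u →
      ∃ c : ℂ, c ≠ 0 ∧ (X ^ p) ((Y ^ p) u) = c • u := by
    intro p m u hm hu0 hu
    induction p with
    | zero => exact ⟨1, one_ne_zero, by simp⟩
    | succ p ih =>
      obtain ⟨c, hc, h⟩ := ih (by omega)
      refine ⟨((p + 1) * (m - p)) * c, mul_ne_zero (mul_ne_zero ?_ ?_) hc, ?_⟩
      · exact_mod_cast Nat.succ_ne_zero p
      · exact sub_ne_zero.2 (by exact_mod_cast (show m ≠ p by omega))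
      · have : (X ^ (p + 1)) ((Y ^ (p + 1)) u) = (X ^ p) (X ((Y ^ (p + 1)) u)) := by
          rw [pow_succ X]; rfl
        rw [this, X_Y_pow hXY hHY hu hu0, map_smul, h, smul_smul]
  have h2 : ∀ p, hwt X H p ≤ S.map (X ^ p) := fun p => hwt_le fun m u hm hu0 hu => by
    obtain ⟨c, hc, h⟩ := h1 p m u hm hu0 hu
    refine ⟨c⁻¹ • (Y ^ p) u, S.smul_mem _ (hS m p u hu0 hu), ?_⟩
    rw [map_smul, h, smul_smul, inv_mul_cancel₀ hc, one_smul]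
  have h3 : ∀ p v, (X ^ p) v = 0 → v ∈ S := by
    intro p
    induction p with
    | zero => intro v hv; rw [pow_zero] at hv; rw [show v = 0 from hv]; exact zero_mem _
    | succ p ih =>
      intro v hv
      obtain ⟨b, hb, hbv⟩ := h2 p (ker_inf_range_le hHX hXY hX p v hv)
      have := add_mem (ih (v - b) (by rw [map_sub, hbv, sub_self])) hb
      rwa [sub_add_cancel] at this
  obtain ⟨n, hn⟩ := hX
  exact eq_top_iff.2 fun v _ => h3 n v (by rw [hn]; rfl)

theorem iSup_eig_eq_top (hHX : ∀ v, H (X v) = X (H v) + (2 : ℂ) • X v)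
    (hXY : ∀ v, X (Y v) = Y (X v) + H v) (hHY : ∀ v, H (Y v) = Y (H v) - (2 : ℂ) • Y v)
    (hX : IsNilpotent X) : ⨆ n : ℤ, End.eigenspace H (n : ℂ) = ⊤ := by
  refine sl2_span hHX hXY hHY hX _ fun m k u _ hu => ?_
  refine Submodule.mem_iSup_of_mem ((m : ℤ) - 2 * k) (End.mem_eigenspace_iff.2 ?_)
  rw [H_Y_pow hHY hu]
  push_cast
  rfl

theorem nonpos_sup_range (hHX : ∀ v, H (X v) = X (H v) + (2 : ℂ) • X v)
    (hXY : ∀ v, X (Y v) = Y (X v) + H v) (hHY : ∀ v, H (Y v) = Y (H v) - (2 : ℂ) • Y v)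
    (hX : IsNilpotent X) :
    (⨆ n : ℤ, ⨆ _ : n ≤ 0, End.eigenspace H (n : ℂ)) ⊔ LinearMap.range X = ⊤ := by
  refine sl2_span hHX hXY hHY hX _ fun m k u hu0 hu => ?_
  by_cases hk : (m : ℤ) - 2 * k ≤ 0
  · refine Submodule.mem_sup_left (Submodule.mem_iSup_of_mem ((m : ℤ) - 2 * k)
      (Submodule.mem_iSup_of_mem hk (End.mem_eigenspace_iff.2 ?_)))
    rw [H_Y_pow hHY hu]
    push_cast
    rfl
  · refine Submodule.mem_sup_right ?_
    have hc : ((k + 1) * (m - k) : ℂ) ≠ 0 := mul_ne_zero (by exact_mod_cast Nat.succ_ne_zero k)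
      (sub_ne_zero.2 (by exact_mod_cast (show m ≠ k by omega)))
    refine ⟨((k + 1) * (m - k) : ℂ)⁻¹ • (Y ^ (k + 1)) u, ?_⟩
    rw [map_smul, X_Y_pow hXY hHY hu hu0, smul_smul, inv_mul_cancel₀ hc, one_smul]

end Sl2

end E7

/-! ### The Jacobson-Morozov theorem -/

namespace E7

open Module

section Count

variable {V : Type*} [AddCommGroup V] [Module ℂ V] {X H : End ℂ V} {ι : Type*}

theorem repr_eig (b : Basis ι ℂ V) {n : ι → ℤ} (hb : ∀ i, H (b i) = (n i : ℂ) • b i)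
    {m : ℤ} {v : V} (hv : H v = (m : ℂ) • v) {i : ι} (hi : n i ≠ m) : b.repr v i = 0 := by
  have h1 : ∀ w, b.repr (H w) i = (n i : ℂ) * b.repr w i := by
    intro w
    have : (Finsupp.lapply i ∘ₗ b.repr.toLinearMap ∘ₗ H : V →ₗ[ℂ] ℂ) =
        (n i : ℂ) • (Finsupp.lapply i ∘ₗ b.repr.toLinearMap) := by
      refine b.ext fun j => ?_
      by_cases hj : j = i
      · subst hj; simp [hb]
      · simp [hb, hj]
    simpa using congrArg (fun f => f w) this
  have h2 := h1 v
  rw [hv, map_smul, Finsupp.smul_apply, smul_eq_mul] at h2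
  have h3 : ((m : ℂ) - n i) * b.repr v i = 0 := by rw [sub_mul, h2, sub_self]
  exact (mul_eq_zero.1 h3).resolve_left (sub_ne_zero.2 (by exact_mod_cast hi.symm))

/-- The projection onto the span of the basis vectors of weight at least `j`. -/
noncomputable def truncation (b : Basis ι ℂ V) (n : ι → ℤ) (j : ℤ) : End ℂ V :=
  b.constr ℂ fun i => if j ≤ n i then b i else 0

theorem truncation_basis (b : Basis ι ℂ V) (n : ι → ℤ) (j : ℤ) (i : ι) :
    truncation b n j (b i) = if j ≤ n i then b i else 0 := by
  rw [truncation, Basis.constr_basis]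

theorem truncation_eig [Fintype ι] (b : Basis ι ℂ V) {n : ι → ℤ}
    (hb : ∀ i, H (b i) = (n i : ℂ) • b i)
    {m : ℤ} {v : V} (hv : H v = (m : ℂ) • v) (j : ℤ) :
    truncation b n j v = if j ≤ m then v else 0 := by
  have h1 : truncation b n j v = ∑ i, b.repr v i • if j ≤ n i then b i else 0 := by
    conv_lhs => rw [← b.sum_repr v]
    simp only [map_sum, map_smul, truncation_basis]
  have h2 : (if j ≤ m then v else 0) = ∑ i, b.repr v i • if j ≤ m then b i else 0 := by
    split_ifs
    · rw [b.sum_repr]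
    · simp
  rw [h1, h2]
  refine Finset.sum_congr rfl fun i _ => ?_
  by_cases hi : n i = m
  · rw [hi]
  · rw [repr_eig b hb hv hi, zero_smul, zero_smul]

theorem finrank_range_truncation [Fintype ι] (b : Basis ι ℂ V) (n : ι → ℤ) (j : ℤ) :
    finrank ℂ (LinearMap.range (truncation b n j)) = Fintype.card {i // j ≤ n i} := by
  have h1 : LinearMap.range (truncation b n j) =
      Submodule.span ℂ (Set.range fun i : {i // j ≤ n i} => b i.1) := by
    refine le_antisymm ?_ (Submodule.span_le.2 ?_)
    · rw [LinearMap.range_eq_map, ← b.span_eq, Submodule.map_span, Submodule.span_le]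
      rintro _ ⟨_, ⟨i, rfl⟩, rfl⟩
      rw [truncation_basis]
      split_ifs with hi
      · exact Submodule.subset_span ⟨⟨i, hi⟩, rfl⟩
      · exact zero_mem _
    · rintro _ ⟨i, rfl⟩
      exact ⟨b i.1, by rw [truncation_basis, if_pos i.2]⟩
  rw [h1]
  exact finrank_span_eq_card (b.linearIndependent.comp _ Subtype.val_injective)

theorem finrank_ker_eq [Fintype ι] (b : Basis ι ℂ V) {n : ι → ℤ}
    (hb : ∀ i, H (b i) = (n i : ℂ) • b i)
    (hHX : ∀ v, H (X v) = X (H v) + (2 : ℂ) • X v)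
    (h1 : (⨆ n : ℤ, ⨆ _ : n ≤ 0, End.eigenspace H (n : ℂ)) ⊔ LinearMap.range X = ⊤)
    (h2 : LinearMap.ker X ≤ hwt X H 0) :
    finrank ℂ (LinearMap.ker X) = Fintype.card {i // n i = 0 ∨ n i = 1} := by
  classical
  have : FiniteDimensional ℂ V := Module.Finite.of_basis b
  set P := truncation b n
  have hXP : X ∘ₗ P 0 = P 2 ∘ₗ X := by
    refine b.ext fun i => ?_
    have h3 : H (X (b i)) = ((n i + 2 : ℤ) : ℂ) • X (b i) := by
      rw [hHX, hb, map_smul]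
      push_cast
      module
    change X (truncation b n 0 (b i)) = truncation b n 2 (X (b i))
    rw [truncation_eig b hb h3, truncation_basis]
    by_cases hi : 0 ≤ n i
    · rw [if_pos hi, if_pos (by omega)]
    · rw [if_neg hi, if_neg (by omega), map_zero]
  have hr : LinearMap.range (X ∘ₗ P 0) = LinearMap.range (P 2) := by
    rw [hXP]
    refine le_antisymm (LinearMap.range_comp_le_range _ _) ?_
    rw [LinearMap.range_comp, LinearMap.range_eq_map, ← h1, Submodule.map_sup]
    refine sup_le ?_ le_rfl
    refine le_trans (Submodule.map_le_iff_le_comap.2 (iSup_le fun k => iSup_le fun hk v hv => ?_))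
      bot_le
    change P 2 v ∈ (⊥ : Submodule ℂ V)
    rw [Submodule.mem_bot]
    change truncation b n 2 v = 0
    rw [truncation_eig b hb (End.mem_eigenspace_iff.1 hv), if_neg (by omega)]
  have hP0 : ∀ v, X v = 0 → P 0 v = v := by
    intro v hv
    have h3 : hwt X H 0 ≤ LinearMap.ker (P 0 - 1) := hwt_le fun m u _ _ hu => by
      have := truncation_eig b hb (m := (m : ℤ)) (by simpa using hu) 0
      rw [if_pos (by omega)] at this
      rw [LinearMap.mem_ker, LinearMap.sub_apply, End.one_apply, sub_eq_zero]
      exact this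
    have h4 := h3 (h2 hv)
    rwa [LinearMap.mem_ker, LinearMap.sub_apply, End.one_apply, sub_eq_zero] at h4
  have hrn := LinearMap.finrank_range_add_finrank_ker (X.domRestrict (LinearMap.range (P 0)))
  have hr2 : LinearMap.range (X.domRestrict (LinearMap.range (P 0))) = LinearMap.range (P 2) := by
    rw [← hr, LinearMap.range_domRestrict, LinearMap.range_comp]
  have hk : finrank ℂ (LinearMap.ker (X.domRestrict (LinearMap.range (P 0)))) =
      finrank ℂ (LinearMap.ker X) := by
    rw [LinearMap.ker_domRestrict]
    refine LinearEquiv.finrank_eq (Submodule.comapSubtypeEquivOfLe fun v hv => ?_)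
    exact ⟨v, hP0 v hv⟩
  rw [hr2, hk, finrank_range_truncation, finrank_range_truncation] at hrn
  have hc : Fintype.card {i // n i = 0 ∨ n i = 1} + Fintype.card {i // 2 ≤ n i} =
      Fintype.card {i // 0 ≤ n i} := by
    rw [Fintype.card_subtype, Fintype.card_subtype, Fintype.card_subtype,
      ← Finset.card_union_of_disjoint]
    · congr 1
      ext i
      simp
      omega
    · rw [Finset.disjoint_filter]
      intro i _ h
      omega
  omega

end Count

section JM

variable {L : Type*} [LieRing L] [LieAlgebra ℂ L]

/-- An `sl₂`-triple. -/
structure Triple (e h f : L) : Prop where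
  he : ⁅h, e⁆ = (2 : ℂ) • e
  hf : ⁅h, f⁆ = -((2 : ℂ) • f)
  ef : ⁅e, f⁆ = h

variable {e h f : L}

theorem Triple.hX (T : Triple e h f) (v : L) : ⁅h, ⁅e, v⁆⁆ = ⁅e, ⁅h, v⁆⁆ + (2 : ℂ) • ⁅e, v⁆ := by
  rw [leibniz_lie, T.he, smul_lie, add_comm]

theorem Triple.hY (T : Triple e h f) (v : L) : ⁅h, ⁅f, v⁆⁆ = ⁅f, ⁅h, v⁆⁆ - (2 : ℂ) • ⁅f, v⁆ := by
  rw [leibniz_lie, T.hf, neg_lie, smul_lie]; abel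

theorem Triple.eY (T : Triple e h f) (v : L) : ⁅e, ⁅f, v⁆⁆ = ⁅f, ⁅e, v⁆⁆ + ⁅h, v⁆ := by
  rw [leibniz_lie, T.ef, add_comm]

theorem Triple.iSup_eig (T : Triple e h f) (he : IsNilpotent (LieAlgebra.ad ℂ L e)) :
    ⨆ n : ℤ, End.eigenspace (LieAlgebra.ad ℂ L h) (n : ℂ) = ⊤ :=
  iSup_eig_eq_top (X := LieAlgebra.ad ℂ L e) (Y := LieAlgebra.ad ℂ L f) T.hX T.eY T.hY he

theorem Triple.finrank_ker (T : Triple e h f) (he : IsNilpotent (LieAlgebra.ad ℂ L e))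
    {ι : Type*} [Fintype ι] (b : Basis ι ℂ L) {n : ι → ℤ}
    (hb : ∀ i, ⁅h, b i⁆ = (n i : ℂ) • b i) :
    finrank ℂ (LinearMap.ker (LieAlgebra.ad ℂ L e)) =
      Fintype.card {i // n i = 0 ∨ n i = 1} :=
  finrank_ker_eq (H := LieAlgebra.ad ℂ L h) b hb T.hX
    (nonpos_sup_range (Y := LieAlgebra.ad ℂ L f) T.hX T.eY T.hY he)
    fun _ hv => ker_le_hwt (Y := LieAlgebra.ad ℂ L f) T.hX T.eY he hv

variable {x : Q → L} {hh : (Fin 7 → ℂ) →ₗ[ℂ] L}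

theorem Frame.mem_range_sq (S : Frame x hh) (he : IsNilpotent (LieAlgebra.ad ℂ L e)) :
    ∃ y, ⁅e, ⁅e, y⁆⁆ = e := by
  have := S.finite
  by_contra hne
  set T : End ℂ L := LieAlgebra.ad ℂ L e * LieAlgebra.ad ℂ L e
  have hT : e ∉ LinearMap.range T := fun ⟨y, hy⟩ => hne ⟨y, hy⟩
  obtain ⟨φ, h1, h2⟩ := Submodule.exists_le_ker_of_notMem hT
  have hinj : Function.Injective (killingForm ℂ L) := by
    rw [← LinearMap.ker_eq_bot, LinearMap.ker_eq_bot']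
    exact fun y hy => S.kf_nondeg fun z => by rw [hy]; rfl
  obtain ⟨z, rfl⟩ := (LinearMap.injective_iff_surjective_of_finrank_eq_finrank
    (by rw [Subspace.dual_finrank_eq])).1 hinj φ
  have hs : ∀ u w, killingForm ℂ L ⁅e, u⁆ w = - killingForm ℂ L u ⁅e, w⁆ := by
    intro u w
    rw [← lie_skew, map_neg, LinearMap.neg_apply, kf_inv]
  have hTz : ⁅e, ⁅e, z⁆⁆ = 0 := S.kf_nondeg fun w => by
    rw [hs, hs, neg_neg]
    exact h2 ⟨w, rfl⟩
  refine h1 ?_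
  rw [kf_comm, killingForm_apply_apply]
  have had : ∀ w : L, LieAlgebra.ad ℂ L e * LieAlgebra.ad ℂ L w -
      LieAlgebra.ad ℂ L w * LieAlgebra.ad ℂ L e = LieAlgebra.ad ℂ L ⁅e, w⁆ :=
    fun w => LinearMap.ext fun v => (lie_lie e w v).symm
  refine trace_mul_eq_zero he ?_
  rw [had]
  have h3 := had ⁅e, z⁆
  rw [hTz, map_zero] at h3
  exact sub_eq_zero.1 h3

theorem Frame.exists_triple (S : Frame x hh) (he : IsNilpotent (LieAlgebra.ad ℂ L e)) :
    ∃ h f, Triple e h f := by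
  obtain ⟨y, hy⟩ := S.mem_range_sq he
  set f₀ := (-2 : ℂ) • y
  set h := ⁅e, f₀⁆ with hh0
  have h1 : ⁅h, e⁆ = (2 : ℂ) • e := by
    have : h = (-2 : ℂ) • ⁅e, y⁆ := by rw [hh0, lie_smul]
    rw [this, smul_lie, ← lie_skew, hy]
    module
  have hX : ∀ v : L, ⁅h, ⁅e, v⁆⁆ = ⁅e, ⁅h, v⁆⁆ + (2 : ℂ) • ⁅e, v⁆ := fun v => by
    rw [leibniz_lie, h1, smul_lie, add_comm]
  have hY : ∀ v : L, ⁅e, ⁅f₀, v⁆⁆ = ⁅f₀, ⁅e, v⁆⁆ + ⁅h, v⁆ := fun v => by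
    rw [leibniz_lie e f₀ v, add_comm]
  have hr : ⁅e, ⁅h, f₀⁆ + (2 : ℂ) • f₀⁆ = 0 := by
    have := hX f₀
    rw [← hh0, lie_self] at this
    rw [lie_add, lie_smul (2 : ℂ) e f₀, ← hh0]
    exact this.symm
  obtain ⟨s, hs, hs2⟩ := hwt_solve (X := LieAlgebra.ad ℂ L e) (H := LieAlgebra.ad ℂ L h)
    (p := 0) (c := -2) (fun m _ hm => by
      have : ((m + 2 : ℕ) : ℂ) = 0 := by push_cast; rw [hm]; ring
      exact absurd (Nat.cast_eq_zero.1 this) (by omega))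
    (ker_le_hwt (Y := LieAlgebra.ad ℂ L f₀) hX hY he hr)
  have hes : ⁅e, s⁆ = 0 := (hwt_le (K := LinearMap.ker (LieAlgebra.ad ℂ L e))
    fun _ _ _ h _ => h) hs
  simp only [LieAlgebra.ad_apply] at hs2
  refine ⟨h, f₀ - s, h1, ?_, ?_⟩
  · have h2 : ⁅h, s⁆ = ⁅h, f₀⁆ + (2 : ℂ) • f₀ - (2 : ℂ) • s := by rw [← hs2]; module
    rw [lie_sub, h2]
    module
  · rw [lie_sub, hes, sub_zero]

end JM

end E7

/-! ### Sweeping out a weight space by exponentials -/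

namespace E7

open Module

section Exp

variable {V : Type*} [NormedAddCommGroup V] [NormedSpace ℂ V] [FiniteDimensional ℂ V]

/-- The continuous linear endomorphism `y ↦ br z y`. -/
noncomputable def cad (br : V →ₗ[ℂ] V →ₗ[ℂ] V) : V →L[ℂ] V →L[ℂ] V :=
  LinearMap.toContinuousLinearMap (LinearMap.toContinuousLinearMap.toLinearMap ∘ₗ br)

@[simp] theorem cad_apply (br : V →ₗ[ℂ] V →ₗ[ℂ] V) (z y : V) : cad br z y = br z y := rfl

theorem exp_neg_apply_exp (D : V →L[ℂ] V) (y : V) :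
    NormedSpace.exp (-D) (NormedSpace.exp D y) = y := by
  let _ : NormedAlgebra ℚ (V →L[ℂ] V) := NormedAlgebra.restrictScalars ℚ ℂ _
  have h1 : NormedSpace.exp (-D) * NormedSpace.exp D = 1 := by
    rw [← NormedSpace.exp_add_of_commute (Commute.refl D).neg_left, neg_add_cancel,
      NormedSpace.exp_zero]
  exact congrArg (fun f : V →L[ℂ] V => f y) h1

theorem exp_apply_exp_neg (D : V →L[ℂ] V) (y : V) :
    NormedSpace.exp D (NormedSpace.exp (-D) y) = y := by
  simpa using exp_neg_apply_exp (-D) y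

theorem exp_br (br : V →ₗ[ℂ] V →ₗ[ℂ] V) (z : V)
    (hbr : ∀ x y, br z (br x y) = br (br z x) y + br x (br z y)) (x y : V) :
    NormedSpace.exp (cad br z) (br x y) =
      br (NormedSpace.exp (cad br z) x) (NormedSpace.exp (cad br z) y) := by
  set D := cad br z with hD
  let g : ℂ → V := fun t => NormedSpace.exp (t • -D)
    (cad br (NormedSpace.exp (t • D) x) (NormedSpace.exp (t • D) y))
  have hg : ∀ t, HasDerivAt g 0 t := by
    intro t
    have hE : ∀ u, HasDerivAt (fun t : ℂ => NormedSpace.exp (t • D) u)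
        (D (NormedSpace.exp (t • D) u)) t := fun u => by
      simpa using (hasDerivAt_exp_smul_const' D t).clm_apply (hasDerivAt_const t u)
    have h1 := ((cad br).hasFDerivAt.comp_hasDerivAt t (hE x)).clm_apply (hE y)
    have h2 := (hasDerivAt_exp_smul_const (-D) t).clm_apply h1
    refine h2.congr_deriv ?_
    simp only [mul_apply_eq_comp, neg_apply, map_neg, hD,
      cad_apply, hbr, Function.comp]
    abel
  have hc := is_const_of_deriv_eq_zero (fun t => (hg t).differentiableAt)
    (fun t => (hg t).deriv) 1 0
  simp only [g, one_smul, zero_smul, NormedSpace.exp_zero, one_apply_eq_self,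
    cad_apply] at hc
  rw [← exp_apply_exp_neg D (br (NormedSpace.exp D x) (NormedSpace.exp D y)), hc]

theorem exp_fix (D : V →L[ℂ] V) {y : V} (hy : D y = 0) : NormedSpace.exp D y = y := by
  let g : ℂ → V := fun t => NormedSpace.exp (t • D) y
  have hg : ∀ t, HasDerivAt g 0 t := fun t => by
    have := (hasDerivAt_exp_smul_const D t).clm_apply (hasDerivAt_const t y)
    simpa [hy] using this
  have hc := is_const_of_deriv_eq_zero (fun t => (hg t).differentiableAt)
    (fun t => (hg t).deriv) 1 0
  simpa [g] using hc

theorem sweep_normed (br : V →ₗ[ℂ] V →ₗ[ℂ] V) (Z K : Submodule ℂ V) (x₀ : V)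
    (hK : ∀ y, ∃ z ∈ Z, ∃ w ∈ K, br z x₀ + w = y) :
    ∀ᶠ y in nhds x₀, ∃ z ∈ Z, ∃ w ∈ K, NormedSpace.exp (cad br z) (x₀ + w) = y := by
  let F : Z × K → V := fun p => NormedSpace.exp (cad br p.1) (x₀ + p.2)
  have hF : HasStrictFDerivAt F
      ((((cad br).flip x₀) ∘L Z.subtypeL).coprod K.subtypeL) (0 : Z × K) := by
    have h1 : HasStrictFDerivAt (fun p : Z × K => cad br (p.1 : V))
        ((cad br) ∘L Z.subtypeL ∘L ContinuousLinearMap.fst ℂ Z K) 0 :=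
      ((cad br) ∘L Z.subtypeL ∘L ContinuousLinearMap.fst ℂ Z K).hasStrictFDerivAt
    have h2 : HasStrictFDerivAt (fun p : Z × K => NormedSpace.exp (cad br (p.1 : V)))
        ((1 : (V →L[ℂ] V) →L[ℂ] (V →L[ℂ] V)) ∘L
          ((cad br) ∘L Z.subtypeL ∘L ContinuousLinearMap.fst ℂ Z K)) 0 := by
      refine HasStrictFDerivAt.comp (0 : Z × K) ?_ h1
      have : cad br ((0 : Z × K).1 : V) = 0 := by simp
      rw [this]
      exact hasStrictFDerivAt_exp_zero (𝕂 := ℂ)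
    have h3 : HasStrictFDerivAt (fun p : Z × K => x₀ + (p.2 : V))
        (K.subtypeL ∘L ContinuousLinearMap.snd ℂ Z K) 0 :=
      (K.subtypeL ∘L ContinuousLinearMap.snd ℂ Z K).hasStrictFDerivAt.const_add x₀
    refine (h2.clm_apply h3).congr_fderiv ?_
    ext p <;> simp
  have hs := hF.map_nhds_eq_of_surj (by
    rw [LinearMap.range_eq_top]
    intro y
    obtain ⟨z, hz, w, hw, h⟩ := hK y
    exact ⟨(⟨z, hz⟩, ⟨w, hw⟩), by simpa using h⟩)
  have h0 : F 0 = x₀ := by simp [F]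
  rw [h0] at hs
  rw [← hs, Filter.eventually_map]
  exact Filter.Eventually.of_forall fun p => ⟨p.1, p.1.2, p.2, p.2.2, rfl⟩

end Exp

section Sweep

variable {L : Type*} [LieRing L] [LieAlgebra ℂ L]

theorem sweep [FiniteDimensional ℂ L] (Z K : Submodule ℂ L) (a b : L) (s : ℂ)
    (hK : ∀ y, ∃ z ∈ Z, ∃ w ∈ K, ⁅z, a + s • b⁆ + w = y) :
    ∀ᶠ t in nhds s, ∃ φ : L ≃ₗ⁅ℂ⁆ L, (∀ y, (∀ z ∈ Z, ⁅z, y⁆ = 0) → φ y = y) ∧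
      ∃ w ∈ K, φ (a + s • b + w) = a + t • b := by
  let B := finBasis ℂ L
  let E : L ≃ₗ[ℂ] (Fin (finrank ℂ L) → ℂ) := B.equivFun
  let br : (Fin (finrank ℂ L) → ℂ) →ₗ[ℂ] (Fin (finrank ℂ L) → ℂ) →ₗ[ℂ] (Fin (finrank ℂ L) → ℂ) :=
    LinearMap.mk₂ ℂ (fun u v => E ⁅E.symm u, E.symm v⁆) (by simp) (by simp) (by simp) (by simp)
  have hbr : ∀ u v, br u v = E ⁅E.symm u, E.symm v⁆ := fun _ _ => rfl
  have hs := sweep_normed br (Z.map E.toLinearMap) (K.map E.toLinearMap) (E (a + s • b)) (by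
    intro y
    obtain ⟨z, hz, w, hw, h⟩ := hK (E.symm y)
    refine ⟨E z, ⟨z, hz, rfl⟩, E w, ⟨w, hw, rfl⟩, ?_⟩
    rw [hbr, E.symm_apply_apply, E.symm_apply_apply, ← map_add, h, E.apply_symm_apply])
  have hcont : Filter.Tendsto (fun t : ℂ => E (a + t • b)) (nhds s) (nhds (E (a + s • b))) := by
    have : (fun t : ℂ => E (a + t • b)) = fun t => E a + t • E b := by
      funext t; simp
    rw [this, map_add, map_smul]
    exact Continuous.tendsto (by fun_prop) s
  filter_upwards [hcont.eventually hs] with t ht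
  obtain ⟨z', ⟨z, hz, rfl⟩, w', ⟨w, hw, rfl⟩, h⟩ := ht
  set D := cad br (E.toLinearMap z) with hD
  let φ : L ≃ₗ⁅ℂ⁆ L :=
    { toFun := fun y => E.symm (NormedSpace.exp D (E y))
      map_add' := by simp
      map_smul' := by simp
      map_lie' := by
        intro x y
        have h1 : E ⁅x, y⁆ = br (E x) (E y) := by simp [hbr]
        have h2 : ∀ u v, br (E.toLinearMap z) (br u v) =
            br (br (E.toLinearMap z) u) v + br u (br (E.toLinearMap z) v) := by
          intro u v
          simp only [hbr, E.symm_apply_apply]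
          rw [← map_add]
          exact congrArg E (leibniz_lie _ _ _)
        rw [h1, exp_br br _ h2, hbr, E.symm_apply_apply]
      invFun := fun y => E.symm (NormedSpace.exp (-D) (E y))
      left_inv := fun y => by simp [exp_neg_apply_exp]
      right_inv := fun y => by simp [exp_apply_exp_neg] }
  have hφ : ∀ y, φ y = E.symm (NormedSpace.exp D (E y)) := fun _ => rfl
  refine ⟨φ, fun y hy => ?_, w, hw, ?_⟩
  · rw [hφ, exp_fix, E.symm_apply_apply]
    rw [hD, cad_apply, hbr]
    simp [hy z hz]
  · rw [hφ, map_add]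
    exact (congrArg E.symm h).trans (E.symm_apply_apply _)

theorem connect {p : ℂ → ℂ → Prop} {R : Set ℂ} (hR : Rᶜ.Countable)
    (h1 : ∀ s ∈ R, ∀ᶠ t in nhds s, t ∈ R → p s t)
    (htr : ∀ s t u, p s t → p t u → p s u) (hsy : ∀ s t, p s t → p t s) {s t : ℂ}
    (hs : s ∈ R) (ht : t ∈ R) : p s t := by
  have hc : IsPreconnected R := by
    have := hR.isPathConnected_compl_of_one_lt_rank (by
      rw [Complex.rank_real_complex]; exact Nat.one_lt_ofNat)
    rw [compl_compl] at this
    exact this.isConnected.isPreconnected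
  exact hc.induction₂ p (fun s hs => eventually_nhdsWithin_of_eventually_nhds (h1 s hs) |>.mp
    (eventually_nhdsWithin_of_forall fun t ht h => h ht)) (fun _ _ _ _ _ _ => htr _ _ _)
    (fun _ _ _ _ => hsy _ _) hs ht

end Sweep

end E7

/-! ### Conjugacy of semisimple elements into the torus -/

namespace E7

open Module LieSubalgebra

variable {L : Type*} [LieRing L] [LieAlgebra ℂ L]

theorem mem_engel_equiv (φ : L ≃ₗ⁅ℂ⁆ L) (y v : L) :
    φ v ∈ engel ℂ (φ y) ↔ v ∈ engel ℂ y := by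
  rw [mem_engel_iff, mem_engel_iff]
  have : ∀ n, ((LieAlgebra.ad ℂ L (φ y)) ^ n) (φ v) = φ (((LieAlgebra.ad ℂ L y) ^ n) v) := by
    intro n
    induction n with
    | zero => rfl
    | succ n ih =>
      rw [pow_succ', pow_succ', Module.End.mul_apply, Module.End.mul_apply, ih,
        LieAlgebra.ad_apply, LieAlgebra.ad_apply, LieEquiv.map_lie]
  simp [this]

section Finite

variable [FiniteDimensional ℂ L]

theorem engel_eq_of_le {y : L} (hy : LieAlgebra.IsRegular ℂ y) {K : LieSubalgebra ℂ L} {z : L}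
    (hK : K = engel ℂ z) (h : engel ℂ y ≥ K) : K = engel ℂ y := by
  refine LieSubalgebra.toSubmodule_injective (Submodule.eq_of_le_of_finrank_le h ?_)
  have h1 := (LieAlgebra.isRegular_iff_finrank_engel_eq_rank ℂ y).1 hy
  have h2 := LieAlgebra.rank_le_finrank_engel ℂ z
  rw [← hK, ← h1] at h2
  exact h2

theorem engel_le_of_mem {y z : L} (hy : LieAlgebra.IsRegular ℂ y) (hz : z ∈ engel ℂ y) :
    engel ℂ y ≤ engel ℂ z := by
  set Ex : {engel ℂ z | z ∈ engel ℂ y} := ⟨engel ℂ y, y, self_mem_engel _ _, rfl⟩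
  have h : IsBot Ex := by
    refine LieAlgebra.engel_isBot_of_isMin
      ((Cardinal.natCast_le_aleph0).trans (Cardinal.infinite_iff.1 inferInstance))
      (engel ℂ y) Ex le_rfl ?_
    rintro ⟨_, w, hw, rfl⟩ hyw
    exact (engel_eq_of_le hy rfl hyw).ge
  exact h ⟨engel ℂ z, z, hz, rfl⟩

theorem regular_cofinite (a b : L) (h1 : LieAlgebra.IsRegular ℂ (a + (1 : ℂ) • b)) :
    {t : ℂ | LieAlgebra.IsRegular ℂ (a + t • b)}ᶜ.Finite := by
  let T := LinearMap.toMatrix (finBasis ℂ L) (finBasis ℂ L)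
  let g : Polynomial ℂ := ((T (LieAlgebra.ad ℂ L a)).map Polynomial.C +
    (Polynomial.X : Polynomial ℂ) •
      (T (LieAlgebra.ad ℂ L b)).map Polynomial.C).charpoly.coeff (LieAlgebra.rank ℂ L)
  have hg : ∀ t, g.eval t =
      (LieAlgebra.ad ℂ L (a + t • b)).charpoly.coeff (LieAlgebra.rank ℂ L) := by
    intro t
    rw [← LinearMap.charpoly_toMatrix _ (finBasis ℂ L), ← Polynomial.coe_evalRingHom,
      ← Polynomial.coeff_map, ← Matrix.charpoly_map]
    congr 2
    change _ = T _
    rw [map_add, map_smul, map_add, map_smul]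
    ext i j
    simp
    exact mul_comm _ _
  have hR : ∀ t : ℂ, LieAlgebra.IsRegular ℂ (a + t • b) ↔ g.eval t ≠ 0 := fun t => by
    rw [hg]
    exact LieAlgebra.isRegular_def ℂ _
  have hg0 : g ≠ 0 := by
    rintro h0
    exact (hR 1).1 h1 (by rw [h0, Polynomial.eval_zero])
  refine (Polynomial.finite_setOfPred_isRoot hg0).subset fun t ht => ?_
  by_contra hne
  exact ht ((hR t).2 hne)

theorem engel_local (a b : L) {s : ℂ} (hs : LieAlgebra.IsRegular ℂ (a + s • b)) :
    ∀ᶠ t in nhds s, LieAlgebra.IsRegular ℂ (a + t • b) →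
      ∃ φ : L ≃ₗ⁅ℂ⁆ L, ∀ v, v ∈ engel ℂ (a + s • b) ↔ φ v ∈ engel ℂ (a + t • b) := by
  have h := sweep ⊤ (engel ℂ (a + s • b)).toSubmodule a b s (by
    intro y
    have hc := (LieAlgebra.ad ℂ L (a + s • b)).isCompl_iSup_ker_pow_iInf_range_pow
    obtain ⟨u, hu, w, hw, rfl⟩ := Submodule.mem_sup.1 (hc.codisjoint.eq_top ▸ Submodule.mem_top :
      y ∈ _ ⊔ _)
    obtain ⟨z, hz⟩ := (Submodule.mem_iInf _).1 hw 1
    refine ⟨-z, Submodule.mem_top, u, ?_, ?_⟩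
    · have hmono : Monotone fun n => LinearMap.ker ((LieAlgebra.ad ℂ L (a + s • b)) ^ n) :=
        fun m n hmn v hv => by
          obtain ⟨k, rfl⟩ := Nat.exists_eq_add_of_le' hmn
          rw [LinearMap.mem_ker, pow_add, Module.End.mul_apply, LinearMap.mem_ker.1 hv, map_zero]
      rw [Submodule.mem_iSup_of_directed _ hmono.directed_le] at hu
      exact (mem_engel_iff ℂ _ _).2 hu
    · rw [neg_lie, lie_skew, ← hz, add_comm]
      simp)
  filter_upwards [h] with t ht hreg
  obtain ⟨φ, -, w, hw, h⟩ := ht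
  have hx : a + s • b + w ∈ engel ℂ (a + s • b) :=
    add_mem (self_mem_engel ℂ _) hw
  have hreg2 : LieAlgebra.IsRegular ℂ (a + s • b + w) := by
    rw [LieAlgebra.isRegular_iff_finrank_engel_eq_rank] at hreg ⊢
    rw [← hreg]
    refine LinearEquiv.finrank_eq ((φ.toLinearEquiv.submoduleMap _).trans
      (LinearEquiv.ofEq _ (engel ℂ (a + t • b)).toSubmodule ?_))
    ext v
    constructor
    · rintro ⟨u, hu, rfl⟩
      change φ u ∈ engel ℂ (a + t • b)
      rw [← h]
      exact (mem_engel_equiv φ _ _).2 hu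
    · intro hv
      obtain ⟨u, rfl⟩ := φ.surjective v
      refine ⟨u, ?_, rfl⟩
      rw [← h] at hv
      exact (mem_engel_equiv φ _ _).1 hv
  have he := engel_eq_of_le hreg2 rfl (engel_le_of_mem hs hx)
  refine ⟨φ, fun v => ?_⟩
  rw [he, ← h, mem_engel_equiv]

theorem nhds_inter_cofinite {R : Set ℂ} (hR : Rᶜ.Finite) {s : ℂ} {p : ℂ → Prop}
    (hp : ∀ᶠ t in nhds s, p t) : ∃ t ∈ R, p t := by
  have h1 : ∀ᶠ t in nhdsWithin s {s}ᶜ, p t := hp.filter_mono nhdsWithin_le_nhds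
  have h2 : ∀ᶠ t in nhdsWithin s {s}ᶜ, t ∈ R := by
    have := (hR.subset Set.sdiff_subset : (Rᶜ \ {s}).Finite).isClosed.isOpen_compl.mem_nhds
      (show s ∈ (Rᶜ \ {s})ᶜ by simp)
    filter_upwards [nhdsWithin_le_nhds this, self_mem_nhdsWithin] with t ht hts
    by_contra hn
    exact ht ⟨hn, hts⟩
  exact (h2.and h1).exists

end Finite

variable {x : Q → L} {hh : (Fin 7 → ℂ) →ₗ[ℂ] L}

theorem Frame.mem_engel_gnr (S : Frame x hh) {v : L} :
    v ∈ engel ℂ (hh gnr) ↔ v ∈ LinearMap.range hh := by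
  rw [mem_engel_iff]
  constructor
  · rintro ⟨n, hn⟩
    have hco : ∀ β, IsRt β → S.co β v = 0 := by
      intro β hβ
      have : ∀ n, S.co β (((LieAlgebra.ad ℂ L (hh gnr)) ^ n) v) = ev gnr β ^ n * S.co β v := by
        intro n
        induction n with
        | zero => simp
        | succ n ih =>
          rw [pow_succ', Module.End.mul_apply, LieAlgebra.ad_apply, S.co_h_lie, ih]
          ring
      have h1 := this n
      rw [hn, map_zero] at h1
      exact (mul_eq_zero.1 h1.symm).resolve_left (pow_ne_zero _ (ev_gnr_ne hβ))
    refine ⟨S.ca v, S.ext (by simp) fun β hβ => ?_⟩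
    rw [hco β hβ, S.co_h]
  · rintro ⟨a, rfl⟩
    exact ⟨1, by simpa using S.h_h gnr a⟩

theorem Frame.engel_conj (S : Frame x hh) [FiniteDimensional ℂ L] {y : L}
    (hy : LieAlgebra.IsRegular ℂ y) :
    ∃ φ : L ≃ₗ⁅ℂ⁆ L, ∀ v, v ∈ engel ℂ y ↔ φ v ∈ LinearMap.range hh := by
  set g := hh gnr
  set b := y - g
  have h1 : g + (1 : ℂ) • b = y := by simp [b]
  have hfin := regular_cofinite g b (by rwa [h1])
  have h0 := sweep ⊤ (LinearMap.range hh) g b 0 (by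
    intro v
    have : (LinearMap.range hh) ⊔ (LinearMap.range (LieAlgebra.ad ℂ L g)) = ⊤ := by
      refine eq_top_iff.2 fun v _ => S.induction (K := _) ?_ ?_ v
      · exact fun a => Submodule.mem_sup_left ⟨a, rfl⟩
      · intro β hβ
        refine Submodule.mem_sup_right ⟨(ev gnr β)⁻¹ • x β, ?_⟩
        rw [LieAlgebra.ad_apply, lie_smul, S.h_x, smul_smul,
          inv_mul_cancel₀ (ev_gnr_ne hβ), one_smul]
    obtain ⟨u, hu, w, ⟨z, rfl⟩, rfl⟩ := Submodule.mem_sup.1 (this ▸ Submodule.mem_top :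
      v ∈ LinearMap.range hh ⊔ LinearMap.range (LieAlgebra.ad ℂ L g))
    refine ⟨-z, Submodule.mem_top, u, hu, ?_⟩
    rw [zero_smul, add_zero, neg_lie, lie_skew, add_comm, LieAlgebra.ad_apply])
  obtain ⟨t, ht, φ, -, w, hw, hφ⟩ := nhds_inter_cofinite hfin h0
  rw [zero_smul, add_zero] at hφ
  have hgw : ∀ v ∈ LinearMap.range hh, v ∈ engel ℂ (g + w) := by
    rintro _ ⟨c, rfl⟩
    obtain ⟨d, rfl⟩ := hw
    refine (mem_engel_iff ℂ _ _).2 ⟨1, ?_⟩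
    rw [pow_one, LieAlgebra.ad_apply, add_lie, S.h_h, S.h_h, add_zero]
  have hreg : LieAlgebra.IsRegular ℂ (g + t • b) := ht
  have hle : engel ℂ g ≤ engel ℂ (g + w) := fun v hv => hgw v (S.mem_engel_gnr.1 hv)
  have hfr : finrank ℂ (engel ℂ (g + w)) = finrank ℂ (engel ℂ (g + t • b)) := by
    refine LinearEquiv.finrank_eq ((φ.toLinearEquiv.submoduleMap _).trans
      (LinearEquiv.ofEq _ (engel ℂ (g + t • b)).toSubmodule ?_))
    ext v
    constructor
    · rintro ⟨u, hu, rfl⟩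
      change φ u ∈ engel ℂ (g + t • b)
      rw [← hφ]
      exact (mem_engel_equiv φ _ _).2 hu
    · intro hv
      obtain ⟨u, rfl⟩ := φ.surjective v
      refine ⟨u, ?_, rfl⟩
      rw [← hφ] at hv
      exact (mem_engel_equiv φ _ _).1 hv
  have hreg2 : LieAlgebra.IsRegular ℂ (g + w) := by
    rw [LieAlgebra.isRegular_iff_finrank_engel_eq_rank] at hreg ⊢
    rw [hfr, hreg]
  have heq := engel_eq_of_le hreg2 rfl hle
  have hc := connect (p := fun s t => ∃ φ : L ≃ₗ⁅ℂ⁆ L, ∀ v, v ∈ engel ℂ (g + s • b) ↔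
      φ v ∈ engel ℂ (g + t • b)) hfin.countable (fun s hs => engel_local g b hs)
    (fun s t u ⟨φ, h⟩ ⟨ψ, h'⟩ => ⟨φ.trans ψ, fun v => (h v).trans (h' _)⟩)
    (fun s t ⟨φ, h⟩ => ⟨φ.symm, fun v => by rw [h, LieEquiv.apply_symm_apply]⟩)
    (s := 1) (t := t) (by change LieAlgebra.IsRegular ℂ _; rwa [h1]) ht
  obtain ⟨ψ, hψ⟩ := hc
  refine ⟨ψ.trans φ.symm, fun v => ?_⟩
  rw [← S.mem_engel_gnr, heq, ← h1, hψ, ← hφ, ← mem_engel_equiv φ _ ((ψ.trans φ.symm) v),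
    LieEquiv.trans_apply, LieEquiv.apply_symm_apply]

theorem Frame.semisimple_conj (S : Frame x hh) [FiniteDimensional ℂ L] {y : L}
    (hy : ⨆ n : ℤ, End.eigenspace (LieAlgebra.ad ℂ L y) (n : ℂ) = ⊤) :
    ∃ φ : L ≃ₗ⁅ℂ⁆ L, φ y ∈ LinearMap.range hh := by
  obtain ⟨r, hr⟩ := LieAlgebra.exists_isRegular ℂ L
  set b := r - y
  have h1 : y + (1 : ℂ) • b = r := by simp [b]
  have hfin := regular_cofinite y b (by rwa [h1])
  have h0 := sweep ⊤ (LinearMap.ker (LieAlgebra.ad ℂ L y)) y b 0 (by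
    intro v
    have : (LinearMap.ker (LieAlgebra.ad ℂ L y)) ⊔ (LinearMap.range (LieAlgebra.ad ℂ L y)) = ⊤ := by
      refine eq_top_iff.2 (hy ▸ iSup_le fun n u hu => ?_)
      rw [End.mem_eigenspace_iff] at hu
      by_cases hn : n = 0
      · exact Submodule.mem_sup_left (by simpa [hn] using hu)
      · refine Submodule.mem_sup_right ⟨(n : ℂ)⁻¹ • u, ?_⟩
        rw [map_smul, hu, smul_smul, inv_mul_cancel₀ (Int.cast_ne_zero.2 hn), one_smul]
    obtain ⟨u, hu, w, ⟨z, rfl⟩, rfl⟩ := Submodule.mem_sup.1 (this ▸ Submodule.mem_top :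
      v ∈ LinearMap.ker (LieAlgebra.ad ℂ L y) ⊔ LinearMap.range (LieAlgebra.ad ℂ L y))
    refine ⟨-z, Submodule.mem_top, u, hu, ?_⟩
    rw [zero_smul, add_zero, neg_lie, lie_skew, add_comm, LieAlgebra.ad_apply])
  obtain ⟨t, ht, φ, -, w, hw, hφ⟩ := nhds_inter_cofinite hfin h0
  rw [zero_smul, add_zero] at hφ
  obtain ⟨ψ, hψ⟩ := S.engel_conj (y := y + t • b) ht
  refine ⟨φ.trans ψ, ?_⟩
  rw [LieEquiv.trans_apply, ← hψ, ← hφ, mem_engel_equiv, mem_engel_iff]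
  refine ⟨1, ?_⟩
  have hw' : ⁅y, w⁆ = 0 := hw
  rw [pow_one, LieAlgebra.ad_apply, add_lie, lie_self, ← lie_skew, hw', neg_zero, add_zero]

end E7

/-! ### Orbits of elements of weight two -/

namespace E7

open Module

variable {L : Type*} [LieRing L] [LieAlgebra ℂ L]

/-- The eigenspace of `ad h` for the integer `n`. -/
noncomputable abbrev wt (h : L) (n : ℤ) : Submodule ℂ L :=
  End.eigenspace (LieAlgebra.ad ℂ L h) (n : ℂ)

theorem mem_wt {h : L} {n : ℤ} {v : L} : v ∈ wt h n ↔ ⁅h, v⁆ = (n : ℂ) • v :=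
  End.mem_eigenspace_iff

theorem lie_mem_wt {h u v : L} {m n : ℤ} (hu : u ∈ wt h m) (hv : v ∈ wt h n) :
    ⁅u, v⁆ ∈ wt h (m + n) := by
  rw [mem_wt] at *
  rw [leibniz_lie, hu, hv, smul_lie, lie_smul, Int.cast_add, add_smul]

theorem wt_disjoint (h : L) (m : ℤ) : Disjoint (wt h m) (⨆ n : ℤ, ⨆ _ : n ≠ m, wt h n) := by
  have := (Module.End.eigenspaces_iSupIndep (LieAlgebra.ad ℂ L h)).comp
    (Int.cast_injective (α := ℂ))
  exact this m

theorem Triple.surj {e h f : L} (T : Triple e h f) (he : IsNilpotent (LieAlgebra.ad ℂ L e))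
    {y : L} (hy : y ∈ wt h 2) : ∃ z ∈ wt h 0, ⁅e, z⁆ = y := by
  have hS : (⨆ n : ℤ, ⨆ _ : n ≠ 2, wt h n) ⊔ (wt h 0).map (LieAlgebra.ad ℂ L e) = ⊤ := by
    refine sl2_span (X := LieAlgebra.ad ℂ L e) (H := LieAlgebra.ad ℂ L h)
      (Y := LieAlgebra.ad ℂ L f) T.hX T.eY T.hY he _ fun m k u hu0 hu => ?_
    by_cases hk : (m : ℤ) - 2 * k = 2
    · refine Submodule.mem_sup_right ?_
      have hmk : (m : ℂ) = 2 * k + 2 := by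
        have : (m : ℤ) = 2 * k + 2 := by omega
        exact_mod_cast this
      have hc : ((k + 1) * (m - k) : ℂ) ≠ 0 :=
        mul_ne_zero (by exact_mod_cast Nat.succ_ne_zero k)
          (sub_ne_zero.2 (by exact_mod_cast (show m ≠ k by omega)))
      refine ⟨((k + 1) * (m - k) : ℂ)⁻¹ • ((LieAlgebra.ad ℂ L f) ^ (k + 1)) u, ?_, ?_⟩
      · refine Submodule.smul_mem _ _ (mem_wt.2 ?_)
        have := H_Y_pow (H := LieAlgebra.ad ℂ L h) (Y := LieAlgebra.ad ℂ L f) T.hY hu (k + 1)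
        rw [LieAlgebra.ad_apply] at this
        rw [this, hmk]
        push_cast
        congr 1
        ring
      · rw [map_smul, X_Y_pow (X := LieAlgebra.ad ℂ L e) (H := LieAlgebra.ad ℂ L h)
          T.eY T.hY hu hu0, smul_smul, inv_mul_cancel₀ hc, one_smul]
    · refine Submodule.mem_sup_left (Submodule.mem_iSup_of_mem ((m : ℤ) - 2 * k)
        (Submodule.mem_iSup_of_mem hk (End.mem_eigenspace_iff.2 ?_)))
      rw [H_Y_pow (H := LieAlgebra.ad ℂ L h) (Y := LieAlgebra.ad ℂ L f) T.hY hu]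
      push_cast
      rfl
  obtain ⟨a, ha, _, ⟨z, hz, rfl⟩, hs⟩ := Submodule.mem_sup.1 (hS ▸ Submodule.mem_top : y ∈ _ ⊔ _)
  refine ⟨z, hz, ?_⟩
  have he2 : ⁅e, z⁆ ∈ wt h 2 := by
    have := lie_mem_wt (mem_wt.2 (by simpa using T.he) : e ∈ wt h 2) hz
    simpa using this
  have ha2 : a ∈ wt h 2 := by
    rw [← hs] at hy
    simpa using sub_mem hy he2
  have := (Submodule.disjoint_def.1 (wt_disjoint h 2)) a ha2 ha
  rw [← hs, this, zero_add]
  rfl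

theorem orbit [FiniteDimensional ℂ L] {h e e' : L} (htop : ⨆ n : ℤ, wt h n = ⊤)
    (he : e ∈ wt h 2) (he' : e' ∈ wt h 2)
    (hs : ∀ y ∈ wt h 2, ∃ z ∈ wt h 0, ⁅e, z⁆ = y)
    (hs' : ∀ y ∈ wt h 2, ∃ z ∈ wt h 0, ⁅e', z⁆ = y) : ∃ φ : L ≃ₗ⁅ℂ⁆ L, φ e = e' := by
  set b := e' - e
  have hb : b ∈ wt h 2 := sub_mem he' he
  have hmaps : ∀ v ∈ wt h 2, ∀ z ∈ wt h 0, LieAlgebra.ad ℂ L v z ∈ wt h 2 := fun v hv z hz => by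
    simpa using lie_mem_wt hv hz
  let R : Set ℂ := {t | ∀ y ∈ wt h 2, ∃ z ∈ wt h 0, ⁅e + t • b, z⁆ = y}
  have hR : Rᶜ.Finite := by
    let Me : wt h 0 →ₗ[ℂ] wt h 2 := (LieAlgebra.ad ℂ L e).restrict (hmaps e he)
    let Mb : wt h 0 →ₗ[ℂ] wt h 2 := (LieAlgebra.ad ℂ L b).restrict (hmaps b hb)
    obtain ⟨σ, hσ⟩ := Me.exists_rightInverse_of_surjective (by
      rw [LinearMap.range_eq_top]
      rintro ⟨y, hy⟩
      obtain ⟨z, hz, h1⟩ := hs y hy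
      exact ⟨⟨z, hz⟩, Subtype.ext h1⟩)
    let N : End ℂ (wt h 2) := Mb ∘ₗ σ
    refine (N.finite_hasEigenvalue.image fun μ => -μ⁻¹).subset fun t ht => ?_
    have hni : ¬Function.Injective (1 + t • N : End ℂ (wt h 2)) := by
      intro hinj
      refine ht fun y hy => ?_
      obtain ⟨u, hu⟩ := LinearMap.injective_iff_surjective.1 hinj ⟨y, hy⟩
      refine ⟨σ u, (σ u).2, ?_⟩
      have h1 : ⁅e, (σ u : L)⁆ = u := congrArg Subtype.val (congrArg (fun f => f u) hσ)
      have h2 : ⁅b, (σ u : L)⁆ = (N u : L) := rfl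
      rw [add_lie, smul_lie, h1, h2]
      exact congrArg Subtype.val hu
    rw [← LinearMap.ker_eq_bot, Submodule.eq_bot_iff] at hni
    push Not at hni
    obtain ⟨u, hu, hu0⟩ := hni
    have hu2 : u + t • N u = 0 := hu
    have ht0 : t ≠ 0 := by
      rintro rfl
      rw [zero_smul, add_zero] at hu2
      exact hu0 hu2
    refine ⟨-t⁻¹, ?_, by simp⟩
    refine End.hasEigenvalue_of_hasEigenvector (x := u) (End.hasEigenvector_iff.2
      ⟨End.mem_eigenspace_iff.2 ?_, hu0⟩)
    have h3 : t⁻¹ • (u + t • N u) = 0 := by rw [hu2, smul_zero]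
    rw [smul_add, smul_smul, inv_mul_cancel₀ ht0, one_smul] at h3
    rw [neg_smul]
    exact eq_neg_of_add_eq_zero_right h3
  have hp : ∀ t : ℂ, e + t • b ∈ wt h 2 := fun t => add_mem he (Submodule.smul_mem _ _ hb)
  have hloc : ∀ s ∈ R, ∀ᶠ t in nhds s, t ∈ R →
      ∃ φ : L ≃ₗ⁅ℂ⁆ L, φ (e + s • b) = e + t • b := by
    intro s hs
    have h1 := sweep (wt h 0) (⨆ n : ℤ, ⨆ _ : n ≠ 2, wt h n) e b s (by
      intro y
      have : (wt h 0).map (LieAlgebra.ad ℂ L (e + s • b)) ⊔ (⨆ n : ℤ, ⨆ _ : n ≠ 2, wt h n) = ⊤ := by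
        refine eq_top_iff.2 (htop ▸ iSup_le fun n v hv => ?_)
        by_cases hn : n = 2
        · subst hn
          obtain ⟨z, hz, h1⟩ := hs v hv
          exact Submodule.mem_sup_left ⟨z, hz, h1⟩
        · exact Submodule.mem_sup_right (Submodule.mem_iSup_of_mem n
            (Submodule.mem_iSup_of_mem hn hv))
      obtain ⟨_, ⟨z, hz, rfl⟩, w, hw, rfl⟩ :=
        Submodule.mem_sup.1 (this ▸ Submodule.mem_top : y ∈ _ ⊔ _)
      refine ⟨-z, neg_mem hz, w, hw, ?_⟩
      rw [neg_lie, lie_skew, LieAlgebra.ad_apply])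
    filter_upwards [h1] with t ht _
    obtain ⟨φ, hfix, w, hw, hφ⟩ := ht
    have hh : φ h = h := hfix h fun z hz => by
      have := mem_wt.1 hz
      rw [← lie_skew, this]
      simp
    have hw2 : w ∈ wt h 2 := by
      have h2 : e + s • b + w ∈ wt h 2 := by
        rw [mem_wt]
        apply φ.toLinearEquiv.injective
        change φ _ = φ _
        rw [LieEquiv.map_lie, hh, hφ, mem_wt.1 (hp t), ← hφ]
        exact (φ.toLinearEquiv.map_smul _ _).symm
      simpa using sub_mem h2 (hp s)
    have hw0 := (Submodule.disjoint_def.1 (wt_disjoint h 2)) w hw2 hw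
    rw [hw0, add_zero] at hφ
    exact ⟨φ, hφ⟩
  have hc := connect (p := fun s t => ∃ φ : L ≃ₗ⁅ℂ⁆ L, φ (e + s • b) = e + t • b) hR.countable hloc
    (fun s t u ⟨φ, h⟩ ⟨ψ, h'⟩ => ⟨φ.trans ψ, by rw [LieEquiv.trans_apply, h, h']⟩)
    (fun s t ⟨φ, h⟩ => ⟨φ.symm, by rw [← h, LieEquiv.symm_apply_apply]⟩)
    (s := 0) (t := 1) (by simpa [R] using hs) (by simpa [R, b] using hs')
  simpa [b] using hc

end E7

/-! ### The Weyl group action on frames -/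

namespace E7

open Module

/-- The value of a root lattice element at an integral coweight. -/
def iv (m : Fin 7 → ℤ) (β : Q) : ℤ := ∑ i, β i * m i

/-- The complexification of an integral coweight. -/
def cv (m : Fin 7 → ℤ) : Fin 7 → ℂ := fun i => (m i : ℂ)

theorem ev_cv (m : Fin 7 → ℤ) (β : Q) : ev (cv m) β = (iv m β : ℂ) := by
  simp [ev, cv, iv]

theorem iv_add (m : Fin 7 → ℤ) (β γ : Q) : iv m (β + γ) = iv m β + iv m γ := by
  simp [iv, add_mul, Finset.sum_add_distrib]

theorem iv_neg (m : Fin 7 → ℤ) (β : Q) : iv m (-β) = -iv m β := by simp [iv]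

/-- The simple reflections on the root lattice. -/
def sref (i : Fin 7) (β : Q) : Q := fun j => β j - pair β i * sr i j

theorem sref_eq (i : Fin 7) (β : Q) : sref i β = β - pair β i • sr i := rfl

theorem pair_smul (c : ℤ) (β : Q) (i : Fin 7) : pair (c • β) i = c * pair β i := by
  simp [pair, Finset.mul_sum, mul_assoc]

theorem sref_sref (i : Fin 7) (β : Q) : sref i (sref i β) = β := by
  simp only [sref_eq, pair_sub, pair_smul, pair_sr, A_self]
  module

theorem sref_neg (i : Fin 7) (β : Q) : sref i (-β) = -sref i β := by
  simp only [sref_eq, pair_neg]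
  module

theorem sref_add (i : Fin 7) (β γ : Q) : sref i (β + γ) = sref i β + sref i γ := by
  simp only [sref_eq, pair_add]
  module

theorem isRt_sref_pos : ∀ β ∈ posL, ∀ i, IsRt (sref i β) := by
  have : ∀ β ∈ posL, ∀ i, sref i β ∈ posL ∨ -sref i β ∈ posL := by decide +kernel
  exact this

theorem IsRt.sref {β : Q} (h : IsRt β) (i : Fin 7) : IsRt (sref i β) := by
  rcases isRt_iff.1 h with h | h
  · exact isRt_sref_pos β h i
  · have := (isRt_sref_pos _ h i).neg
    rwa [sref_neg, neg_neg] at this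

/-- The simple reflections on coweights. -/
def rfw (m : Fin 7 → ℤ) (i : Fin 7) : Fin 7 → ℤ := fun j => m j - m i * A i j

theorem iv_rfw (m : Fin 7 → ℤ) (i : Fin 7) (β : Q) : iv (rfw m i) β = iv m (sref i β) := by
  simp only [iv, rfw, sref, sub_mul, mul_sub, Finset.sum_sub_distrib]
  congr 1
  simp only [sr, Pi.single_apply, mul_ite, mul_one, mul_zero, ite_mul, zero_mul,
    Finset.sum_ite_eq', Finset.mem_univ, if_true, pair, Finset.sum_mul]
  refine Finset.sum_congr rfl fun j _ => ?_
  rw [A_symm j i]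
  ring

/-- The simple reflections on complex coweights. -/
noncomputable def rfc (i : Fin 7) : (Fin 7 → ℂ) →ₗ[ℂ] (Fin 7 → ℂ) :=
  LinearMap.id - (LinearMap.proj i).smulRight (fun j => (A i j : ℂ))

theorem rfc_apply (i : Fin 7) (a : Fin 7 → ℂ) (j : Fin 7) :
    rfc i a j = a j - a i * (A i j : ℂ) := rfl

theorem rfc_rfc (i : Fin 7) (a : Fin 7 → ℂ) : rfc i (rfc i a) = a := by
  funext j
  simp only [rfc_apply, A_self]
  push_cast
  ring

theorem rfc_cv (i : Fin 7) (m : Fin 7 → ℤ) : rfc i (cv m) = cv (rfw m i) := by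
  funext j
  simp [rfc_apply, cv, rfw]

theorem ev_rfc (i : Fin 7) (a : Fin 7 → ℂ) (β : Q) : ev (rfc i a) β = ev a (sref i β) := by
  simp only [ev, rfc_apply, sref, mul_sub, Int.cast_sub, sub_mul, Finset.sum_sub_distrib]
  congr 1
  simp only [sr, Pi.single_apply, mul_ite, mul_one, mul_zero, ite_mul, zero_mul, Int.cast_ite,
    Int.cast_zero, Finset.sum_ite_eq', Finset.mem_univ, if_true, pair, Int.cast_sum, Int.cast_mul,
    Finset.sum_mul]
  refine Finset.sum_congr rfl fun j _ => ?_
  rw [A_symm j i]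
  ring

variable {L : Type*} [LieRing L] [LieAlgebra ℂ L] {x : Q → L} {hh : (Fin 7 → ℂ) →ₗ[ℂ] L}

theorem Frame.reflect (S : Frame x hh) (i : Fin 7) :
    Frame (fun β => x (sref i β)) (hh ∘ₗ rfc i) where
  x_ne β := by
    rw [S.x_ne]
    refine ⟨fun h => ?_, fun h => h.sref i⟩
    have := h.sref i
    rwa [sref_sref] at this
  h_x a β := by
    rw [LinearMap.comp_apply, S.h_x, ev_rfc, sref_sref]
  h_h a b := S.h_h _ _
  x_neg β hβ := by
    obtain ⟨c, hc, h⟩ := S.x_neg _ (hβ.sref i)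
    refine ⟨c, hc, ?_⟩
    rw [sref_neg, h, LinearMap.comp_apply]
    congr 2
    funext j
    rw [rfc_apply, sref_eq, pair_sub, pair_smul, pair_sr]
    push_cast
    ring
  x_add α β h := by
    obtain ⟨c, hc⟩ := S.x_add (sref i α) (sref i β) fun h2 => h (by
      rw [← sref_add] at h2
      rw [← sref_sref i (α + β), h2]
      simp [sref_eq, pair])
    exact ⟨c, by rw [hc, sref_add]⟩
  span := by
    rw [← S.span]
    congr 1
    · congr 1
      exact Function.Surjective.range_comp
        (fun β => ⟨sref i β, sref_sref i β⟩ : Function.Surjective (sref i)) x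
    · refine LinearMap.range_comp_of_range_eq_top _ (LinearMap.range_eq_top.2 fun a => ?_)
      exact ⟨rfc i a, rfc_rfc i a⟩

theorem Frame.map (S : Frame x hh) (φ : L ≃ₗ⁅ℂ⁆ L) :
    Frame (fun β => φ (x β)) (φ.toLinearEquiv.toLinearMap ∘ₗ hh) where
  x_ne β := by
    rw [← S.x_ne]
    exact (φ.toLinearEquiv.map_eq_zero_iff (x := x β)).not
  h_x a β := by
    change ⁅φ (hh a), φ (x β)⁆ = _
    rw [← LieEquiv.map_lie, S.h_x]
    exact φ.toLinearEquiv.map_smul _ _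
  h_h a b := by
    change ⁅φ (hh a), φ (hh b)⁆ = _
    rw [← LieEquiv.map_lie, S.h_h]
    exact φ.toLinearEquiv.map_zero
  x_neg β hβ := by
    obtain ⟨c, hc, h⟩ := S.x_neg β hβ
    refine ⟨c, hc, ?_⟩
    rw [← LieEquiv.map_lie, h]
    exact φ.toLinearEquiv.map_smul _ _
  x_add α β h := by
    obtain ⟨c, hc⟩ := S.x_add α β h
    refine ⟨c, ?_⟩
    rw [← LieEquiv.map_lie, hc]
    exact φ.toLinearEquiv.map_smul _ _
  span := by
    have h1 := congrArg (Submodule.map φ.toLinearEquiv.toLinearMap) S.span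
    rw [Submodule.map_sup, Submodule.map_span, ← Set.range_comp, ← LinearMap.range_comp,
      Submodule.map_top, LinearEquiv.range] at h1
    exact h1

/-- `y` is the integral coweight `m` in some frame. -/
def Adm (y : L) (m : Fin 7 → ℤ) : Prop :=
  ∃ (x : Q → L) (hh : (Fin 7 → ℂ) →ₗ[ℂ] L), Frame x hh ∧ y = hh (cv m)

theorem Adm.rfw {y : L} {m : Fin 7 → ℤ} (h : Adm y m) (i : Fin 7) : Adm y (rfw m i) := by
  obtain ⟨x, hh, S, rfl⟩ := h
  refine ⟨_, _, S.reflect i, ?_⟩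
  rw [← rfc_cv, LinearMap.comp_apply, rfc_rfc]

theorem Adm.foldl {y : L} (w : List (Fin 7)) : ∀ {m : Fin 7 → ℤ}, Adm y m →
    Adm y (w.foldl E7.rfw m) := by
  induction w with
  | nil => exact fun h => h
  | cons i w ih => exact fun h => ih (h.rfw i)

theorem Frame.adm (S : Frame x hh) [FiniteDimensional ℂ L] {y : L}
    (hy : ⨆ n : ℤ, wt y n = ⊤) : ∃ m, Adm y m := by
  obtain ⟨φ, a, ha⟩ := S.semisimple_conj hy
  have S' := S.map φ.symm
  have hya : y = (φ.symm.toLinearEquiv.toLinearMap ∘ₗ hh) a := by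
    change y = φ.symm (hh a)
    rw [ha, LieEquiv.symm_apply_apply]
  have h_int : ∀ i, ∃ n : ℤ, a i = n := by
    intro i
    have h1 := S'.h_x a (sr i)
    rw [← hya, ev_sr] at h1
    by_contra hcon
    push Not at hcon
    have h2 : φ.symm (x (sr i)) ∈ ⨆ n : ℤ, wt y n := hy ▸ Submodule.mem_top
    have hind := Module.End.eigenspaces_iSupIndep (LieAlgebra.ad ℂ L y)
    have h3 := (Submodule.disjoint_def.1 (hind (a i))) (φ.symm (x (sr i)))
      (End.mem_eigenspace_iff.2 h1) ((iSup_le fun n : ℤ => le_iSup₂_of_le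
        (f := fun (μ : ℂ) (_ : μ ≠ a i) => End.eigenspace (LieAlgebra.ad ℂ L y) μ)
        (n : ℂ) (hcon n).symm le_rfl) h2)
    exact (S'.x_ne _).2 (isRt_sr i) h3
  choose m hm using h_int
  refine ⟨m, _, _, S', ?_⟩
  rw [hya]
  congr 1
  funext i
  exact hm i

/-- Minus twice the sum of the negative values of the positive roots. -/
def neg2 (m : Fin 7 → ℤ) : ℤ := ∑ β : Rt, |iv m β.1| - 2 * (posL.map (iv m)).sum

theorem neg2_nonneg (m : Fin 7 → ℤ) : 0 ≤ neg2 m := by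
  rw [neg2, sum_Rt fun β => |iv m β|, sub_nonneg, ← List.sum_map_mul_left]
  refine List.sum_le_sum fun β _ => ?_
  rw [iv_neg, abs_neg]
  have := le_abs_self (iv m β)
  omega

/-- A simple reflection as a permutation of the roots. -/
def rfE (i : Fin 7) : Rt ≃ Rt where
  toFun β := ⟨sref i β.1, β.2.sref i⟩
  invFun β := ⟨sref i β.1, β.2.sref i⟩
  left_inv β := Subtype.ext (sref_sref i β.1)
  right_inv β := Subtype.ext (sref_sref i β.1)

theorem sum_iv (m : Fin 7 → ℤ) : (posL.map (iv m)).sum = 34 * m 0 + 49 * m 1 + 66 * m 2 +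
    96 * m 3 + 75 * m 4 + 52 * m 5 + 27 * m 6 := by
  have h1 : ∀ l : List Q, (l.map (iv m)).sum = ∑ i, (l.map fun β => β i).sum * m i := by
    intro l
    induction l with
    | nil => simp
    | cons β l ih => simp [ih, iv, add_mul, Finset.sum_add_distrib]
  have h2 : ∀ i, (posL.map fun β => β i).sum = (![34, 49, 66, 96, 75, 52, 27] : Q) i := by
    decide +kernel
  rw [h1]
  simp only [h2, Fin.sum_univ_seven]
  rfl

theorem neg2_rfw (m : Fin 7 → ℤ) (i : Fin 7) : neg2 (rfw m i) = neg2 m + 4 * m i := by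
  have h1 : ∑ β : Rt, |iv (rfw m i) β.1| = ∑ β : Rt, |iv m β.1| := by
    simp only [iv_rfw]
    exact (rfE i).sum_comp (fun β : Rt => |iv m β.1|)
  have h2 : (posL.map (iv (rfw m i))).sum = (posL.map (iv m)).sum - 2 * m i := by
    rw [sum_iv, sum_iv]
    simp only [rfw]
    fin_cases i <;>
    · simp [CartanMatrix.E₇]
      ring
  rw [neg2, neg2, h1, h2]
  ring

theorem Adm.dominant {y : L} : ∀ (n : ℕ) (m : Fin 7 → ℤ), neg2 m ≤ n → Adm y m →
    ∃ m', (∀ i, 0 ≤ m' i) ∧ Adm y m' := by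
  intro n
  induction n with
  | zero =>
    intro m hm h
    refine ⟨m, fun i => ?_, h⟩
    have h1 := neg2_rfw m i
    have h2 := neg2_nonneg (E7.rfw m i)
    push_cast at hm
    omega
  | succ n ih =>
    intro m hm h
    by_cases hd : ∀ i, 0 ≤ m i
    · exact ⟨m, hd, h⟩
    · push Not at hd
      obtain ⟨i, hi⟩ := hd
      refine ih _ ?_ (h.rfw i)
      rw [neg2_rfw]
      push_cast at hm
      omega

end E7

/-! ### Classification of the neutral element -/

namespace E7

open Module

/-- The positive roots as tuples of natural numbers. -/
def posT : List (ℕ × ℕ × ℕ × ℕ × ℕ × ℕ × ℕ) := posL.map fun β =>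
  ((β 0).toNat, (β 1).toNat, (β 2).toNat, (β 3).toNat, (β 4).toNat, (β 5).toNat, (β 6).toNat)

/-- The number of roots of value `0` or `1` at a coweight. -/
def cnt (t : List (ℕ × ℕ × ℕ × ℕ × ℕ × ℕ × ℕ)) (m0 m1 m2 m3 m4 m5 m6 : ℕ) : ℕ :=
  t.foldr (fun b n => (2 - (b.1 * m0 + b.2.1 * m1 + b.2.2.1 * m2 + b.2.2.2.1 * m3 +
    b.2.2.2.2.1 * m4 + b.2.2.2.2.2.1 * m5 + b.2.2.2.2.2.2 * m6)) + n) 0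

theorem cnt_posT : ∀ m0 ∈ [0, 1, 2], ∀ m1 ∈ [0, 1, 2], ∀ m2 ∈ [0, 1, 2], ∀ m3 ∈ [0, 1, 2],
    ∀ m4 ∈ [0, 1, 2], ∀ m5 ∈ [0, 1, 2], ∀ m6 ∈ [0, 1, 2], cnt posT m0 m1 m2 m3 m4 m5 m6 = 34 →
    [m0, m1, m2, m3, m4, m5, m6] ∈ [[0, 0, 0, 0, 1, 1, 0], [0, 1, 0, 0, 1, 0, 0],
      [1, 0, 0, 0, 0, 2, 0], [1, 0, 0, 1, 0, 0, 0]] := by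
  decide +kernel

theorem iv_nonneg {m : Fin 7 → ℤ} (hm : ∀ i, 0 ≤ m i) {β : Q} (hβ : β ∈ posL) : 0 ≤ iv m β :=
  Finset.sum_nonneg fun i _ => mul_nonneg (posL_nonneg β hβ i) (hm i)

theorem iv_cap {m : Fin 7 → ℤ} (hm : ∀ i, 0 ≤ m i) {β : Q} (hβ : β ∈ posL) :
    2 - (iv m β).toNat = 2 - (iv (fun i => min (m i) 2) β).toNat := by
  have hle : iv (fun i => min (m i) 2) β ≤ iv m β :=
    Finset.sum_le_sum fun i _ => mul_le_mul_of_nonneg_left (min_le_left _ _) (posL_nonneg β hβ i)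
  have hc : ∀ i, 0 ≤ min (m i) 2 := fun i => le_min (hm i) (by norm_num)
  by_cases h1 : iv (fun i => min (m i) 2) β ≤ 1
  · have : iv (fun i => min (m i) 2) β = iv m β := by
      refine Finset.sum_congr rfl fun i _ => ?_
      have h2 : β i * min (m i) 2 ≤ 1 := (Finset.single_le_sum
        (f := fun i => β i * min (m i) 2)
        (fun j _ => mul_nonneg (posL_nonneg β hβ j) (hc j)) (Finset.mem_univ i)).trans h1
      have h0 := posL_nonneg β hβ i
      change β i * min (m i) 2 = β i * m i
      rcases le_total (m i) 2 with h3 | h3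
      · rw [min_eq_left h3]
      · rw [min_eq_right h3] at h2 ⊢
        have : β i = 0 := by omega
        simp [this]
    rw [this]
  · omega

theorem cnt_eq (m : Fin 7 → ℤ) (hm : ∀ i, 0 ≤ m i) : cnt posT (m 0).toNat (m 1).toNat (m 2).toNat
    (m 3).toNat (m 4).toNat (m 5).toNat (m 6).toNat =
    (posL.map fun β => 2 - (iv m β).toNat).sum := by
  have h : ∀ l : List Q, (∀ β ∈ l, ∀ i, 0 ≤ β i) → cnt (l.map fun β =>
      ((β 0).toNat, (β 1).toNat, (β 2).toNat, (β 3).toNat, (β 4).toNat, (β 5).toNat, (β 6).toNat))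
      (m 0).toNat (m 1).toNat (m 2).toNat (m 3).toNat (m 4).toNat (m 5).toNat (m 6).toNat =
      (l.map fun β => 2 - (iv m β).toNat).sum := by
    intro l hl
    induction l with
    | nil => rfl
    | cons β l ih =>
      have hi := ih fun γ hγ => hl γ (List.mem_cons_of_mem _ hγ)
      have hβ := hl β List.mem_cons_self
      rw [List.map_cons, List.map_cons, List.sum_cons, ← hi]
      simp only [cnt, List.foldr_cons]
      congr 2
      zify
      rw [iv, Int.toNat_of_nonneg (Finset.sum_nonneg fun i _ => mul_nonneg (hβ i) (hm i))]
      simp only [Int.toNat_of_nonneg (hβ _), Int.toNat_of_nonneg (hm _), Fin.sum_univ_seven]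
  exact h posL fun β hβ => posL_nonneg β hβ

theorem card_deg (m : Fin 7 → ℤ) (hm : ∀ i, 0 ≤ m i) :
    Fintype.card {i : Fin 7 ⊕ Rt // Sum.elim (fun _ => 0) (fun β : Rt => iv m β.1) i = 0 ∨
      Sum.elim (fun _ => 0) (fun β : Rt => iv m β.1) i = 1} =
      7 + (posL.map fun β => 2 - (iv m β).toNat).sum := by
  have h1 : (∑ i : Fin 7 ⊕ Rt, if Sum.elim (fun _ => 0) (fun β : Rt => iv m β.1) i = 0 ∨
      Sum.elim (fun _ => 0) (fun β : Rt => iv m β.1) i = 1 then 1 else 0) =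
      7 + ∑ β : Rt, if iv m β.1 = 0 ∨ iv m β.1 = 1 then 1 else 0 := by
    rw [Fintype.sum_sum_type]
    simp only [Sum.elim_inl, Sum.elim_inr, true_or, if_true, Finset.sum_const, Finset.card_univ,
      Fintype.card_fin, smul_eq_mul, mul_one]
    exact congrArg (7 + ·) (Finset.sum_congr rfl fun β _ => by congr)
  rw [Fintype.card_subtype, Finset.card_filter, h1,
    sum_Rt fun β => if iv m β = 0 ∨ iv m β = 1 then 1 else 0]
  have h2 : ∀ β ∈ posL, ((if iv m β = 0 ∨ iv m β = 1 then 1 else 0) +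
      if iv m (-β) = 0 ∨ iv m (-β) = 1 then 1 else 0) = 2 - (iv m β).toNat := by
    intro β hβ
    have := iv_nonneg hm hβ
    rw [iv_neg]
    split_ifs <;> omega
  rw [List.map_congr_left h2]

variable {L : Type*} [LieRing L] [LieAlgebra ℂ L] {x : Q → L} {hh : (Fin 7 → ℂ) →ₗ[ℂ] L}

theorem Frame.finrank_ker (S : Frame x hh) {e f : L} (m : Fin 7 → ℤ)
    (T : Triple e (hh (cv m)) f) (he : IsNilpotent (LieAlgebra.ad ℂ L e)) :
    finrank ℂ (LinearMap.ker (LieAlgebra.ad ℂ L e)) =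
      Fintype.card {i : Fin 7 ⊕ Rt // Sum.elim (fun _ => 0) (fun β : Rt => iv m β.1) i = 0 ∨
        Sum.elim (fun _ => 0) (fun β : Rt => iv m β.1) i = 1} := by
  refine T.finrank_ker he S.basis ?_
  rintro (i | β)
  · simp [S.basis_inl, S.h_h]
  · rw [S.basis_inr, S.h_x, ev_cv]
    rfl

/-- The coordinates of half the Killing form against an integral coweight. -/
def kfz (z : Fin 7 → ℤ) (i : Fin 7) : ℤ := (posL.map fun β => β i * iv z β).sum

theorem Frame.kf_cv (S : Frame x hh) (m z : Fin 7 → ℤ) :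
    killingForm ℂ L (hh (cv m)) (hh (cv z)) = ((2 * ∑ i, kfz z i * m i : ℤ) : ℂ) := by
  have h1 : ∀ l : List Q, (l.map fun β => iv m β * iv z β + iv m β * iv z β).sum =
      2 * ∑ i, (l.map fun β => β i * iv z β).sum * m i := by
    intro l
    induction l with
    | nil => simp
    | cons β l ih =>
      simp only [List.map_cons, List.sum_cons, ih, add_mul, Finset.sum_add_distrib, mul_add]
      rw [← two_mul, iv, Finset.sum_mul]
      congr 2
      exact Finset.sum_congr rfl fun i _ => by ring
  have h2 : ∑ β : Rt, iv m β.1 * iv z β.1 = 2 * ∑ i, kfz z i * m i := by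
    rw [sum_Rt fun β => iv m β * iv z β]
    simp only [iv_neg, neg_mul_neg]
    exact h1 posL
  rw [S.kf_h, ← h2, Int.cast_sum]
  exact Finset.sum_congr rfl fun β _ => by rw [ev_cv, ev_cv, Int.cast_mul]

theorem Frame.kf_obstruction (S : Frame x hh) {e f : L} {m : Fin 7 → ℤ}
    (T : Triple e (hh (cv m)) f) (z : Fin 7 → ℤ)
    (hz : ∀ β, IsRt β → iv m β = 2 → iv z β = 0) : ∑ i, kfz z i * m i = 0 := by
  have hez : ⁅hh (cv z), e⁆ = 0 := by
    refine S.ext (by rw [S.ca_h_lie, map_zero]) fun β hβ => ?_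
    rw [S.co_h_lie, ev_cv, map_zero]
    by_cases h2 : iv m β = 2
    · rw [hz β hβ h2, Int.cast_zero, zero_mul]
    · have h1 := S.co_h_lie (cv m) β e
      rw [T.he, map_smul, ev_cv, smul_eq_mul] at h1
      have h3 : S.co β e = 0 := by
        by_contra hne
        exact h2 (by exact_mod_cast (mul_right_cancel₀ hne h1).symm)
      rw [h3, mul_zero]
  have h0 : killingForm ℂ L (hh (cv m)) (hh (cv z)) = 0 := by
    rw [← T.ef, ← lie_skew, map_neg, LinearMap.neg_apply, kf_inv, ← lie_skew, hez]
    simp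
  rw [S.kf_cv] at h0
  have h1 : 2 * ∑ i, kfz z i * m i = 0 := by exact_mod_cast h0
  omega

theorem iv_obstruction {m z : Fin 7 → ℤ} (h : ∀ β ∈ posL, iv m β = 2 → iv z β = 0)
    (hm : ∀ i, 0 ≤ m i) : ∀ β, IsRt β → iv m β = 2 → iv z β = 0 := by
  intro β hβ h2
  rcases isRt_iff.1 hβ with h1 | h1
  · exact h β h1 h2
  · have := iv_nonneg hm h1
    rw [iv_neg] at this
    omega

theorem Adm.classify {e y f : L} {m : Fin 7 → ℤ} (hm : ∀ i, 0 ≤ m i)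
    (T : Triple e y f) (hA : Adm y m) (he : IsNilpotent (LieAlgebra.ad ℂ L e))
    (hd : finrank ℂ (LinearMap.ker (LieAlgebra.ad ℂ L e)) = 41) :
    m = ![1, 0, 0, 1, 0, 0, 0] := by
  obtain ⟨x, hh, S, rfl⟩ := hA
  have hob := fun z h => S.kf_obstruction T z (iv_obstruction h hm)
  rw [S.finrank_ker m T he, card_deg m hm] at hd
  have hc := cnt_eq (fun i => min (m i) 2) fun i => le_min (hm i) (by norm_num)
  have h1 : (posL.map fun β => 2 - (iv m β).toNat).sum =
      (posL.map fun β => 2 - (iv (fun i => min (m i) 2) β).toNat).sum :=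
    congrArg _ (List.map_congr_left fun β hβ => iv_cap hm hβ)
  have hmem : ∀ i, (min (m i) 2).toNat ∈ [0, 1, 2] := fun i => by
    have := hm i
    simp only [List.mem_cons, List.not_mem_nil, or_false]
    omega
  have hm0 := hm 0
  have hm1 := hm 1
  have hm2 := hm 2
  have hm3 := hm 3
  have hm4 := hm 4
  have hm5 := hm 5
  have hm6 := hm 6
  have key := cnt_posT _ (hmem 0) _ (hmem 1) _ (hmem 2) _ (hmem 3) _ (hmem 4) _ (hmem 5) _
    (hmem 6) (by omega)
  simp only [List.mem_cons, List.not_mem_nil, or_false, List.cons.injEq, and_true] at key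
  rcases key with h | h | h | h
  · exfalso
    have hm' : m = ![0, 0, 0, 0, 1, 1, 0] := by
      funext i
      fin_cases i <;> simp <;> omega
    subst hm'
    exact absurd (hob ![0, 0, 0, 0, 1, -1, 0] (by decide +kernel)) (by decide +kernel)
  · exfalso
    have hm' : m = ![0, 1, 0, 0, 1, 0, 0] := by
      funext i
      fin_cases i <;> simp <;> omega
    subst hm'
    exact absurd (hob ![0, 1, 0, 0, -1, 0, 0] (by decide +kernel)) (by decide +kernel)
  · exfalso
    have hm' : m = ![1, 0, 0, 0, 0, m 5, 0] := by
      funext i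
      fin_cases i <;> simp <;> omega
    have hk : 2 ≤ m 5 := by omega
    have hiv : ∀ β : Q, iv m β = β 0 + β 5 * m 5 := by
      intro β
      rw [hm']
      simp [iv, Fin.sum_univ_seven]
    have hz : ∀ β : Q, iv ![1, 0, 0, 0, 0, 0, 0] β = β 0 := by
      intro β
      simp [iv, Fin.sum_univ_seven]
    have hp : ∀ β ∈ posL, β 5 = 0 → β 0 ≤ 1 := by decide +kernel
    have h2 := hob ![1, 0, 0, 0, 0, 0, 0] fun β hβ h2 => by
      rw [hiv] at h2
      rw [hz]
      have h3 := posL_nonneg β hβ 0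
      rcases (posL_nonneg β hβ 5).eq_or_lt with h4 | h4
      · have := hp β hβ h4.symm
        rw [← h4] at h2
        omega
      · nlinarith
    have hf : kfz ![1, 0, 0, 0, 0, 0, 0] = ![36, 36, 54, 72, 54, 36, 18] := by decide +kernel
    rw [hf, hm'] at h2
    simp [Fin.sum_univ_seven] at h2
    omega
  · funext i
    fin_cases i <;> simp <;> omega

theorem Frame.exists_adm (S : Frame x hh) {e : L} (he : IsNilpotent (LieAlgebra.ad ℂ L e))
    (hd : finrank ℂ (LinearMap.ker (LieAlgebra.ad ℂ L e)) = 41) :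
    ∃ y f, Triple e y f ∧ Adm y ![2, 0, -1, -3, 2, 2, 2] := by
  have := S.finite
  obtain ⟨y, f, T⟩ := S.exists_triple he
  obtain ⟨m, hm⟩ := S.adm (T.iSup_eig he)
  obtain ⟨m', hm', hA⟩ := hm.dominant (neg2 m).toNat m (Int.self_le_toNat _)
  have := hA.classify hm' T he hd
  subst this
  refine ⟨y, f, T, ?_⟩
  have h1 := hA.foldl [3, 4, 5, 6, 1, 0, 2, 0, 3, 2, 0, 4, 3, 2, 1, 3, 2, 0, 5, 4, 3, 1, 2, 3]
  have h2 : [3, 4, 5, 6, 1, 0, 2, 0, 3, 2, 0, 4, 3, 2, 1, 3, 2, 0, 5, 4, 3, 1, 2, 3].foldl E7.rfw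
      ![1, 0, 0, 1, 0, 0, 0] = ![2, 0, -1, -3, 2, 2, 2] := by decide +kernel
  rwa [h2] at h1

end E7

/-! ### The representative of the orbit -/

namespace E7

open Module

/-- The invariant bilinear form on the root lattice. -/
def ip (α β : Q) : ℤ := iv (pair α) β

theorem ip_comm (α β : Q) : ip α β = ip β α := by
  simp only [ip, iv, pair, Finset.mul_sum]
  rw [Finset.sum_comm]
  refine Finset.sum_congr rfl fun i _ => Finset.sum_congr rfl fun j _ => ?_
  rw [A_symm]
  ring

theorem ip_add_right (α β γ : Q) : ip α (β + γ) = ip α β + ip α γ := iv_add _ _ _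

theorem ip_neg_right (α β : Q) : ip α (-β) = -ip α β := iv_neg _ _

theorem ip_add_left (α β γ : Q) : ip (α + β) γ = ip α γ + ip β γ := by
  rw [ip_comm, ip_add_right, ip_comm γ α, ip_comm γ β]

theorem ip_neg_left (α β : Q) : ip (-α) β = -ip α β := by
  rw [ip_comm, ip_neg_right, ip_comm]

theorem ip_self_pos : ∀ β ∈ posL, ip β β = 2 := by decide +kernel

theorem IsRt.ip_self {β : Q} (h : IsRt β) : ip β β = 2 := by
  rcases isRt_iff.1 h with h | h
  · exact ip_self_pos β h
  · have := ip_self_pos _ h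
    rwa [ip_neg_left, ip_neg_right, neg_neg] at this

namespace Frame

variable {L : Type*} [LieRing L] [LieAlgebra ℂ L] {x : Q → L} {hh : (Fin 7 → ℂ) →ₗ[ℂ] L}

/-- The structure constants of a frame. -/
noncomputable def n (S : Frame x hh) (α β : Q) : ℂ := S.co (α + β) ⁅x α, x β⁆

theorem co_of_not (S : Frame x hh) {β : Q} (hβ : ¬IsRt β) : S.co β = 0 := by
  rw [co, dif_neg hβ]

theorem lie_x_x (S : Frame x hh) {α β : Q} (h : α + β ≠ 0) :
    ⁅x α, x β⁆ = S.n α β • x (α + β) := by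
  obtain ⟨c, hc⟩ := S.x_add α β h
  by_cases hr : IsRt (α + β)
  · rw [n, hc, map_smul, S.co_x hr, if_pos rfl, smul_eq_mul, mul_one]
  · rw [hc, S.x_eq_zero hr, smul_zero, smul_zero]

theorem lie_x_x_eq_zero (S : Frame x hh) {α β : Q} (h : α + β ≠ 0) (hr : ¬IsRt (α + β)) :
    ⁅x α, x β⁆ = 0 := by
  rw [S.lie_x_x h, S.x_eq_zero hr, smul_zero]

theorem n_ne_zero (S : Frame x hh) {α β : Q} (hα : IsRt α) (hβ : IsRt β) (hr : IsRt (α + β)) :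
    S.n α β ≠ 0 := by
  intro h0
  have h1 : ⁅x α, x β⁆ = 0 := by rw [S.lie_x_x hr.ne_zero, h0, zero_smul]
  have hip : ip α β = -1 := by
    have := hr.ip_self
    rw [ip_add_left, ip_add_right, ip_add_right, ip_comm β α, hα.ip_self, hβ.ip_self] at this
    omega
  have hn : ¬IsRt (-α + β) := fun h => by
    have := h.ip_self
    rw [ip_add_left, ip_add_right, ip_add_right, ip_comm β, ip_neg_left, ip_neg_left, ip_neg_right,
      hα.ip_self, hβ.ip_self] at this
    omega
  have hn0 : -α + β ≠ 0 := fun h => by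
    have : β = α := (neg_add_eq_zero.1 h).symm
    rw [this, hα.ip_self] at hip
    omega
  obtain ⟨c, hc, h2⟩ := S.x_neg α hα
  have h3 : ⁅x (-α), ⁅x α, x β⁆⁆ = 0 := by rw [h1, lie_zero]
  rw [leibniz_lie, S.lie_x_x_eq_zero hn0 hn, lie_zero, add_zero, ← lie_skew (x (-α)), h2, neg_lie,
    smul_lie, S.h_x, neg_eq_zero] at h3
  have h4 : ev (fun i => (pair α i : ℂ)) β = ((-1 : ℤ) : ℂ) := by
    rw [← hip]
    exact ev_cv _ _
  rw [h4] at h3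
  exact (S.x_ne β).2 hβ (by simpa [hc] using h3)

theorem co_x_lie (S : Frame x hh) {α δ : Q} (h : δ ≠ α) (y : L) :
    S.co δ ⁅x α, y⁆ = S.n α (δ - α) * S.co (δ - α) y := by
  have := S.induction (K := LinearMap.ker (S.co δ ∘ₗ (LieAlgebra.ad ℂ L (x α) : L →ₗ[ℂ] L) -
    S.n α (δ - α) • S.co (δ - α))) ?_ ?_ y
  · simpa [sub_eq_zero] using this
  · intro a
    simp only [LinearMap.mem_ker, LinearMap.sub_apply, LinearMap.comp_apply, LieAlgebra.ad_apply,
      LinearMap.smul_apply, co_h, smul_zero, sub_zero]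
    rw [← lie_skew, S.h_x, map_neg, map_smul]
    by_cases hα : IsRt α
    · rw [S.co_x hα, if_neg h.symm, smul_zero, neg_zero]
    · rw [S.x_eq_zero hα, map_zero, smul_zero, neg_zero]
  · intro γ hγ
    simp only [LinearMap.mem_ker, LinearMap.sub_apply, LinearMap.comp_apply, LieAlgebra.ad_apply,
      LinearMap.smul_apply, S.co_x hγ, smul_eq_mul]
    by_cases hs : γ = δ - α
    · subst hs
      rw [if_pos rfl, mul_one, n, add_sub_cancel, sub_self]
    · rw [if_neg hs, mul_zero, sub_zero]
      by_cases h0 : α + γ = 0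
      · have hα : γ = -α := eq_neg_of_add_eq_zero_right h0
        subst hα
        have hα := hγ.neg
        rw [neg_neg] at hα
        obtain ⟨c, -, hc⟩ := S.x_neg α hα
        rw [hc, map_smul, co_h, smul_zero]
      · rw [S.lie_x_x h0, map_smul]
        by_cases hr : IsRt (α + γ)
        · rw [S.co_x hr, if_neg fun h2 => hs (by rw [← h2]; abel), smul_zero]
        · rw [S.x_eq_zero hr, map_zero, smul_zero]

theorem co_x_lie_self (S : Frame x hh) {α : Q} (hα : IsRt α) (y : L) :
    S.co α ⁅x α, y⁆ = -ev (S.ca y) α := by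
  have h1 : ⁅x α, y⁆ = -(ev (S.ca y) α • x α) + ⁅x α, y - hh (S.ca y)⁆ := by
    rw [lie_sub, ← lie_skew (x α) (hh _), S.h_x]
    abel
  have h2 : ∀ z : L, S.co α ⁅x α, z - hh (S.ca z)⁆ = 0 := by
    intro z
    have := S.induction (K := LinearMap.ker (S.co α ∘ₗ (LieAlgebra.ad ℂ L (x α) : L →ₗ[ℂ] L) ∘ₗ
      (LinearMap.id - hh ∘ₗ S.ca))) ?_ ?_ z
    · simpa using this
    · intro a
      simp
    · intro γ hγ
      simp only [LinearMap.mem_ker, LinearMap.sub_apply, LinearMap.comp_apply,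
        LieAlgebra.ad_apply, LinearMap.id_apply, ca_x, map_zero, sub_zero]
      by_cases h0 : α + γ = 0
      · have hα' : γ = -α := eq_neg_of_add_eq_zero_right h0
        subst hα'
        obtain ⟨c, -, hc⟩ := S.x_neg α hα
        rw [hc, map_smul, co_h, smul_zero]
      · rw [S.lie_x_x h0, map_smul]
        by_cases hr : IsRt (α + γ)
        · rw [S.co_x hr, if_neg fun h2 => hγ.ne_zero (by simpa using h2), smul_zero]
        · rw [S.x_eq_zero hr, map_zero, smul_zero]
  rw [h1, map_add, h2, add_zero, map_neg, map_smul, S.co_x hα, if_pos rfl, smul_eq_mul, mul_one]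

end Frame

/-- The coordinates of the neutral element of the regular nilpotent of the Levi subalgebra
with simple roots `sr 0, sr 4, sr 5, sr 6`. -/
def m₀ : Fin 7 → ℤ := ![2, 0, -1, -3, 2, 2, 2]

/-- The sum of the simple root vectors of the Levi subalgebra. -/
def e₀ {L : Type*} [LieRing L] (x : Q → L) : L := x (sr 0) + x (sr 4) + x (sr 5) + x (sr 6)

namespace Frame

variable {L : Type*} [LieRing L] [LieAlgebra ℂ L] {x : Q → L} {hh : (Fin 7 → ℂ) →ₗ[ℂ] L}

theorem h_e₀ (S : Frame x hh) : ⁅hh (cv m₀), e₀ x⁆ = (2 : ℂ) • e₀ x := by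
  simp only [e₀, lie_add, S.h_x, ev_sr, smul_add]
  simp [cv, m₀]

theorem exists_f₀ (S : Frame x hh) : ∃ f, Triple (e₀ x) (hh (cv m₀)) f := by
  have hc : ∀ i, ∃ c : ℂ, c ≠ 0 ∧ ⁅x (sr i), x (-sr i)⁆ = c • hh (cv (A i)) := by
    intro i
    obtain ⟨c, hc, h⟩ := S.x_neg _ (isRt_sr i)
    refine ⟨c, hc, h.trans ?_⟩
    congr 2
    funext j
    rw [pair_sr]
    rfl
  choose c hc0 hc using hc
  have h0 : ∀ i j, i ≠ j → ⁅x (sr i), x (-sr j)⁆ = 0 := by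
    intro i j hij
    refine S.lie_x_x_eq_zero (fun h => hij ?_) ?_
    · have := congrFun h i
      by_contra h2
      simp [sr, h2] at this
    · revert i j
      have : ∀ i j : Fin 7, i ≠ j → sr i + -sr j ∉ posL ∧ -(sr i + -sr j) ∉ posL := by
        decide +kernel
      intro i j hij h
      exact (isRt_iff.1 h).elim (this i j hij).1 (this i j hij).2
  refine ⟨(c 0)⁻¹ • x (-sr 0) + (3 * (c 4)⁻¹) • x (-sr 4) + (4 * (c 5)⁻¹) • x (-sr 5) +
    (3 * (c 6)⁻¹) • x (-sr 6), S.h_e₀, ?_, ?_⟩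
  · simp only [lie_add, lie_smul, S.h_x, ev_neg, ev_sr]
    simp only [cv, m₀]
    simp
    module
  · simp only [e₀, add_lie, lie_add, lie_smul, hc]
    rw [h0 0 4 (by decide), h0 0 5 (by decide), h0 0 6 (by decide), h0 4 0 (by decide),
      h0 4 5 (by decide), h0 4 6 (by decide), h0 5 0 (by decide), h0 5 4 (by decide),
      h0 5 6 (by decide), h0 6 0 (by decide), h0 6 4 (by decide), h0 6 5 (by decide)]
    simp only [add_zero, zero_add, ← map_smul, ← map_add]
    congr 1
    funext j
    simp only [cv, Pi.add_apply, Pi.smul_apply, smul_eq_mul]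
    have : ∀ j, A 0 j + 3 * A 4 j + 4 * A 5 j + 3 * A 6 j = m₀ j := by decide +kernel
    rw [← this]
    push_cast
    linear_combination (A 0 j : ℂ) * mul_inv_cancel₀ (hc0 0) +
      3 * (A 4 j : ℂ) * mul_inv_cancel₀ (hc0 4) + 4 * (A 5 j : ℂ) * mul_inv_cancel₀ (hc0 5) +
      3 * (A 6 j : ℂ) * mul_inv_cancel₀ (hc0 6)

theorem e₀_nilpotent (S : Frame x hh) : IsNilpotent (LieAlgebra.ad ℂ L (e₀ x)) := by
  have hb : ∀ β ∈ posL, |iv m₀ β| ≤ 50 := by decide +kernel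
  have hbot : ∀ k : ℤ, 50 < k → wt (hh (cv m₀)) k = ⊥ := by
    intro k hk
    rw [Submodule.eq_bot_iff]
    intro v hv
    rw [mem_wt] at hv
    have hk0 : (k : ℂ) ≠ 0 := by exact_mod_cast (show k ≠ 0 by omega)
    refine S.ext ?_ fun β hβ => ?_
    · have := S.ca_h_lie (cv m₀) v
      rw [hv, map_smul] at this
      rw [map_zero]
      exact (smul_eq_zero.1 this).resolve_left hk0
    · have := S.co_h_lie (cv m₀) β v
      rw [hv, map_smul, ev_cv, smul_eq_mul] at this
      rw [map_zero]
      by_contra hne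
      have h2 : k = iv m₀ β := by exact_mod_cast mul_right_cancel₀ hne this
      rcases isRt_iff.1 hβ with h | h
      · have := hb _ h
        rw [← h2] at this
        exact absurd (abs_le.1 this).2 (by omega)
      · have := hb _ h
        rw [iv_neg, ← h2] at this
        have := (abs_le.1 this).1
        omega
  have hstep : ∀ (n : ℕ) (k : ℤ) (v : L), v ∈ wt (hh (cv m₀)) k →
      ((LieAlgebra.ad ℂ L (e₀ x)) ^ n) v ∈ wt (hh (cv m₀)) (k + 2 * n) := by
    intro n k v hv
    induction n with
    | zero => simpa using hv
    | succ n ih =>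
      rw [pow_succ', Module.End.mul_apply, LieAlgebra.ad_apply]
      have := lie_mem_wt (mem_wt.2 (by simpa using S.h_e₀) : e₀ x ∈ wt (hh (cv m₀)) 2) ih
      rw [show (2 : ℤ) + (k + 2 * n) = k + 2 * ((n + 1 : ℕ) : ℤ) by push_cast; ring] at this
      exact this
  have hkill : ∀ (k : ℤ) (v : L), -50 ≤ k → v ∈ wt (hh (cv m₀)) k →
      ((LieAlgebra.ad ℂ L (e₀ x)) ^ 51) v = 0 := by
    intro k v hk hv
    have := hstep 51 k v hv
    rwa [hbot _ (by push_cast; omega), Submodule.mem_bot] at this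
  refine ⟨51, LinearMap.ext fun v => ?_⟩
  refine S.induction (K := LinearMap.ker ((LieAlgebra.ad ℂ L (e₀ x)) ^ 51)) ?_ ?_ v
  · intro a
    exact hkill 0 _ (by norm_num) (mem_wt.2 (by rw [S.h_h]; simp))
  · intro β hβ
    refine hkill (iv m₀ β) _ ?_ (mem_wt.2 (by rw [S.h_x, ev_cv]))
    rcases isRt_iff.1 hβ with h | h
    · exact (abs_le.1 (hb _ h)).1
    · have := (abs_le.1 (hb _ h)).2
      rw [iv_neg] at this
      omega

theorem exists_e₀ (S : Frame x hh) {e : L} (he : IsNilpotent (LieAlgebra.ad ℂ L e))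
    (hd : finrank ℂ (LinearMap.ker (LieAlgebra.ad ℂ L e)) = 41) :
    ∃ (x' : Q → L) (hh' : (Fin 7 → ℂ) →ₗ[ℂ] L), Frame x' hh' ∧
      ∃ φ : L ≃ₗ⁅ℂ⁆ L, φ (e₀ x') = e := by
  have := S.finite
  obtain ⟨y, f, T, x', hh', S', rfl⟩ := S.exists_adm he hd
  obtain ⟨f₀, T₀⟩ := S'.exists_f₀
  refine ⟨x', hh', S', orbit (T.iSup_eig he) ?_ ?_ ?_ ?_⟩
  · exact mem_wt.2 (by simpa [m₀] using S'.h_e₀)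
  · exact mem_wt.2 (by simpa using T.he)
  · exact fun y hy => T₀.surj S'.e₀_nilpotent hy
  · exact fun y hy => T.surj he hy

end Frame

end E7

/-! ### The representative is not in the derived algebra -/

namespace E7

open Module

/-- A combinatorial criterion for the coefficient at `β` to vanish on the centralizer of `e₀`. -/
def Killed (β : Q) : Prop :=
  iv m₀ β < 0 ∨ ∃ s ∈ [0, 4, 5, 6], IsRt (β + sr s) ∧ ∀ t ∈ [0, 4, 5, 6],
    β + sr s ≠ sr t ∧ (t ≠ s → ¬IsRt (β + sr s - sr t))

instance : DecidablePred Killed := fun _ => inferInstanceAs (Decidable (_ ∨ _))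

theorem killed_or : ∀ β ∈ posL,
    (IsRt (sr 5 - β) → Killed β ∨ Killed (sr 5 - β)) ∧
      (IsRt (sr 5 - -β) → Killed (-β) ∨ Killed (sr 5 - -β)) := by
  decide +kernel

theorem not_isRt_sub : ∀ s ∈ [0, 4, 5, 6], ∀ t ∈ [0, 4, 5, 6], s ≠ t →
    ¬IsRt (sr s - sr t) := by
  decide +kernel

theorem sr_injective : Function.Injective sr := fun i j h => by
  by_contra hij
  have := congrFun h i
  simp [sr, hij] at this

namespace Frame

variable {L : Type*} [LieRing L] [LieAlgebra ℂ L] {x : Q → L} {hh : (Fin 7 → ℂ) →ₗ[ℂ] L}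

theorem co_e₀_lie (S : Frame x hh) {δ : Q} (h : ∀ t ∈ [0, 4, 5, 6], δ ≠ sr t) (y : L) :
    S.co δ ⁅e₀ x, y⁆ = S.n (sr 0) (δ - sr 0) * S.co (δ - sr 0) y +
      S.n (sr 4) (δ - sr 4) * S.co (δ - sr 4) y + S.n (sr 5) (δ - sr 5) * S.co (δ - sr 5) y +
      S.n (sr 6) (δ - sr 6) * S.co (δ - sr 6) y := by
  simp only [e₀, add_lie, map_add]
  rw [S.co_x_lie (h 0 (by simp)), S.co_x_lie (h 4 (by simp)), S.co_x_lie (h 5 (by simp)),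
    S.co_x_lie (h 6 (by simp))]

theorem co_sr_e₀_lie (S : Frame x hh) {s : Fin 7} (hs : s ∈ [0, 4, 5, 6]) (y : L) :
    S.co (sr s) ⁅e₀ x, y⁆ = -ev (S.ca y) (sr s) := by
  have key : ∀ t ∈ [0, 4, 5, 6], s ≠ t → S.co (sr s) ⁅x (sr t), y⁆ = 0 := by
    intro t ht hst
    rw [S.co_x_lie (sr_injective.ne hst), S.co_of_not (not_isRt_sub s hs t ht hst),
      LinearMap.zero_apply, mul_zero]
  simp only [e₀, add_lie, map_add]
  simp only [List.mem_cons, List.not_mem_nil, or_false] at hs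
  rcases hs with rfl | rfl | rfl | rfl
  · rw [key 4 (by simp) (by decide), key 5 (by simp) (by decide), key 6 (by simp) (by decide),
      S.co_x_lie_self (isRt_sr _), add_zero, add_zero, add_zero]
  · rw [key 0 (by simp) (by decide), key 5 (by simp) (by decide), key 6 (by simp) (by decide),
      S.co_x_lie_self (isRt_sr _), add_zero, add_zero, zero_add]
  · rw [key 0 (by simp) (by decide), key 4 (by simp) (by decide), key 6 (by simp) (by decide),
      S.co_x_lie_self (isRt_sr _), add_zero, zero_add, zero_add]
  · rw [key 0 (by simp) (by decide), key 4 (by simp) (by decide), key 5 (by simp) (by decide),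
      S.co_x_lie_self (isRt_sr _), zero_add, zero_add, zero_add]

theorem ev_ca_eq_zero (S : Frame x hh) {y : L} (hy : ⁅e₀ x, y⁆ = 0) {s : Fin 7}
    (hs : s ∈ [0, 4, 5, 6]) : ev (S.ca y) (sr s) = 0 := by
  have := S.co_sr_e₀_lie hs y
  rw [hy, map_zero] at this
  exact neg_eq_zero.1 this.symm

theorem co_eq_zero_of_neg (S : Frame x hh) {y : L} (hy : ⁅e₀ x, y⁆ = 0) {β : Q}
    (hβ : iv m₀ β < 0) : S.co β y = 0 := by
  have := S.finite
  obtain ⟨f, T⟩ := S.exists_f₀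
  refine hwt_le (K := LinearMap.ker (S.co β)) ?_
    (ker_le_hwt (X := LieAlgebra.ad ℂ L (e₀ x)) (Y := LieAlgebra.ad ℂ L f)
      (H := LieAlgebra.ad ℂ L (hh (cv m₀))) T.hX T.eY S.e₀_nilpotent hy)
  intro m v _ _ hv
  have h := S.co_h_lie (cv m₀) β v
  change ⁅hh (cv m₀), v⁆ = _ at hv
  rw [hv, map_smul, ev_cv, smul_eq_mul] at h
  by_contra hne
  have h2 : (m : ℤ) = iv m₀ β := by exact_mod_cast mul_right_cancel₀ hne h
  omega

theorem co_eq_zero_of_killed (S : Frame x hh) {y : L} (hy : ⁅e₀ x, y⁆ = 0) {β : Q}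
    (hβ : IsRt β) (hk : Killed β) : S.co β y = 0 := by
  rcases hk with hk | ⟨s, hs, hr, hk⟩
  · exact S.co_eq_zero_of_neg hy hk
  have h := S.co_e₀_lie (fun t ht => (hk t ht).1) y
  have h0 : ∀ t ∈ [0, 4, 5, 6], t ≠ s → S.n (sr t) (β + sr s - sr t) *
      S.co (β + sr s - sr t) y = 0 := by
    intro t ht hts
    rw [S.co_of_not ((hk t ht).2 hts), LinearMap.zero_apply, mul_zero]
  have h1 : S.n (sr s) (β + sr s - sr s) * S.co (β + sr s - sr s) y = 0 := by
    rw [hy, map_zero] at h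
    simp only [List.mem_cons, List.not_mem_nil, or_false] at hs
    rcases hs with rfl | rfl | rfl | rfl
    · rwa [h0 4 (by simp) (by decide), h0 5 (by simp) (by decide), h0 6 (by simp) (by decide),
        add_zero, add_zero, add_zero, eq_comm] at h
    · rwa [h0 0 (by simp) (by decide), h0 5 (by simp) (by decide), h0 6 (by simp) (by decide),
        add_zero, add_zero, zero_add, eq_comm] at h
    · rwa [h0 0 (by simp) (by decide), h0 4 (by simp) (by decide), h0 6 (by simp) (by decide),
        add_zero, zero_add, zero_add, eq_comm] at h
    · rwa [h0 0 (by simp) (by decide), h0 4 (by simp) (by decide), h0 5 (by simp) (by decide),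
        zero_add, zero_add, zero_add, eq_comm] at h
  rw [add_sub_cancel_right] at h1
  refine (mul_eq_zero.1 h1).resolve_left (S.n_ne_zero (isRt_sr s) hβ ?_)
  rwa [add_comm]

theorem co_sr_lie_eq_zero (S : Frame x hh) {u v : L} (hu : ⁅e₀ x, u⁆ = 0) (hv : ⁅e₀ x, v⁆ = 0) :
    S.co (sr 5) ⁅u, v⁆ = 0 := by
  rw [S.expand u, add_lie, map_add, S.co_h_lie, S.ev_ca_eq_zero hu (by simp), zero_mul, zero_add,
    sum_lie, map_sum]
  refine Finset.sum_eq_zero fun β _ => ?_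
  rw [smul_lie, map_smul, smul_eq_mul]
  by_cases hs : sr 5 = β.1
  · rw [← hs, S.co_x_lie_self (isRt_sr _), S.ev_ca_eq_zero hv (by simp), neg_zero, mul_zero]
  rw [S.co_x_lie hs]
  by_cases hr : IsRt (sr 5 - β.1)
  · have hk : Killed β.1 ∨ Killed (sr 5 - β.1) := by
      rcases isRt_iff.1 β.2 with h | h
      · exact (killed_or _ h).1 hr
      · have := (killed_or _ h).2
        rw [neg_neg] at this
        exact this hr
    rcases hk with hk | hk
    · rw [S.co_eq_zero_of_killed hu β.2 hk, zero_mul]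
    · rw [S.co_eq_zero_of_killed hv hr hk, mul_zero, mul_zero]
  · rw [S.co_of_not hr, LinearMap.zero_apply, mul_zero, mul_zero]

theorem co_sr_e₀ (S : Frame x hh) : S.co (sr 5) (e₀ x) = 1 := by
  simp only [e₀, map_add, S.co_x (isRt_sr _), sr_injective.eq_iff]
  simp

end Frame

/-- The derived algebra of the centralizer. -/
def der {L : Type*} [LieRing L] [LieAlgebra ℂ L] (e : L) : Submodule ℂ L :=
  Submodule.span ℂ {z : L | ∃ x ∈ LinearMap.ker (LieAlgebra.ad ℂ L e),
    ∃ y ∈ LinearMap.ker (LieAlgebra.ad ℂ L e), ⁅x, y⁆ = z}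

theorem Frame.e₀_not_mem {L : Type*} [LieRing L] [LieAlgebra ℂ L] {x : Q → L}
    {hh : (Fin 7 → ℂ) →ₗ[ℂ] L} (S : Frame x hh) : e₀ x ∉ der (e₀ x) := by
  intro h
  have h2 : der (e₀ x) ≤ LinearMap.ker (S.co (sr 5)) := by
    refine Submodule.span_le.2 ?_
    rintro _ ⟨u, hu, v, hv, rfl⟩
    exact S.co_sr_lie_eq_zero hu hv
  have := h2 h
  rw [LinearMap.mem_ker, S.co_sr_e₀] at this
  exact one_ne_zero this

end E7

/-! ### Elements of the derived algebra -/

namespace E7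

open Module

section der

variable {L : Type*} [LieRing L] [LieAlgebra ℂ L] {e : L}

theorem lie_mem_der {u v : L} (hu : ⁅e, u⁆ = 0) (hv : ⁅e, v⁆ = 0) : ⁅u, v⁆ ∈ der e :=
  Submodule.subset_span ⟨u, hu, v, hv, rfl⟩

theorem der_le : der e ≤ LinearMap.ker (LieAlgebra.ad ℂ L e) := by
  refine Submodule.span_le.2 ?_
  rintro _ ⟨u, hu, v, hv, rfl⟩
  rw [SetLike.mem_coe, LinearMap.mem_ker, LieAlgebra.ad_apply] at *
  rw [leibniz_lie, hu, hv, zero_lie, lie_zero, add_zero]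

end der

/-- At most the simple root vector of index `s` moves the root vector of `α`. -/
def Only (s : Fin 7) (α : Q) : Prop :=
  ∀ t ∈ [0, 4, 5, 6], sr t + α ≠ 0 ∧ (t ≠ s → ¬IsRt (sr t + α))

instance (s : Fin 7) (α : Q) : Decidable (Only s α) :=
  inferInstanceAs (Decidable (∀ _ ∈ _, _))

/-- The root vector of `α` commutes with `e₀`. -/
def Ann (α : Q) : Prop := ∀ t ∈ [0, 4, 5, 6], sr t + α ≠ 0 ∧ ¬IsRt (sr t + α)

instance (α : Q) : Decidable (Ann α) := inferInstanceAs (Decidable (∀ _ ∈ _, _))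

namespace Frame

variable {L : Type*} [LieRing L] [LieAlgebra ℂ L] {x : Q → L} {hh : (Fin 7 → ℂ) →ₗ[ℂ] L}

theorem e₀_lie_x (S : Frame x hh) {s : Fin 7} (hs : s ∈ [0, 4, 5, 6]) {α : Q} (h : Only s α) :
    ⁅e₀ x, x α⁆ = S.n (sr s) α • x (sr s + α) := by
  have key : ∀ t ∈ [0, 4, 5, 6], t ≠ s → ⁅x (sr t), x α⁆ = 0 := fun t ht hts =>
    S.lie_x_x_eq_zero (h t ht).1 ((h t ht).2 hts)
  simp only [e₀, add_lie]
  rw [← S.lie_x_x (h s hs).1]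
  simp only [List.mem_cons, List.not_mem_nil, or_false] at hs
  rcases hs with rfl | rfl | rfl | rfl
  · rw [key 4 (by simp) (by decide), key 5 (by simp) (by decide), key 6 (by simp) (by decide),
      add_zero, add_zero, add_zero]
  · rw [key 0 (by simp) (by decide), key 5 (by simp) (by decide), key 6 (by simp) (by decide),
      add_zero, add_zero, zero_add]
  · rw [key 0 (by simp) (by decide), key 4 (by simp) (by decide), key 6 (by simp) (by decide),
      add_zero, zero_add, zero_add]
  · rw [key 0 (by simp) (by decide), key 4 (by simp) (by decide), key 5 (by simp) (by decide),
      zero_add, zero_add, zero_add]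

theorem e₀_lie_x_eq_zero (S : Frame x hh) {α : Q} (h : Ann α) : ⁅e₀ x, x α⁆ = 0 := by
  rw [S.e₀_lie_x (s := 0) (by simp) fun t ht => ⟨(h t ht).1, fun _ => (h t ht).2⟩,
    S.x_eq_zero (h 0 (by simp)).2, smul_zero]

theorem e₀_lie_comb (S : Frame x hh) {s t : Fin 7} (hs : s ∈ [0, 4, 5, 6])
    (ht : t ∈ [0, 4, 5, 6]) {α β : Q} (hα : Only s α) (hβ : Only t β)
    (h : sr s + α = sr t + β) :
    ⁅e₀ x, S.n (sr t) β • x α - S.n (sr s) α • x β⁆ = 0 := by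
  rw [lie_sub, lie_smul, lie_smul, S.e₀_lie_x hs hα, S.e₀_lie_x ht hβ, h, smul_comm, sub_self]

theorem x_mem_der (S : Frame x hh) {α β : Q} (h : IsRt α ∧ IsRt β ∧ IsRt (α + β))
    (hα : Ann α) (hβ : Ann β) : x (α + β) ∈ der (e₀ x) := by
  have := lie_mem_der (S.e₀_lie_x_eq_zero hα) (S.e₀_lie_x_eq_zero hβ)
  rw [S.lie_x_x h.2.2.ne_zero] at this
  exact ((der (e₀ x)).smul_mem_iff (S.n_ne_zero h.1 h.2.1 h.2.2)).1 this

theorem h_mem_der (S : Frame x hh) {α : Q} (h : IsRt α) (hα : Ann α) (hα' : Ann (-α)) :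
    hh (cv (pair α)) ∈ der (e₀ x) := by
  have := lie_mem_der (S.e₀_lie_x_eq_zero hα) (S.e₀_lie_x_eq_zero hα')
  obtain ⟨c, hc, h⟩ := S.x_neg α h
  rw [h] at this
  exact ((der (e₀ x)).smul_mem_iff hc).1 this

theorem x_sr_zero_mem (S : Frame x hh) : x (sr 0) ∈ der (e₀ x) := by
  have := S.x_mem_der (α := -sr 2) (β := sr 0 + sr 2) (by decide +kernel) (by decide +kernel)
    (by decide +kernel)
  rwa [show -sr 2 + (sr 0 + sr 2) = sr 0 by abel] at this

theorem x_top_mem (S : Frame x hh) : x (sr 4 + sr 5 + sr 6) ∈ der (e₀ x) := by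
  have := S.x_mem_der (α := -sr 3) (β := sr 3 + sr 4 + sr 5 + sr 6) (by decide +kernel)
    (by decide +kernel) (by decide +kernel)
  rwa [show -sr 3 + (sr 3 + sr 4 + sr 5 + sr 6) = sr 4 + sr 5 + sr 6 by abel] at this

/-- The commutator of `a • x α + b • x β` and `c • x γ + d • x δ` when two of the four sums are
neither zero nor roots. -/
theorem lie_comb (S : Frame x hh) {α β γ δ : Q} (a b c d : ℂ)
    (h1 : α + δ ≠ 0 ∧ ¬IsRt (α + δ)) (h2 : β + γ ≠ 0 ∧ ¬IsRt (β + γ)) :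
    ⁅a • x α - b • x β, c • x γ - d • x δ⁆ = (a * c) • ⁅x α, x γ⁆ + (b * d) • ⁅x β, x δ⁆ := by
  simp only [sub_lie, lie_sub, smul_lie, lie_smul, S.lie_x_x_eq_zero h1.1 h1.2,
    S.lie_x_x_eq_zero h2.1 h2.2]
  module

theorem comb_mem (S : Frame x hh) {p q : ℂ}
    (h : S.n (sr 6) (sr 4 + sr 5) * p + S.n (sr 4) (sr 5 + sr 6) * q = 0) :
    p • x (sr 4 + sr 5) + q • x (sr 5 + sr 6) ∈ der (e₀ x) := by
  have hc : ∀ p q : ℂ, p • x (sr 4 + sr 5) + q • x (sr 5 + sr 6) ∈ der (e₀ x) →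
      S.n (sr 6) (sr 4 + sr 5) * p + S.n (sr 4) (sr 5 + sr 6) * q = 0 := by
    intro p q h
    have := der_le h
    rw [LinearMap.mem_ker, LieAlgebra.ad_apply, lie_add, lie_smul, lie_smul,
      S.e₀_lie_x (s := 6) (by simp) (by decide +kernel),
      S.e₀_lie_x (s := 4) (by simp) (by decide +kernel),
      show sr 6 + (sr 4 + sr 5) = sr 4 + (sr 5 + sr 6) by abel, smul_smul, smul_smul,
      ← add_smul] at this
    have := (smul_eq_zero.1 this).resolve_right ((S.x_ne _).2 (by decide +kernel))
    linear_combination this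
  have h1 := S.e₀_lie_comb (s := 0) (t := 6) (α := ![0, 0, 1, 1, 1, 1, 1])
    (β := ![1, 0, 1, 1, 1, 1, 0]) (by simp) (by simp) (by decide +kernel) (by decide +kernel)
    (by decide +kernel)
  have h2 := S.e₀_lie_comb (s := 4) (t := 0) (α := ![0, 0, -1, -1, -1, 0, 0])
    (β := ![-1, 0, -1, -1, 0, 0, 0]) (by simp) (by simp) (by decide +kernel) (by decide +kernel)
    (by decide +kernel)
  have h3 := lie_mem_der h1 h2
  rw [S.lie_comb _ _ _ _ (by decide +kernel) (by decide +kernel), S.lie_x_x (by decide +kernel),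
    S.lie_x_x (by decide +kernel),
    show (![0, 0, 1, 1, 1, 1, 1] + ![0, 0, -1, -1, -1, 0, 0] : Q) = sr 5 + sr 6 by decide +kernel,
    show (![1, 0, 1, 1, 1, 1, 0] + ![-1, 0, -1, -1, 0, 0, 0] : Q) = sr 4 + sr 5 by decide +kernel,
    smul_smul, smul_smul, add_comm] at h3
  have hr : ∀ α β : Q, IsRt α ∧ IsRt β ∧ IsRt (α + β) → S.n α β ≠ 0 := fun α β h =>
    S.n_ne_zero h.1 h.2.1 h.2.2
  have h4 := hc _ _ h3
  have hp0 := mul_ne_zero (mul_ne_zero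
    (hr (sr 0) ![0, 0, 1, 1, 1, 1, 1] (by decide +kernel))
    (hr (sr 4) ![0, 0, -1, -1, -1, 0, 0] (by decide +kernel)))
    (hr ![1, 0, 1, 1, 1, 1, 0] ![-1, 0, -1, -1, 0, 0, 0] (by decide +kernel))
  revert h3 h4 hp0
  generalize S.n (sr 0) ![0, 0, 1, 1, 1, 1, 1] * S.n (sr 4) ![0, 0, -1, -1, -1, 0, 0] *
    S.n ![1, 0, 1, 1, 1, 1, 0] ![-1, 0, -1, -1, 0, 0, 0] = p₁
  generalize S.n (sr 6) ![1, 0, 1, 1, 1, 1, 0] * S.n (sr 0) ![-1, 0, -1, -1, 0, 0, 0] *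
    S.n ![0, 0, 1, 1, 1, 1, 1] ![0, 0, -1, -1, -1, 0, 0] = q₁
  intro h3 h4 hp0
  have hq := hr (sr 4) (sr 5 + sr 6) (by decide +kernel)
  have hpq : q = p * p₁⁻¹ * q₁ := by
    field_simp
    refine mul_left_cancel₀ hq ?_
    linear_combination p₁ * h - p * h4
  have := (der (e₀ x)).smul_mem (p * p₁⁻¹) h3
  rwa [smul_add, smul_smul, smul_smul, ← hpq, mul_assoc, inv_mul_cancel₀ hp0, mul_one] at this

theorem h_sum_mem (S : Frame x hh) :
    hh (cv (pair ![1, 1, 2, 2, 1, 1, 1] + pair ![1, 1, 2, 2, 2, 1, 0])) ∈ der (e₀ x) := by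
  have h1 := S.e₀_lie_comb (s := 4) (t := 6) (α := ![1, 1, 2, 2, 1, 1, 1])
    (β := ![1, 1, 2, 2, 2, 1, 0]) (by simp) (by simp) (by decide +kernel) (by decide +kernel)
    (by decide +kernel)
  have h2 := S.e₀_lie_comb (s := 6) (t := 4) (α := -![1, 1, 2, 2, 1, 1, 1])
    (β := -![1, 1, 2, 2, 2, 1, 0]) (by simp) (by simp) (by decide +kernel) (by decide +kernel)
    (by decide +kernel)
  have h3 := lie_mem_der h1 h2
  rw [S.lie_comb _ _ _ _ (by decide +kernel) (by decide +kernel)] at h3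
  obtain ⟨c₁, hc₁, e₁⟩ := S.x_neg ![1, 1, 2, 2, 1, 1, 1] (by decide +kernel)
  obtain ⟨c₂, hc₂, e₂⟩ := S.x_neg ![1, 1, 2, 2, 2, 1, 0] (by decide +kernel)
  have hr : ∀ α β : Q, IsRt α ∧ IsRt β ∧ IsRt (α + β) → S.n α β ≠ 0 := fun α β h =>
    S.n_ne_zero h.1 h.2.1 h.2.2
  have hp0 := mul_ne_zero (mul_ne_zero
    (hr (sr 6) ![1, 1, 2, 2, 2, 1, 0] (by decide +kernel))
    (hr (sr 4) (-![1, 1, 2, 2, 2, 1, 0]) (by decide +kernel))) hc₁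
  rw [e₁, e₂, smul_smul, smul_smul] at h3
  revert h3 hp0
  generalize S.n (sr 6) ![1, 1, 2, 2, 2, 1, 0] * S.n (sr 4) (-![1, 1, 2, 2, 2, 1, 0]) * c₁ = p
  generalize S.n (sr 4) ![1, 1, 2, 2, 1, 1, 1] * S.n (sr 6) (-![1, 1, 2, 2, 1, 1, 1]) * c₂ = q
  intro h3 hp0
  have h4 := S.ev_ca_eq_zero (der_le h3) (s := 4) (by simp)
  rw [map_add, map_smul, map_smul, ca_h, ca_h, ev_sr] at h4
  have hpq : q = p := by
    have e1 : pair ![1, 1, 2, 2, 1, 1, 1] 4 = -1 := by decide +kernel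
    have e2 : pair ![1, 1, 2, 2, 2, 1, 0] 4 = 1 := by decide +kernel
    simp only [Pi.add_apply, Pi.smul_apply, e1, e2, smul_eq_mul] at h4
    push_cast at h4
    linear_combination h4
  rw [hpq, ← smul_add, ← map_add] at h3
  have h5 := ((der (e₀ x)).smul_mem_iff hp0).1 h3
  convert h5 using 2
  funext i
  simp [cv]

theorem h_mem (S : Frame x hh) {a : Fin 7 → ℂ} (ha : ∀ s ∈ [0, 4, 5, 6], a s = 0) :
    hh a ∈ der (e₀ x) := by
  have h1 := S.h_mem_der (α := sr 1) (by decide +kernel) (by decide +kernel) (by decide +kernel)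
  have h2 := S.h_mem_der (α := ![1, 2, 2, 4, 3, 2, 1]) (by decide +kernel) (by decide +kernel)
    (by decide +kernel)
  have h3 := S.h_sum_mem
  rw [show pair (sr 1) = ![0, 2, 0, -1, 0, 0, 0] by decide +kernel] at h1
  rw [show pair ![1, 2, 2, 4, 3, 2, 1] = ![0, 0, -1, 1, 0, 0, 0] by decide +kernel] at h2
  rw [show pair ![1, 1, 2, 2, 1, 1, 1] + pair ![1, 1, 2, 2, 2, 1, 0] = ![0, 0, 2, -1, 0, 0, 0] by
    decide +kernel] at h3
  have := add_mem (add_mem ((der (e₀ x)).smul_mem (a 1 / 2) h1)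
    ((der (e₀ x)).smul_mem (a 2 + 2 * a 3 + a 1) h2))
    ((der (e₀ x)).smul_mem (a 2 + a 3 + a 1 / 2) h3)
  simp only [← map_smul, ← map_add] at this
  convert this using 2
  funext i
  have e0 := ha 0 (by simp)
  have e4 := ha 4 (by simp)
  have e5 := ha 5 (by simp)
  have e6 := ha 6 (by simp)
  fin_cases i <;> simp [cv, e0, e4, e5, e6] <;> ring

end Frame

end E7

/-! ### The main result -/

namespace E7

open Module

theorem levi_pos : ∀ β ∈ posL, iv ![0, 1, 1, 1, 0, 0, 0] β = 0 →
    β ∈ [sr 0, sr 4, sr 5, sr 6, sr 4 + sr 5, sr 5 + sr 6, sr 4 + sr 5 + sr 6] := by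
  decide +kernel

theorem levi_neg : ∀ β ∈ posL, iv ![0, 1, 1, 1, 0, 0, 0] β = 0 → 0 < iv m₀ β := by
  decide +kernel

/-- A semisimple endomorphism in the weak sense splits the space into kernel and range. -/
theorem ker_sup_range {V : Type*} [AddCommGroup V] [Module ℂ V] [FiniteDimensional ℂ V]
    (T : End ℂ V) (h : ∀ v, T (T v) = 0 → T v = 0) :
    LinearMap.ker T ⊔ LinearMap.range T = ⊤ := by
  refine Submodule.eq_top_of_disjoint _ _ ?_ ?_
  · rw [add_comm, LinearMap.finrank_range_add_finrank_ker]
  · rw [Submodule.disjoint_def]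
    rintro _ hv ⟨w, rfl⟩
    exact h w hv

namespace Frame

variable {L : Type*} [LieRing L] [LieAlgebra ℂ L] {x : Q → L} {hh : (Fin 7 → ℂ) →ₗ[ℂ] L}

theorem h_lie_h_lie (S : Frame x hh) {a : Fin 7 → ℂ} {v : L} (h : ⁅hh a, ⁅hh a, v⁆⁆ = 0) :
    ⁅hh a, v⁆ = 0 := by
  refine S.ext ?_ fun β _ => ?_
  · rw [S.ca_h_lie, map_zero]
  · have := congrArg (S.co β) h
    rw [S.co_h_lie, S.co_h_lie, map_zero] at this
    rw [S.co_h_lie, map_zero]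
    rcases mul_eq_zero.1 this with h | h
    · rw [h, zero_mul]
    · exact h

theorem e₀_lie_t (S : Frame x hh) : ⁅e₀ x, hh (cv ![0, 1, 1, 1, 0, 0, 0])⁆ = 0 := by
  rw [← lie_skew]
  simp only [e₀, lie_add, S.h_x, ev_sr]
  simp [cv]

theorem mem_of_levi (S : Frame x hh) {u : L} (hu : ⁅e₀ x, u⁆ = 0)
    (ht : ⁅hh (cv ![0, 1, 1, 1, 0, 0, 0]), u⁆ = 0) : u ∈ der (e₀ x) ⊔ Submodule.span ℂ {e₀ x} := by
  have hz : ∀ β, IsRt β → S.co β u ≠ 0 →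
      β ∈ [sr 0, sr 4, sr 5, sr 6, sr 4 + sr 5, sr 5 + sr 6, sr 4 + sr 5 + sr 6] := by
    intro β hβ hne
    have h := S.co_h_lie (cv ![0, 1, 1, 1, 0, 0, 0]) β u
    rw [ht, map_zero, ev_cv, eq_comm, mul_eq_zero, or_iff_left hne] at h
    have h : iv ![0, 1, 1, 1, 0, 0, 0] β = 0 := by exact_mod_cast h
    rcases isRt_iff.1 hβ with hp | hp
    · exact levi_pos β hp h
    · have := levi_neg _ hp (by rw [iv_neg, h, neg_zero])
      rw [iv_neg] at this
      exact absurd (S.co_eq_zero_of_neg hu (by omega)) hne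
  have hrt : ∀ β ∈ [sr 0, sr 4, sr 5, sr 6, sr 4 + sr 5, sr 5 + sr 6, sr 4 + sr 5 + sr 6],
      IsRt β := by decide +kernel
  have hnd : [sr 0, sr 4, sr 5, sr 6, sr 4 + sr 5, sr 5 + sr 6, sr 4 + sr 5 + sr 6].Nodup := by
    decide +kernel
  have hexp : u = hh (S.ca u) +
      ([sr 0, sr 4, sr 5, sr 6, sr 4 + sr 5, sr 5 + sr 6, sr 4 + sr 5 + sr 6].map
        fun β => S.co β u • x β).sum := by
    rw [← List.sum_toFinset _ hnd]
    refine S.ext ?_ fun β hβ => ?_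
    · simp
    · rw [map_add, co_h, zero_add, map_sum]
      by_cases hm : β ∈ [sr 0, sr 4, sr 5, sr 6, sr 4 + sr 5, sr 5 + sr 6, sr 4 + sr 5 + sr 6]
      · rw [Finset.sum_eq_single_of_mem β (List.mem_toFinset.2 hm), map_smul, S.co_x hβ,
          if_pos rfl, smul_eq_mul, mul_one]
        intro γ hγ hne
        rw [map_smul, S.co_x (hrt γ (List.mem_toFinset.1 hγ)), if_neg hne, smul_zero]
      · rw [Finset.sum_eq_zero]
        · by_contra hne
          exact hm (hz β hβ hne)
        · intro γ hγ
          rw [map_smul, S.co_x (hrt γ (List.mem_toFinset.1 hγ)), if_neg, smul_zero]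
          rintro rfl
          exact hm (List.mem_toFinset.1 hγ)
  have hr : ∀ α β : Q, IsRt α ∧ IsRt β ∧ IsRt (α + β) → S.n α β ≠ 0 := fun α β h =>
    S.n_ne_zero h.1 h.2.1 h.2.2
  have hskew : ∀ α β : Q, S.n α β = -S.n β α := by
    intro α β
    rw [n, n, ← lie_skew, map_neg, add_comm]
  have heq : ∀ δ, (∀ t ∈ [0, 4, 5, 6], δ ≠ sr t) → S.n (sr 0) (δ - sr 0) * S.co (δ - sr 0) u +
      S.n (sr 4) (δ - sr 4) * S.co (δ - sr 4) u + S.n (sr 5) (δ - sr 5) * S.co (δ - sr 5) u +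
      S.n (sr 6) (δ - sr 6) * S.co (δ - sr 6) u = 0 := by
    intro δ hδ
    rw [← S.co_e₀_lie hδ, hu, map_zero]
  have h45 : S.co (sr 4) u = S.co (sr 5) u := by
    have h := heq (sr 4 + sr 5) (by decide +kernel)
    rw [S.co_of_not (β := sr 4 + sr 5 - sr 0) (by decide +kernel),
      S.co_of_not (β := sr 4 + sr 5 - sr 6) (by decide +kernel), add_sub_cancel_left,
      add_sub_cancel_right, hskew (sr 5)] at h
    simp only [LinearMap.zero_apply, mul_zero, zero_add, add_zero] at h
    refine mul_left_cancel₀ (hr (sr 4) (sr 5) (by decide +kernel)) ?_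
    linear_combination -h
  have h56 : S.co (sr 5) u = S.co (sr 6) u := by
    have h := heq (sr 5 + sr 6) (by decide +kernel)
    rw [S.co_of_not (β := sr 5 + sr 6 - sr 0) (by decide +kernel),
      S.co_of_not (β := sr 5 + sr 6 - sr 4) (by decide +kernel), add_sub_cancel_left,
      add_sub_cancel_right, hskew (sr 6)] at h
    simp only [LinearMap.zero_apply, mul_zero, zero_add, add_zero] at h
    refine mul_left_cancel₀ (hr (sr 5) (sr 6) (by decide +kernel)) ?_
    linear_combination -h
  have h456 : S.n (sr 6) (sr 4 + sr 5) * S.co (sr 4 + sr 5) u +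
      S.n (sr 4) (sr 5 + sr 6) * S.co (sr 5 + sr 6) u = 0 := by
    have h := heq (sr 4 + sr 5 + sr 6) (by decide +kernel)
    rw [S.co_of_not (β := sr 4 + sr 5 + sr 6 - sr 0) (by decide +kernel),
      S.co_of_not (β := sr 4 + sr 5 + sr 6 - sr 5) (by decide +kernel), add_sub_cancel_right,
      show sr 4 + sr 5 + sr 6 - sr 4 = sr 5 + sr 6 by abel] at h
    simp only [LinearMap.zero_apply, mul_zero, zero_add, add_zero] at h
    linear_combination h
  have h1 : hh (S.ca u) ∈ der (e₀ x) := S.h_mem fun s hs => by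
    rw [← ev_sr (S.ca u) s]
    exact S.ev_ca_eq_zero hu hs
  have h2 := S.comb_mem h456
  have h3 := (der (e₀ x)).smul_mem (S.co (sr 4 + sr 5 + sr 6) u) S.x_top_mem
  have h4 := (der (e₀ x)).smul_mem (S.co (sr 0) u - S.co (sr 6) u) S.x_sr_zero_mem
  have h5 := Submodule.smul_mem _ (S.co (sr 6) u)
    (Submodule.mem_span_singleton_self (R := ℂ) (e₀ x))
  have := Submodule.add_mem_sup (add_mem (add_mem (add_mem h1 h2) h3) h4) h5
  rw [hexp]
  convert this using 1
  simp only [List.map_cons, List.map_nil, List.sum_cons, List.sum_nil, h45, h56, e₀]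
  module

theorem ker_eq (S : Frame x hh) :
    LinearMap.ker (LieAlgebra.ad ℂ L (e₀ x)) = der (e₀ x) ⊔ Submodule.span ℂ {e₀ x} := by
  have := S.finite
  refine le_antisymm (fun y hy => ?_) (sup_le der_le ?_)
  · have hC : ∀ v ∈ LinearMap.ker (LieAlgebra.ad ℂ L (e₀ x)),
        LieAlgebra.ad ℂ L (hh (cv ![0, 1, 1, 1, 0, 0, 0])) v ∈
          LinearMap.ker (LieAlgebra.ad ℂ L (e₀ x)) := fun v hv =>
      der_le (lie_mem_der S.e₀_lie_t hv)
    have hs := ker_sup_range ((LieAlgebra.ad ℂ L (hh (cv ![0, 1, 1, 1, 0, 0, 0]))).restrict hC)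
      fun v hv => Subtype.ext (S.h_lie_h_lie (congrArg Subtype.val hv))
    obtain ⟨u, hu, _, ⟨w, rfl⟩, h⟩ := Submodule.mem_sup.1 (hs ▸ Submodule.mem_top :
      (⟨y, hy⟩ : LinearMap.ker (LieAlgebra.ad ℂ L (e₀ x))) ∈ _)
    have hy : u.1 + ⁅hh (cv ![0, 1, 1, 1, 0, 0, 0]), w.1⁆ = y := congrArg Subtype.val h
    rw [← hy]
    exact add_mem (S.mem_of_levi u.2 (congrArg Subtype.val hu))
      (Submodule.mem_sup_left (lie_mem_der S.e₀_lie_t w.2))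
  · rw [Submodule.span_singleton_le_iff_mem, LinearMap.mem_ker, LieAlgebra.ad_apply, lie_self]

theorem derived_centralizer (S : Frame x hh) {e : L} (he : IsNilpotent (LieAlgebra.ad ℂ L e))
    (hd : finrank ℂ (LinearMap.ker (LieAlgebra.ad ℂ L e)) = 41) :
    finrank ℂ (der e) = 40 ∧ e ∉ der e ∧
      LinearMap.ker (LieAlgebra.ad ℂ L e) = der e ⊔ Submodule.span ℂ {e} := by
  have := S.finite
  obtain ⟨x', hh', S', φ, rfl⟩ := S.exists_e₀ he hd
  have hker : ∀ v, ⁅φ (e₀ x'), φ v⁆ = 0 ↔ ⁅e₀ x', v⁆ = 0 := by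
    intro v
    rw [← LieEquiv.map_lie]
    exact φ.toLinearEquiv.map_eq_zero_iff
  have hsub : ∀ u ∈ der (e₀ x'), φ u ∈ der (φ (e₀ x')) := by
    intro u hu
    have : der (e₀ x') ≤ (der (φ (e₀ x'))).comap (φ.toLinearEquiv : L →ₗ[ℂ] L) := by
      refine Submodule.span_le.2 ?_
      rintro _ ⟨u, hu, v, hv, rfl⟩
      have h := lie_mem_der ((hker u).2 hu) ((hker v).2 hv)
      rw [← LieEquiv.map_lie] at h
      exact h
    exact this hu
  have hsub' : ∀ u ∈ der (φ (e₀ x')), φ.symm u ∈ der (e₀ x') := by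
    intro u hu
    have : der (φ (e₀ x')) ≤ (der (e₀ x')).comap (φ.symm.toLinearEquiv : L →ₗ[ℂ] L) := by
      refine Submodule.span_le.2 ?_
      rintro _ ⟨u, hu, v, hv, rfl⟩
      have hinv : ∀ w, φ (φ.symm w) = w := φ.apply_symm_apply
      have h := lie_mem_der ((hker (φ.symm u)).1 (by rw [hinv]; exact hu))
        ((hker (φ.symm v)).1 (by rw [hinv]; exact hv))
      rw [← LieEquiv.map_lie] at h
      exact h
    exact this hu
  have hnot : φ (e₀ x') ∉ der (φ (e₀ x')) := by
    intro h
    have := hsub' _ h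
    rw [φ.symm_apply_apply] at this
    exact S'.e₀_not_mem this
  have heq : LinearMap.ker (LieAlgebra.ad ℂ L (φ (e₀ x'))) =
      der (φ (e₀ x')) ⊔ Submodule.span ℂ {φ (e₀ x')} := by
    refine le_antisymm (fun y hy => ?_) (sup_le der_le ?_)
    · have hy' : φ.symm y ∈ LinearMap.ker (LieAlgebra.ad ℂ L (e₀ x')) :=
        (hker _).1 (by rw [φ.apply_symm_apply]; exact hy)
      rw [S'.ker_eq] at hy'
      obtain ⟨u, hu, w, hw, h⟩ := Submodule.mem_sup.1 hy'
      obtain ⟨c, rfl⟩ := Submodule.mem_span_singleton.1 hw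
      have hy2 : y = φ u + c • φ (e₀ x') := by
        rw [← φ.apply_symm_apply y, ← h]
        exact (φ.toLinearEquiv.map_add _ _).trans
          (congrArg (φ u + ·) (φ.toLinearEquiv.map_smul _ _))
      rw [hy2]
      exact Submodule.add_mem_sup (hsub u hu)
        (Submodule.smul_mem _ _ (Submodule.mem_span_singleton_self _))
    · rw [Submodule.span_singleton_le_iff_mem, LinearMap.mem_ker, LieAlgebra.ad_apply, lie_self]
  refine ⟨?_, hnot, heq⟩
  have hne : φ (e₀ x') ≠ 0 := fun h => hnot (h ▸ zero_mem _)
  have hdis : der (φ (e₀ x')) ⊓ Submodule.span ℂ {φ (e₀ x')} = ⊥ :=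
    disjoint_iff.1 ((Submodule.disjoint_span_singleton' hne).2 hnot)
  have h := Submodule.finrank_sup_add_finrank_inf_eq (der (φ (e₀ x')))
    (Submodule.span ℂ {φ (e₀ x')})
  rw [← heq, hd, hdis, finrank_bot, finrank_span_singleton hne] at h
  omega

end Frame

end E7

/-- In type E₇, for nilpotent `e` with `dim g_e = 41` one has `dim [g_e,g_e] = 40`,
`e ∉ [g_e,g_e]` and `g_e = [g_e,g_e] + ℂ·e`. -/
theorem dim41_E7 (e : LieAlgebra.e₇ ℂ)
    (hnil : IsNilpotent (LieAlgebra.ad ℂ (LieAlgebra.e₇ ℂ) e))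
    (hdim : Module.finrank ℂ ↥(centralizer e) = 41) :
    Module.finrank ℂ ↥(derived e) = 40 ∧ e ∉ derived e ∧
      centralizer e = derived e ⊔ Submodule.span ℂ {e} := by
  have : Nontrivial (LieAlgebra.e₇ ℂ) := by
    by_contra hn
    rw [not_nontrivial_iff_subsingleton] at hn
    have h0 : Module.finrank ℂ ↥(centralizer e) = 0 := Module.finrank_zero_of_subsingleton
    omega
  obtain ⟨x, h, S⟩ := E7.exists_frame7
  exact S.derived_centralizer hnil hdim
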